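/- Let α ∈ (0,1). There exists s₀ > 3/2 such that for every s > 3s₀, every δ ∈ (0,1] and every K ≥ 1 there exist T > 0 and a Fourier solution u : [0,T] → (ℤ → ℂ) of the quasilinear Schrödinger equation ∂_t u = −i|D|^α u + |u|² u_x on the torus such that ∑_{k∈ℤ} max(1,|k|)^{2s} |u_k(t)|² < ∞ for every t ∈ [0,T], ‖u(0)‖_s ≤ δ, ‖u(T)‖_s ≥ K, and sup_{0 ≤ t ≤ T} ‖u(t)‖_{s₀} ≤ 2δ. -/

import Mathlib

noncomputable section

/-- Sobolev weight `⟨k⟩^{2s} = max(1,|k|)^{2s}`. -/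
def sobWeight (s : ℝ) (k : ℤ) : ℝ := (max 1 |(k : ℝ)|) ^ (2 * s)

/-- Square of the `H^s(𝕋)` norm of a Fourier sequence. -/
def sobNormSq (s : ℝ) (u : ℤ → ℂ) : ℝ := ∑' k : ℤ, sobWeight s k * ‖u k‖ ^ 2

/-- The `H^s(𝕋)` norm of a Fourier sequence. -/
def sobNorm (s : ℝ) (u : ℤ → ℂ) : ℝ := Real.sqrt (sobNormSq s u)

/-- Finiteness of the `H^s` norm, i.e. `∑_k ⟨k⟩^{2s} |u_k|² < ∞`. -/
def HasSobNorm (s : ℝ) (u : ℤ → ℂ) : Prop :=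
  Summable fun k : ℤ => sobWeight s k * ‖u k‖ ^ 2

/-- Absolute convergence of the cubic convolution sum at frequency `k`:
`∑_{k₁-k₂+k₃=k} |k₃| |u_{k₁}| |u_{k₂}| |u_{k₃}| < ∞`. -/
def CubicSummable (u : ℤ → ℂ) (k : ℤ) : Prop :=
  Summable fun p : {p : ℤ × ℤ × ℤ // p.1 - p.2.1 + p.2.2 = k} =>
    |(p.1.2.2 : ℝ)| * ‖u p.1.1‖ * ‖u p.1.2.1‖ * ‖u p.1.2.2‖

/-- The cubic convolution sum `∑_{k₁-k₂+k₃=k} k₃ u_{k₁} \bar u_{k₂} u_{k₃}`. -/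
def cubicSum (u : ℤ → ℂ) (k : ℤ) : ℂ :=
  ∑' p : {p : ℤ × ℤ × ℤ // p.1 - p.2.1 + p.2.2 = k},
    (p.1.2.2 : ℂ) * u p.1.1 * (starRingEnd ℂ) (u p.1.2.1) * u p.1.2.2

/-- `u` is a Fourier solution of `∂ₜ u = - i |D|^α u + |u|² u_x` on the time set `I`. -/
def IsFourierSolution (α : ℝ) (I : Set ℝ) (u : ℝ → ℤ → ℂ) : Prop :=
  ∀ k : ℤ, ∀ t ∈ I,
    CubicSummable (u t) k ∧
      HasDerivWithinAt (fun τ => u τ k)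
        (-Complex.I * Complex.ofReal (|(k : ℝ)| ^ α) * u t k +
          Complex.I * cubicSum (u t) k) I t

/-! Part A -/

noncomputable section

open Complex ComplexConjugate

/-- resonant quadruples -/
def QS (S : Finset ℤ) (e : ℤ) : Finset (ℤ × ℤ × ℤ × ℤ) :=
  (S ×ˢ S ×ˢ S ×ˢ S).filter (fun p => p.1 + p.2.2.1 + e = p.2.1 + p.2.2.2)

lemma mem_QS {S : Finset ℤ} {e : ℤ} {p : ℤ × ℤ × ℤ × ℤ} :
    p ∈ QS S e ↔ (p.1 ∈ S ∧ p.2.1 ∈ S ∧ p.2.2.1 ∈ S ∧ p.2.2.2 ∈ S) ∧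
      p.1 + p.2.2.1 + e = p.2.1 + p.2.2.2 := by
  simp [QS, and_assoc]

lemma base_sum {S : Finset ℤ} {e : ℤ} (π : ℤ × ℤ × ℤ × ℤ → ℤ × ℤ × ℤ)
    (hm : ∀ p ∈ QS S e, π p ∈ S ×ˢ S ×ˢ S)
    (hi : ∀ p ∈ QS S e, ∀ p' ∈ QS S e, π p = π p' → p = p')
    (x y v : ℤ → ℝ) (hx : ∀ k, 0 ≤ x k) (hy : ∀ k, 0 ≤ y k) (hv : ∀ k, 0 ≤ v k) :
    ∑ p ∈ QS S e, x (π p).1 * y (π p).2.1 * v (π p).2.2 ≤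
      (∑ k ∈ S, x k) * (∑ k ∈ S, y k) * (∑ k ∈ S, v k) := by
  have h1 : ∑ p ∈ QS S e, x (π p).1 * y (π p).2.1 * v (π p).2.2 =
      ∑ r ∈ (QS S e).image π, x r.1 * y r.2.1 * v r.2.2 := by
    rw [Finset.sum_image]
    intro p hp p' hp' h
    exact hi p hp p' hp' h
  rw [h1]
  have h2 : ∑ r ∈ S ×ˢ S ×ˢ S, x r.1 * y r.2.1 * v r.2.2 =
      (∑ k ∈ S, x k) * (∑ k ∈ S, y k) * (∑ k ∈ S, v k) := by
    rw [Finset.sum_product]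
    simp_rw [Finset.sum_product, mul_assoc, ← Finset.mul_sum]
    rw [Finset.sum_mul]
    simp_rw [← Finset.sum_mul]
  rw [← h2]
  apply Finset.sum_le_sum_of_subset_of_nonneg
  · intro r hr
    obtain ⟨p, hp, rfl⟩ := Finset.mem_image.1 hr
    exact hm p hp
  · intro r _ _
    exact mul_nonneg (mul_nonneg (hx _) (hy _)) (hv _)

/-- sum over the six pairs -/
def pairSum (x y v : ℤ → ℝ) (p : ℤ × ℤ × ℤ × ℤ) : ℝ :=
  x p.1 * x p.2.1 * (y p.2.2.1 * v p.2.2.2 + v p.2.2.1 * y p.2.2.2)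
  + x p.1 * x p.2.2.1 * (y p.2.1 * v p.2.2.2 + v p.2.1 * y p.2.2.2)
  + x p.1 * x p.2.2.2 * (y p.2.1 * v p.2.2.1 + v p.2.1 * y p.2.2.1)
  + x p.2.1 * x p.2.2.1 * (y p.1 * v p.2.2.2 + v p.1 * y p.2.2.2)
  + x p.2.1 * x p.2.2.2 * (y p.1 * v p.2.2.1 + v p.1 * y p.2.2.1)
  + x p.2.2.1 * x p.2.2.2 * (y p.1 * v p.2.1 + v p.1 * y p.2.1)

lemma sum_pair_aux {S : Finset ℤ} {e : ℤ} (i j l m : ℤ × ℤ × ℤ × ℤ → ℤ)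
    (hmi : ∀ p ∈ QS S e, i p ∈ S ∧ j p ∈ S ∧ l p ∈ S ∧ m p ∈ S)
    (h1 : ∀ p ∈ QS S e, ∀ p' ∈ QS S e, i p = i p' → l p = l p' → m p = m p' → p = p')
    (h2 : ∀ p ∈ QS S e, ∀ p' ∈ QS S e, j p = j p' → l p = l p' → m p = m p' → p = p')
    (x y v : ℤ → ℝ) (hx : ∀ k, 0 ≤ x k) (hy : ∀ k, 0 ≤ y k) (hv : ∀ k, 0 ≤ v k) :
    ∑ p ∈ QS S e, x (i p) * x (j p) * (y (l p) * v (m p) + v (l p) * y (m p)) ≤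
      2 * ((∑ k ∈ S, x k ^ 2) * (∑ k ∈ S, y k) * (∑ k ∈ S, v k)) := by
  have A := fun (y v : ℤ → ℝ) (hy : ∀ k, 0 ≤ y k) (hv : ∀ k, 0 ≤ v k) =>
    base_sum (S := S) (e := e) (fun p => (i p, l p, m p))
    (by intro p hp; simpa using ⟨(hmi p hp).1, (hmi p hp).2.2⟩)
    (by intro p hp p' hp' h; simp only [Prod.mk.injEq] at h
        exact h1 p hp p' hp' h.1 h.2.1 h.2.2) (fun k => x k ^ 2) y v
        (fun k => by positivity) hy hv
  have B := fun (y v : ℤ → ℝ) (hy : ∀ k, 0 ≤ y k) (hv : ∀ k, 0 ≤ v k) =>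
    base_sum (S := S) (e := e) (fun p => (j p, l p, m p))
    (by intro p hp; simpa using ⟨(hmi p hp).2.1, (hmi p hp).2.2⟩)
    (by intro p hp p' hp' h; simp only [Prod.mk.injEq] at h
        exact h2 p hp p' hp' h.1 h.2.1 h.2.2) (fun k => x k ^ 2) y v
        (fun k => by positivity) hy hv
  have A1 := A y v hy hv
  have A2 := A v y hv hy
  have B1 := B y v hy hv
  have B2 := B v y hv hy
  simp only at A1 A2 B1 B2
  have : ∑ p ∈ QS S e, x (i p) * x (j p) * (y (l p) * v (m p) + v (l p) * y (m p)) ≤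
     ∑ p ∈ QS S e, (1/2) * (x (i p) ^ 2 * y (l p) * v (m p) + x (i p) ^ 2 * v (l p) * y (m p)
      + (x (j p) ^ 2 * y (l p) * v (m p) + x (j p) ^ 2 * v (l p) * y (m p))) := by
    apply Finset.sum_le_sum
    intro p _
    have h := two_mul_le_add_sq (x (i p)) (x (j p))
    have h0 : 0 ≤ y (l p) * v (m p) + v (l p) * y (m p) :=
      add_nonneg (mul_nonneg (hy _) (hv _)) (mul_nonneg (hv _) (hy _))
    nlinarith [mul_le_mul_of_nonneg_right h h0]
  rw [← Finset.mul_sum, Finset.sum_add_distrib, Finset.sum_add_distrib,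
    Finset.sum_add_distrib] at this
  have e1 : (∑ k ∈ S, x k ^ 2) * (∑ k ∈ S, v k) * (∑ k ∈ S, y k) =
     (∑ k ∈ S, x k ^ 2) * (∑ k ∈ S, y k) * (∑ k ∈ S, v k) := by ring
  rw [e1] at A2 B2
  linarith

lemma sum_pairSum_le {S : Finset ℤ} {e : ℤ} 
    (x y v : ℤ → ℝ) (hx : ∀ k, 0 ≤ x k) (hy : ∀ k, 0 ≤ y k) (hv : ∀ k, 0 ≤ v k) :
    ∑ p ∈ QS S e, pairSum x y v p ≤
      12 * ((∑ k ∈ S, x k ^ 2) * (∑ k ∈ S, y k) * (∑ k ∈ S, v k)) := by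
  unfold pairSum
  simp only [Finset.sum_add_distrib]
  have H := fun (i j l m : ℤ × ℤ × ℤ × ℤ → ℤ) a b c => sum_pair_aux (S := S) (e := e) i j l m a b c x y v hx hy hv
  have H1 := H (fun p => p.1) (fun p => p.2.1) (fun p => p.2.2.1) (fun p => p.2.2.2)
    (by intro p hp; have := mem_QS.1 hp; tauto)
    (by rintro ⟨a, b, c, d⟩ hp ⟨a', b', c', d'⟩ hp' h1 h2 h3
        have := (mem_QS.1 hp).2; have := (mem_QS.1 hp').2
        simp only [Prod.mk.injEq] at *; omega)
    (by rintro ⟨a, b, c, d⟩ hp ⟨a', b', c', d'⟩ hp' h1 h2 h3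
        have := (mem_QS.1 hp).2; have := (mem_QS.1 hp').2
        simp only [Prod.mk.injEq] at *; omega)
  have H2 := H (fun p => p.1) (fun p => p.2.2.1) (fun p => p.2.1) (fun p => p.2.2.2)
    (by intro p hp; have := mem_QS.1 hp; tauto)
    (by rintro ⟨a, b, c, d⟩ hp ⟨a', b', c', d'⟩ hp' h1 h2 h3
        have := (mem_QS.1 hp).2; have := (mem_QS.1 hp').2
        simp only [Prod.mk.injEq] at *; omega)
    (by rintro ⟨a, b, c, d⟩ hp ⟨a', b', c', d'⟩ hp' h1 h2 h3
        have := (mem_QS.1 hp).2; have := (mem_QS.1 hp').2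
        simp only [Prod.mk.injEq] at *; omega)
  have H3 := H (fun p => p.1) (fun p => p.2.2.2) (fun p => p.2.1) (fun p => p.2.2.1)
    (by intro p hp; have := mem_QS.1 hp; tauto)
    (by rintro ⟨a, b, c, d⟩ hp ⟨a', b', c', d'⟩ hp' h1 h2 h3
        have := (mem_QS.1 hp).2; have := (mem_QS.1 hp').2
        simp only [Prod.mk.injEq] at *; omega)
    (by rintro ⟨a, b, c, d⟩ hp ⟨a', b', c', d'⟩ hp' h1 h2 h3
        have := (mem_QS.1 hp).2; have := (mem_QS.1 hp').2
        simp only [Prod.mk.injEq] at *; omega)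
  have H4 := H (fun p => p.2.1) (fun p => p.2.2.1) (fun p => p.1) (fun p => p.2.2.2)
    (by intro p hp; have := mem_QS.1 hp; tauto)
    (by rintro ⟨a, b, c, d⟩ hp ⟨a', b', c', d'⟩ hp' h1 h2 h3
        have := (mem_QS.1 hp).2; have := (mem_QS.1 hp').2
        simp only [Prod.mk.injEq] at *; omega)
    (by rintro ⟨a, b, c, d⟩ hp ⟨a', b', c', d'⟩ hp' h1 h2 h3
        have := (mem_QS.1 hp).2; have := (mem_QS.1 hp').2
        simp only [Prod.mk.injEq] at *; omega)
  have H5 := H (fun p => p.2.1) (fun p => p.2.2.2) (fun p => p.1) (fun p => p.2.2.1)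
    (by intro p hp; have := mem_QS.1 hp; tauto)
    (by rintro ⟨a, b, c, d⟩ hp ⟨a', b', c', d'⟩ hp' h1 h2 h3
        have := (mem_QS.1 hp).2; have := (mem_QS.1 hp').2
        simp only [Prod.mk.injEq] at *; omega)
    (by rintro ⟨a, b, c, d⟩ hp ⟨a', b', c', d'⟩ hp' h1 h2 h3
        have := (mem_QS.1 hp).2; have := (mem_QS.1 hp').2
        simp only [Prod.mk.injEq] at *; omega)
  have H6 := H (fun p => p.2.2.1) (fun p => p.2.2.2) (fun p => p.1) (fun p => p.2.1)
    (by intro p hp; have := mem_QS.1 hp; tauto)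
    (by rintro ⟨a, b, c, d⟩ hp ⟨a', b', c', d'⟩ hp' h1 h2 h3
        have := (mem_QS.1 hp).2; have := (mem_QS.1 hp').2
        simp only [Prod.mk.injEq] at *; omega)
    (by rintro ⟨a, b, c, d⟩ hp ⟨a', b', c', d'⟩ hp' h1 h2 h3
        have := (mem_QS.1 hp).2; have := (mem_QS.1 hp').2
        simp only [Prod.mk.injEq] at *; omega)
  linarith
end

/-! Part B -/

noncomputable section

lemma sum_le_two_mul {a b : ℝ} (ha : 1 ≤ a) (hb : 1 ≤ b) : a + b ≤ 2 * (a * b) := by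
  nlinarith [mul_nonneg (sub_nonneg.2 ha) (sub_nonneg.2 hb)]

lemma sym_core_key {k1 k3 e A1 A3 w1 w3 D : ℝ} (hk1 : 1 ≤ |k1|) (hk3 : 1 ≤ |k3|)
    (h3 : |k3| ≤ |k1|) (he : |e| ≤ 2) (hD : 1 ≤ D) (hw1 : 0 ≤ w1) (hw3 : 0 ≤ w3)
    (hA1 : |A1| ≤ D * w1 ^ 2) (hA3 : |A3| ≤ D * w3 ^ 2) (hm3 : w3 ≤ w1)
    {k2 k4 A2 A4 w2 w4 : ℝ} (hk2 : 1 ≤ |k2|) (hk4 : 1 ≤ |k4|) (h2 : |k2| ≤ |k1|)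
    (heq : k1 + k3 + e = k2 + k4) (hw2 : 0 ≤ w2) (hw4 : 0 ≤ w4) (hm2 : w2 ≤ w1) (hm4 : w4 ≤ w1)
    (hA2 : |A2| ≤ D * w2 ^ 2) (hA4 : |A4| ≤ D * w4 ^ 2) (hj : |k1| ≤ 5 * |k2|) (hwD : w1 ≤ D * w2)
    (hdiff : |k1| * |A1 - A2| ≤ D * (|k1 - k2| + 2) * w1 ^ 2) :
      |(k1 + k3) * (A2 + A4) - (k2 + k4) * (A1 + A3)| ≤
      40 * D ^ 2 * (w1 * w2 * (|k3| * |k4|) + w1 * w3 * (|k2| * |k4|) + w1 * w4 * (|k2| * |k3|)) := by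
  have hD2 : D ≤ D ^ 2 := by nlinarith
  have e1 : (k1 + k3) * (A2 + A4) - (k2 + k4) * (A1 + A3) =
    (k1 + k3) * (A2 - A1) + (k1 + k3) * A4 - (k1 + k3) * A3 - e * (A1 + A3) := by
    rw [← heq]; ring
  rw [e1]
  have q : |k1 + k3| ≤ 2 * |k1| := (abs_add_le _ _).trans (by linarith)
  have p34 : 1 ≤ |k3| * |k4| := one_le_mul_of_one_le_of_one_le hk3 hk4
  have s34 : |k3| + |k4| ≤ 2 * (|k3| * |k4|) := sum_le_two_mul hk3 hk4
  have d12 : |k1 - k2| + 2 ≤ 6 * (|k3| * |k4|) := by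
    have : k1 - k2 = k4 - k3 - e := by linarith
    rw [this]
    have := abs_sub (k4 - k3) e
    have := abs_sub k4 k3
    linarith
  have t1 : |(k1 + k3) * (A2 - A1)| ≤ 12 * D ^ 2 * (w1 * w2 * (|k3| * |k4|)) := by
    rw [abs_mul, abs_sub_comm A2 A1]
    have : |k1 + k3| * |A1 - A2| ≤ 2 * (|k1| * |A1 - A2|) := by
      nlinarith [abs_nonneg (A1 - A2)]
    have h6 : D * (|k1 - k2| + 2) * w1 ^ 2 ≤ D * (6 * (|k3| * |k4|)) * (w1 * (D * w2)) := by
      have : w1 ^ 2 ≤ w1 * (D * w2) := by rw [sq]; gcongr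
      gcongr
    have e2 : D * (6 * (|k3| * |k4|)) * (w1 * (D * w2)) = 6 * D ^ 2 * (w1 * w2 * (|k3| * |k4|)) := by ring
    linarith
  have t2 : |(k1 + k3) * A4| ≤ 10 * D ^ 2 * (w1 * w4 * (|k2| * |k3|)) := by
    rw [abs_mul]
    have c1 : |k1 + k3| ≤ 10 * (|k2| * |k3|) := by
      have := le_mul_of_one_le_right (abs_nonneg k2) hk3
      linarith
    have c2 : |A4| ≤ D ^ 2 * (w1 * w4) := by
      have : w4 ^ 2 ≤ w1 * w4 := by rw [sq]; gcongr
      calc |A4| ≤ D * w4 ^ 2 := hA4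
        _ ≤ D ^ 2 * (w1 * w4) := by gcongr
    calc _ ≤ 10 * (|k2| * |k3|) * (D ^ 2 * (w1 * w4)) := by gcongr
      _ = _ := by ring
  have t3 : |(k1 + k3) * A3| ≤ 10 * D ^ 2 * (w1 * w3 * (|k2| * |k4|)) := by
    rw [abs_mul]
    have c1 : |k1 + k3| ≤ 10 * (|k2| * |k4|) := by
      have := le_mul_of_one_le_right (abs_nonneg k2) hk4
      linarith
    have c2 : |A3| ≤ D ^ 2 * (w1 * w3) := by
      have : w3 ^ 2 ≤ w1 * w3 := by rw [sq]; gcongr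
      calc |A3| ≤ D * w3 ^ 2 := hA3
        _ ≤ D ^ 2 * (w1 * w3) := by gcongr
    calc _ ≤ 10 * (|k2| * |k4|) * (D ^ 2 * (w1 * w3)) := by gcongr
      _ = _ := by ring
  have t4 : |e * (A1 + A3)| ≤ 4 * D ^ 2 * (w1 * w2 * (|k3| * |k4|)) := by
    rw [abs_mul]
    have c2 : |A1 + A3| ≤ 2 * (D * (w1 * (D * w2))) := by
      have : w1 ^ 2 ≤ w1 * (D * w2) := by rw [sq]; gcongr
      have h3' : w3 ^ 2 ≤ w1 ^ 2 := by gcongr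
      have := abs_add_le A1 A3
      have g1 : D * w1 ^ 2 ≤ D * (w1 * (D * w2)) := by gcongr
      have g2 : D * w3 ^ 2 ≤ D * w1 ^ 2 := by gcongr
      linarith
    have : |e| * |A1 + A3| ≤ 2 * (2 * (D * (w1 * (D * w2)))) := by gcongr
    have : D ^ 2 * (w1 * w2) * 1 ≤ D ^ 2 * (w1 * w2) * (|k3| * |k4|) := by gcongr
    have e2 : 2 * (2 * (D * (w1 * (D * w2)))) = 4 * (D ^ 2 * (w1 * w2) * 1) := by ring
    linarith
  have := abs_sub ((k1 + k3) * (A2 - A1) + (k1 + k3) * A4 - (k1 + k3) * A3) (e * (A1 + A3))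
  have := abs_sub ((k1 + k3) * (A2 - A1) + (k1 + k3) * A4) ((k1 + k3) * A3)
  have := abs_add_le ((k1 + k3) * (A2 - A1)) ((k1 + k3) * A4)
  have : 0 ≤ D ^ 2 * (w1 * w2 * (|k3| * |k4|)) := by positivity
  have : 0 ≤ D ^ 2 * (w1 * w3 * (|k2| * |k4|)) := by positivity
  have : 0 ≤ D ^ 2 * (w1 * w4 * (|k2| * |k3|)) := by positivity
  linarith

lemma sym_core {k1 k2 k3 k4 e A1 A2 A3 A4 w1 w2 w3 w4 D : ℝ}
    (hk1 : 1 ≤ |k1|) (hk2 : 1 ≤ |k2|) (hk3 : 1 ≤ |k3|) (hk4 : 1 ≤ |k4|)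
    (h2 : |k2| ≤ |k1|) (h3 : |k3| ≤ |k1|) (h4 : |k4| ≤ |k1|) (he : |e| ≤ 2)
    (heq : k1 + k3 + e = k2 + k4) (hD : 1 ≤ D)
    (hw1 : 0 ≤ w1) (hw2 : 0 ≤ w2) (hw3 : 0 ≤ w3) (hw4 : 0 ≤ w4)
    (hA1 : |A1| ≤ D * w1 ^ 2) (hA2 : |A2| ≤ D * w2 ^ 2) (hA3 : |A3| ≤ D * w3 ^ 2)
    (hA4 : |A4| ≤ D * w4 ^ 2)
    (hm2 : w2 ≤ w1) (hm3 : w3 ≤ w1) (hm4 : w4 ≤ w1)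
    (hd2 : |k1| ≤ 5 * |k2| → w1 ≤ D * w2) (hd3 : |k1| ≤ 5 * |k3| → w1 ≤ D * w3)
    (hd4 : |k1| ≤ 5 * |k4| → w1 ≤ D * w4)
    (hA12 : |k1| ≤ 5 * |k2| → |k1| * |A1 - A2| ≤ D * (|k1 - k2| + 2) * w1 ^ 2)
    (hA14 : |k1| ≤ 5 * |k4| → |k1| * |A1 - A4| ≤ D * (|k1 - k4| + 2) * w1 ^ 2) :
    |(k1 + k3) * (A2 + A4) - (k2 + k4) * (A1 + A3)| ≤
      40 * D ^ 2 * (w1 * w2 * (|k3| * |k4|) + w1 * w3 * (|k2| * |k4|) + w1 * w4 * (|k2| * |k3|)) := by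
  have b12 : 0 ≤ w1 * w2 := by positivity
  have b13 : 0 ≤ w1 * w3 := by positivity
  have b14 : 0 ≤ w1 * w4 := by positivity
  have hD2 : D ≤ D ^ 2 := by nlinarith
  by_cases c2 : |k1| ≤ 5 * |k2|
  · exact sym_core_key hk1 hk3 h3 he hD hw1 hw3 hA1 hA3 hm3 hk2 hk4 h2 heq hw2 hw4 hm2 hm4 hA2 hA4 c2 (hd2 c2) (hA12 c2)
  by_cases c4 : |k1| ≤ 5 * |k4|
  · have := sym_core_key hk1 hk3 h3 he hD hw1 hw3 hA1 hA3 hm3 hk4 hk2 h4 (by linarith : k1 + k3 + e = k4 + k2) hw4 hw2 hm4 hm2 hA4 hA2 c4 (hd4 c4) (hA14 c4)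
    rw [add_comm A4 A2, add_comm k4 k2] at this
    refine this.trans (le_of_eq ?_)
    ring
  have c3 : |k1| ≤ 5 * |k3| := by
    have : k1 = k2 + k4 - k3 - e := by linarith
    have h := abs_sub (k2 + k4 - k3) e
    have := abs_sub (k2 + k4) k3
    have := abs_add_le k2 k4
    rw [← (by linarith : k1 = k2 + k4 - k3 - e)] at h
    push Not at c2 c4
    linarith
  have hw := hd3 c3
  have p24 : 1 ≤ |k2| * |k4| := one_le_mul_of_one_le_of_one_le hk2 hk4
  have s24 : |k2| + |k4| ≤ 2 * (|k2| * |k4|) := sum_le_two_mul hk2 hk4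
  have q1 : |k2 + k4| ≤ 2 * (|k2| * |k4|) := (abs_add_le _ _).trans s24
  have q2 : |k1 + k3| ≤ 4 * (|k2| * |k4|) := by
    have : k1 + k3 = (k2 + k4) - e := by linarith
    rw [this]
    have := abs_sub (k2 + k4) e
    linarith
  have hw13 : w1 ^ 2 ≤ w1 * (D * w3) := by rw [sq]; gcongr
  have g1 : D * w1 ^ 2 ≤ D * (w1 * (D * w3)) := by gcongr
  have c5 : |A1 + A3| ≤ 2 * (D * (w1 * (D * w3))) := by
    have h3' : w3 ^ 2 ≤ w1 ^ 2 := by gcongr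
    have := abs_add_le A1 A3
    have g2 : D * w3 ^ 2 ≤ D * w1 ^ 2 := by gcongr
    linarith
  have c6 : |A2 + A4| ≤ 2 * (D * (w1 * (D * w3))) := by
    have h3' : w2 ^ 2 ≤ w1 ^ 2 := by gcongr
    have h3' : w4 ^ 2 ≤ w1 ^ 2 := by gcongr
    have := abs_add_le A2 A4
    have g2 : D * w2 ^ 2 ≤ D * w1 ^ 2 := by gcongr
    have g3 : D * w4 ^ 2 ≤ D * w1 ^ 2 := by gcongr
    linarith
  have t1 : |(k1 + k3) * (A2 + A4)| ≤ 4 * (|k2| * |k4|) * (2 * (D * (w1 * (D * w3)))) := by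
    rw [abs_mul]; gcongr
  have t2 : |(k2 + k4) * (A1 + A3)| ≤ 2 * (|k2| * |k4|) * (2 * (D * (w1 * (D * w3)))) := by
    rw [abs_mul]; gcongr
  have := abs_sub ((k1 + k3) * (A2 + A4)) ((k2 + k4) * (A1 + A3))
  have : 0 ≤ D ^ 2 * (w1 * w2 * (|k3| * |k4|)) := by positivity
  have : 0 ≤ D ^ 2 * (w1 * w3 * (|k2| * |k4|)) := by positivity
  have : 0 ≤ D ^ 2 * (w1 * w4 * (|k2| * |k3|)) := by positivity
  have e2 : 4 * (|k2| * |k4|) * (2 * (D * (w1 * (D * w3)))) = 8 * (D ^ 2 * (w1 * w3 * (|k2| * |k4|))) := by ring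
  have e3 : 2 * (|k2| * |k4|) * (2 * (D * (w1 * (D * w3)))) = 4 * (D ^ 2 * (w1 * w3 * (|k2| * |k4|))) := by ring
  linarith

/-- the symmetrised symbol -/
def symb (a : ℤ → ℝ) (e : ℤ) (p : ℤ × ℤ × ℤ × ℤ) : ℝ :=
  ((p.1 : ℝ) + p.2.2.1) * (a (p.2.1 - e) + a (p.2.2.2 - e))
    - ((p.2.1 : ℝ) + p.2.2.2) * (a p.1 + a p.2.2.1)

/-- Admissible weights. -/
structure Adm (a : ℤ → ℝ) (e : ℤ) (w : ℤ → ℝ) (D : ℝ) : Prop where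
  hD : 1 ≤ D
  he : |e| ≤ 2
  w0 : ∀ k, 0 ≤ w k
  ub : ∀ k : ℤ, Odd k → |a k| ≤ D * w k ^ 2 
  ub' : ∀ k : ℤ, Odd k → |a (k - e)| ≤ D * w k ^ 2 
  mono : ∀ k l : ℤ, |k| ≤ |l| → w k ≤ w l
  dbl : ∀ k l : ℤ, Odd k → Odd l → |l| ≤ 5 * |k| → w l ≤ D * w k
  dif : ∀ k l : ℤ, Odd k → Odd l → |k| ≤ |l| → |l| ≤ 5 * |k| → 
      |(l : ℝ)| * |a l - a (k - e)| ≤ D * (|(l : ℝ) - k| + 2) * w l ^ 2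
  dif' : ∀ k l : ℤ, Odd k → Odd l → |k| ≤ |l| → |l| ≤ 5 * |k| → 
      |(l : ℝ)| * |a (l - e) - a k| ≤ D * (|(l : ℝ) - k| + 2) * w l ^ 2

lemma odd_abs_ge {k : ℤ} (h : Odd k) : (1 : ℝ) ≤ |(k : ℝ)| := by
  have h0 : k ≠ 0 := by rintro rfl; simp at h
  have := Int.one_le_abs h0
  exact_mod_cast this

lemma symb_bound {a : ℤ → ℝ} {e : ℤ} {w : ℤ → ℝ} {D : ℝ} (H : Adm a e w D)
    (p : ℤ × ℤ × ℤ × ℤ) (h1 : Odd p.1) (h2 : Odd p.2.1) (h3 : Odd p.2.2.1) (h4 : Odd p.2.2.2)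
    (heq : p.1 + p.2.2.1 + e = p.2.1 + p.2.2.2) :
    |symb a e p| ≤ 40 * D ^ 2 * (
      w p.1 * w p.2.1 * (|(p.2.2.1 : ℝ)| * |(p.2.2.2 : ℝ)|)
      + w p.1 * w p.2.2.1 * (|(p.2.1 : ℝ)| * |(p.2.2.2 : ℝ)|)
      + w p.1 * w p.2.2.2 * (|(p.2.1 : ℝ)| * |(p.2.2.1 : ℝ)|)
      + w p.2.1 * w p.2.2.1 * (|(p.1 : ℝ)| * |(p.2.2.2 : ℝ)|)
      + w p.2.1 * w p.2.2.2 * (|(p.1 : ℝ)| * |(p.2.2.1 : ℝ)|)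
      + w p.2.2.1 * w p.2.2.2 * (|(p.1 : ℝ)| * |(p.2.1 : ℝ)|)) := by
  obtain ⟨k1, k2, k3, k4⟩ := p
  simp only [symb] at *
  have P12 : 0 ≤ 40 * D ^ 2 * (w k1 * w k2 * (|(k3 : ℝ)| * |(k4 : ℝ)|)) := by
    have := H.w0 k1; have := H.w0 k2; positivity
  have P13 : 0 ≤ 40 * D ^ 2 * (w k1 * w k3 * (|(k2 : ℝ)| * |(k4 : ℝ)|)) := by
    have := H.w0 k1; have := H.w0 k3; positivity
  have P14 : 0 ≤ 40 * D ^ 2 * (w k1 * w k4 * (|(k2 : ℝ)| * |(k3 : ℝ)|)) := by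
    have := H.w0 k1; have := H.w0 k4; positivity
  have P23 : 0 ≤ 40 * D ^ 2 * (w k2 * w k3 * (|(k1 : ℝ)| * |(k4 : ℝ)|)) := by
    have := H.w0 k2; have := H.w0 k3; positivity
  have P24 : 0 ≤ 40 * D ^ 2 * (w k2 * w k4 * (|(k1 : ℝ)| * |(k3 : ℝ)|)) := by
    have := H.w0 k2; have := H.w0 k4; positivity
  have P34 : 0 ≤ 40 * D ^ 2 * (w k3 * w k4 * (|(k1 : ℝ)| * |(k2 : ℝ)|)) := by
    have := H.w0 k3; have := H.w0 k4; positivity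
  have c : ∀ {k l : ℤ}, |k| ≤ |l| → |(k : ℝ)| ≤ |(l : ℝ)| := by
    intro k l h; exact_mod_cast h
  have c5 : ∀ {k l : ℤ}, |(l : ℝ)| ≤ 5 * |(k : ℝ)| → |l| ≤ 5 * |k| := by
    intro k l h; exact_mod_cast h
  have heR : |(e : ℝ)| ≤ 2 := by exact_mod_cast H.he
  have heR' : |(-e : ℝ)| ≤ 2 := by rw [abs_neg]; exact heR
  have hq : (k1 : ℝ) + k3 + e = k2 + k4 := by exact_mod_cast heq
  have side : ∀ {k1 k2 k3 k4 : ℤ}, Odd k1 → Odd k2 → Odd k3 → Odd k4 → (k1 : ℝ) + k3 + e = k2 + k4 →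
     |k2| ≤ |k1| → |k3| ≤ |k1| → |k4| ≤ |k1| → 
     |((k1 : ℝ) + k3) * (a (k2 - e) + a (k4 - e)) - ((k2 : ℝ) + k4) * (a k1 + a k3)| ≤ 
      40 * D ^ 2 * (w k1 * w k2 * (|(k3 : ℝ)| * |(k4 : ℝ)|) + w k1 * w k3 * (|(k2 : ℝ)| * |(k4 : ℝ)|) + w k1 * w k4 * (|(k2 : ℝ)| * |(k3 : ℝ)|)) := by
    intro k1 k2 k3 k4 h1 h2 h3 h4 hq a2 a3 a4
    exact sym_core (odd_abs_ge h1) (odd_abs_ge h2) (odd_abs_ge h3) (odd_abs_ge h4) (c a2) (c a3) (c a4)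
      heR hq H.hD (H.w0 _) (H.w0 _) (H.w0 _) (H.w0 _) (H.ub _ h1) (H.ub' _ h2) (H.ub _ h3) (H.ub' _ h4)
      (H.mono _ _ a2) (H.mono _ _ a3) (H.mono _ _ a4) (fun h => H.dbl _ _ h2 h1 (c5 h))
      (fun h => H.dbl _ _ h3 h1 (c5 h)) (fun h => H.dbl _ _ h4 h1 (c5 h))
      (fun h => H.dif _ _ h2 h1 a2 (c5 h)) (fun h => H.dif _ _ h4 h1 a4 (c5 h))
  have side' : ∀ {k1 k2 k3 k4 : ℤ}, Odd k1 → Odd k2 → Odd k3 → Odd k4 → (k1 : ℝ) + k3 + e = k2 + k4 →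
     |k1| ≤ |k2| → |k3| ≤ |k2| → |k4| ≤ |k2| → 
     |((k2 : ℝ) + k4) * (a k1 + a k3) - ((k1 : ℝ) + k3) * (a (k2 - e) + a (k4 - e))| ≤ 
      40 * D ^ 2 * (w k2 * w k1 * (|(k4 : ℝ)| * |(k3 : ℝ)|) + w k2 * w k4 * (|(k1 : ℝ)| * |(k3 : ℝ)|) + w k2 * w k3 * (|(k1 : ℝ)| * |(k4 : ℝ)|)) := by
    intro k1 k2 k3 k4 h1 h2 h3 h4 hq a1 a3 a4
    exact sym_core (odd_abs_ge h2) (odd_abs_ge h1) (odd_abs_ge h4) (odd_abs_ge h3) (c a1) (c a4) (c a3)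
      heR' (by linarith) H.hD (H.w0 _) (H.w0 _) (H.w0 _) (H.w0 _) (H.ub' _ h2) (H.ub _ h1) (H.ub' _ h4) (H.ub _ h3)
      (H.mono _ _ a1) (H.mono _ _ a4) (H.mono _ _ a3) (fun h => H.dbl _ _ h1 h2 (c5 h))
      (fun h => H.dbl _ _ h4 h2 (c5 h)) (fun h => H.dbl _ _ h3 h2 (c5 h))
      (fun h => H.dif' _ _ h1 h2 a1 (c5 h)) (fun h => H.dif' _ _ h3 h2 a3 (c5 h))
  have cases4 : (|k2| ≤ |k1| ∧ |k3| ≤ |k1| ∧ |k4| ≤ |k1|) ∨ (|k1| ≤ |k2| ∧ |k3| ≤ |k2| ∧ |k4| ≤ |k2|)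
    ∨ (|k1| ≤ |k3| ∧ |k2| ≤ |k3| ∧ |k4| ≤ |k3|) ∨ (|k1| ≤ |k4| ∧ |k2| ≤ |k4| ∧ |k3| ≤ |k4|) := by omega
  rcases cases4 with ⟨x, y, z⟩ | ⟨x, y, z⟩ | ⟨x, y, z⟩ | ⟨x, y, z⟩
  · have := side h1 h2 h3 h4 hq x y z
    linarith
  · have := side' h1 h2 h3 h4 hq x y z
    rw [abs_sub_comm] at this
    linarith
  · have := side h3 h2 h1 h4 (by linarith) y x z
    rw [add_comm (k3 : ℝ), add_comm (a k3)] at this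
    linarith
  · have := side' h1 h4 h3 h2 (by linarith) x z y
    rw [abs_sub_comm, add_comm (k4 : ℝ), add_comm (a (k4 - e))] at this
    linarith
end

/-! Part C -/

noncomputable section

/-- truncated weight -/
def wR (σ R : ℝ) (k : ℤ) : ℝ := (min |(k : ℝ)| R) ^ σ

lemma rpow_sub_le {p x M : ℝ} (hp : 1 ≤ p) (hx : 0 ≤ x) (hM : 0 < M) (hxM : x ≤ M) :
    M * (M ^ p - x ^ p) ≤ p * (M - x) * M ^ p := by
  have h := one_add_mul_self_le_rpow_one_add (s := x / M - 1) (by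
    have : 0 ≤ x / M := by positivity
    linarith) hp
  have e : (1 + (x / M - 1)) ^ p = x ^ p / M ^ p := by
    rw [← Real.div_rpow hx hM.le]; congr 1; ring
  rw [e] at h
  have hMp : 0 < M ^ p := Real.rpow_pos_of_pos hM p
  rw [le_div_iff₀ hMp] at h
  have h2 := mul_le_mul_of_nonneg_left h hM.le
  have e3 : M * ((1 + p * (x / M - 1)) * M ^ p) = M * M ^ p - p * (M - x) * M ^ p := by
    field_simp
    ring
  rw [e3] at h2
  linarith

lemma wR_nonneg {σ R : ℝ} (hR : 1 ≤ R) (k : ℤ) : 0 ≤ wR σ R k :=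
  Real.rpow_nonneg (le_min (abs_nonneg _) (by linarith)) _

lemma adm_min {σ R : ℝ} (hσ : 1 / 2 ≤ σ) (hR : 1 ≤ R) :
    Adm (fun k => wR σ R k ^ 2) 0 (wR σ R) ((5 : ℝ) ^ σ + 2 * σ + 1) := by
  have h5 : 0 < (5 : ℝ) ^ σ := by positivity
  have D1 : 1 ≤ (5 : ℝ) ^ σ + 2 * σ + 1 := by linarith
  have ub : ∀ k : ℤ, Odd k → |wR σ R k ^ 2| ≤ ((5 : ℝ) ^ σ + 2 * σ + 1) * wR σ R k ^ 2 := by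
    intro k _
    rw [abs_of_nonneg (by positivity)]
    exact le_mul_of_one_le_left (by positivity) D1
  have dif : ∀ k l : ℤ, Odd k → Odd l → |k| ≤ |l| → |l| ≤ 5 * |k| → 
      |(l : ℝ)| * |wR σ R l ^ 2 - wR σ R k ^ 2| ≤ 
      ((5 : ℝ) ^ σ + 2 * σ + 1) * (|(l : ℝ) - k| + 2) * wR σ R l ^ 2 := by
    intro k l hk hl hkl _
    have hk1 := odd_abs_ge hk
    have hl1 := odd_abs_ge hl
    have hkl' : |(k : ℝ)| ≤ |(l : ℝ)| := by exact_mod_cast hkl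
    have hd : |(l : ℝ)| - |(k : ℝ)| ≤ |(l : ℝ) - k| := abs_sub_abs_le_abs_sub _ _
    unfold wR
    set x := |(k : ℝ)|
    set y := |(l : ℝ)|
    have m0 : 0 < min x R := lt_min (by linarith) (by linarith)
    have M0 : 0 < min y R := lt_min (by linarith) (by linarith)
    have mM : min x R ≤ min y R := min_le_min_right _ hkl'
    have e : ∀ z : ℝ, 0 < z → (z ^ σ) ^ 2 = z ^ (2 * σ) := by
      intro z hz
      rw [← Real.rpow_natCast, ← Real.rpow_mul hz.le]; congr 1; push_cast; ring
    rw [e _ m0, e _ M0]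
    have mono : (min x R) ^ (2 * σ) ≤ (min y R) ^ (2 * σ) :=
      Real.rpow_le_rpow m0.le mM (by linarith)
    rw [abs_of_nonneg (by linarith)]
    have B := rpow_sub_le (p := 2 * σ) (by linarith) m0.le M0 mM
    have hMp : 0 < (min y R) ^ (2 * σ) := Real.rpow_pos_of_pos M0 _
    have key : y * (min y R ^ (2 * σ) - min x R ^ (2 * σ)) ≤ 2 * σ * (y - x) * min y R ^ (2 * σ) := by
      rcases le_total y R with h | h
      · have hx : x ≤ R := hkl'.trans h
        rw [min_eq_left h, min_eq_left hx] at B ⊢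
        exact B
      · rw [min_eq_right h] at B hMp ⊢
        rcases le_total x R with h' | h'
        · rw [min_eq_left h'] at B ⊢
          have R0 : 0 < R := by linarith
          have : y * (R * (R ^ (2 * σ) - x ^ (2 * σ))) ≤ y * (2 * σ * (R - x) * R ^ (2 * σ)) := by
            gcongr
          have h3 : y * (R - x) ≤ R * (y - x) := by nlinarith
          have h4 := mul_le_mul_of_nonneg_right h3 (by positivity : 0 ≤ 2 * σ * R ^ (2 * σ))
          have h5 : R * (y * (R ^ (2 * σ) - x ^ (2 * σ))) ≤ R * (2 * σ * (y - x) * R ^ (2 * σ)) := by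
            linarith
          exact le_of_mul_le_mul_left h5 R0
        · rw [min_eq_right h']
          have : 0 ≤ 2 * σ * (y - x) * R ^ (2 * σ) := by
            have : 0 ≤ y - x := by linarith
            positivity
          simpa using this
    refine key.trans ?_
    gcongr
    · linarith
    · linarith
  refine ⟨D1, by norm_num, wR_nonneg hR, ub, ?_, ?_, ?_, ?_, ?_⟩
  · simpa using ub
  · intro k l h
    have h' : |(k : ℝ)| ≤ |(l : ℝ)| := by exact_mod_cast h
    exact Real.rpow_le_rpow (le_min (abs_nonneg _) (by linarith)) (min_le_min_right _ h') (by linarith)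
  · intro k l hk hl h
    have h' : |(l : ℝ)| ≤ 5 * |(k : ℝ)| := by exact_mod_cast h
    have hk1 := odd_abs_ge hk
    have : min |(l : ℝ)| R ≤ 5 * min |(k : ℝ)| R := by
      rw [mul_min_of_nonneg _ _ (by norm_num : (0 : ℝ) ≤ 5)]
      exact min_le_min h' (by linarith)
    have h2 : wR σ R l ≤ 5 ^ σ * wR σ R k := by
      unfold wR
      rw [← Real.mul_rpow (by norm_num) (le_min (abs_nonneg _) (by linarith))]
      exact Real.rpow_le_rpow (le_min (abs_nonneg _) (by linarith)) this (by linarith)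
    refine h2.trans ?_
    have := wR_nonneg (σ := σ) hR k
    gcongr
    linarith
  · simpa using dif
  · simpa using dif

/-- untruncated weight -/
def wt (s : ℝ) (k : ℤ) : ℝ := |(k : ℝ)| ^ s

lemma wt_nonneg (s : ℝ) (k : ℤ) : 0 ≤ wt s k := Real.rpow_nonneg (abs_nonneg _) _

lemma wt_neg (s : ℝ) (k : ℤ) : wt s (-k) = wt s k := by simp [wt]

lemma wt_shift {s : ℝ} (hs : 0 ≤ s) {k : ℤ} (hk : Odd k) (c : ℤ) (hc : |c| ≤ 2) :
    wt s (k + c) ≤ 3 ^ s * wt s k := by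
  have h1 := odd_abs_ge hk
  unfold wt
  rw [← Real.mul_rpow (by norm_num) (abs_nonneg _)]
  apply Real.rpow_le_rpow (abs_nonneg _) _ hs
  push_cast
  have hc' : |(c : ℝ)| ≤ 2 := by exact_mod_cast hc
  exact (abs_add_le _ _).trans (by linarith)

lemma wt_diff {s M : ℝ} (hs : 1 ≤ s) (hM : 0 < M) {k l : ℤ} (hk : |(k : ℝ)| ≤ M) (hl : |(l : ℝ)| ≤ M) :
    M * |wt s k - wt s l| ≤ s * |(k : ℝ) - l| * M ^ s := by
  have main : ∀ x y : ℝ, 0 ≤ x → x ≤ y → y ≤ M → M * (y ^ s - x ^ s) ≤ s * (y - x) * M ^ s := by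
    intro x y hx hxy hy
    rcases hx.eq_or_lt with rfl | hx0
    · rcases hxy.eq_or_lt with rfl | hy0
      · simp
      · have B := rpow_sub_le hs le_rfl hy0 hxy
        have hp : y ^ s = y ^ (s - 1) * y := by
          rw [← Real.rpow_add_one hy0.ne']; congr 1; ring
        have hM2 : M ^ s = M ^ (s - 1) * M := by
          rw [← Real.rpow_add_one hM.ne']; congr 1; ring
        have hle : y ^ (s - 1) ≤ M ^ (s - 1) := Real.rpow_le_rpow hy0.le hy (by linarith)
        have h0 : (0 : ℝ) ^ s = 0 := Real.zero_rpow (by linarith)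
        rw [h0, hp, hM2]
        have : 0 < y ^ (s - 1) := by positivity
        have h3 : M * (y ^ (s - 1) * y) ≤ M * (M ^ (s - 1) * y) := by gcongr
        have h4 : 0 < M * (M ^ (s - 1) * y) := by positivity
        nlinarith
    · have hy0 : 0 < y := by linarith
      have B := rpow_sub_le hs hx hy0 hxy
      have hp : y ^ s = y ^ (s - 1) * y := by
        rw [← Real.rpow_add_one hy0.ne']; congr 1; ring
      have hM2 : M ^ s = M ^ (s - 1) * M := by
        rw [← Real.rpow_add_one hM.ne']; congr 1; ring
      have hle : y ^ (s - 1) ≤ M ^ (s - 1) := Real.rpow_le_rpow hy0.le hy (by linarith)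
      have h2 : y ^ s - x ^ s ≤ s * (y - x) * y ^ (s - 1) := by
        apply le_of_mul_le_mul_left _ hy0
        calc _ ≤ _ := B
          _ = _ := by rw [hp]; ring
      calc M * (y ^ s - x ^ s) ≤ M * (s * (y - x) * y ^ (s - 1)) := by gcongr
        _ ≤ M * (s * (y - x) * M ^ (s - 1)) := by
          have : 0 ≤ y - x := by linarith
          gcongr
        _ = _ := by rw [hM2]; ring
  have hMs : 0 < M ^ s := by positivity
  rcases le_total |(k : ℝ)| |(l : ℝ)| with h | h
  · have := main _ _ (abs_nonneg _) h hl
    have e : |wt s k - wt s l| = wt s l - wt s k := by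
      rw [abs_sub_comm, abs_of_nonneg]
      exact sub_nonneg.2 (Real.rpow_le_rpow (abs_nonneg _) h (by linarith))
    rw [e]
    have hd := abs_sub_abs_le_abs_sub (l : ℝ) k
    rw [abs_sub_comm] at hd
    refine (this : M * (wt s l - wt s k) ≤ _).trans ?_
    gcongr
  · have := main _ _ (abs_nonneg _) h hk
    have e : |wt s k - wt s l| = wt s k - wt s l := by
      rw [abs_of_nonneg]
      exact sub_nonneg.2 (Real.rpow_le_rpow (abs_nonneg _) h (by linarith))
    rw [e]
    have hd := abs_sub_abs_le_abs_sub (k : ℝ) l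
    refine (this : M * (wt s k - wt s l) ≤ _).trans ?_
    gcongr

/-- shifted weight -/
def a2 (s : ℝ) (k : ℤ) : ℝ := wt s k * wt s (k + 2)

lemma a2_dif {s : ℝ} (hs : 1 ≤ s) : ∀ k l : ℤ, Odd k → Odd l → |k| ≤ |l| →
      |(l : ℝ)| * |a2 s l - a2 s (k - 2)| ≤ (5 * s * 9 ^ s) * (|(l : ℝ) - k| + 2) * wt s l ^ 2 := by
  intro k l hk hl hkl
  have hk1 := odd_abs_ge hk
  have hl1 := odd_abs_ge hl
  have hkl' : |(k : ℝ)| ≤ |(l : ℝ)| := by exact_mod_cast hkl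
  set y := |(l : ℝ)| with hy
  have b1 : |((l + 2 : ℤ) : ℝ)| ≤ 3 * y := by
    push_cast
    have := abs_add_le (l : ℝ) 2
    rw [abs_two] at this; linarith
  have b2 : |((k - 2 : ℤ) : ℝ)| ≤ 3 * y := by
    push_cast
    have := abs_sub (k : ℝ) 2
    rw [abs_two] at this; linarith
  have d1 := wt_diff hs (by linarith : 0 < 3 * y) b1 b2
  have d2 := wt_diff hs (by linarith : 0 < 3 * y) (by linarith : |(l : ℝ)| ≤ 3 * y) (by linarith : |(k : ℝ)| ≤ 3 * y)
  have e3 : (3 * y) ^ s = 3 ^ s * wt s l := by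
    rw [Real.mul_rpow (by norm_num) (by linarith)]; rfl
  have hb : wt s (k - 2) ≤ 3 ^ s * wt s l := by
    have := wt_shift (by linarith : 0 ≤ s) hk (-2) (by norm_num)
    refine (this : wt s (k - 2) ≤ _).trans ?_
    gcongr
    exact Real.rpow_le_rpow (abs_nonneg _) hkl' (by linarith)
  rw [e3] at d1 d2
  have e9 : (9 : ℝ) ^ s = 3 ^ s * 3 ^ s := by
    rw [← Real.mul_rpow (by norm_num) (by norm_num)]; norm_num
  have h31 : 1 ≤ (3 : ℝ) ^ s := Real.one_le_rpow (by norm_num) (by linarith)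
  have wl := wt_nonneg s l
  have wk2 := wt_nonneg s (k - 2)
  have ee : a2 s l - a2 s (k - 2) = wt s l * (wt s (l + 2) - wt s (k - 2)) + wt s (k - 2) * (wt s l - wt s k) := by
    unfold a2; rw [sub_add_cancel]; ring
  have dd : |((l + 2 : ℤ) : ℝ) - ((k - 2 : ℤ) : ℝ)| ≤ |(l : ℝ) - k| + 4 := by
    push_cast
    have : (l : ℝ) + 2 - (k - 2) = (l - k) + 4 := by ring
    rw [this]
    exact (abs_add_le _ _).trans (by norm_num)
  have t := abs_add_le (wt s l * (wt s (l + 2) - wt s (k - 2))) (wt s (k - 2) * (wt s l - wt s k))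
  rw [← ee, abs_mul, abs_mul, abs_of_nonneg wl, abs_of_nonneg wk2] at t
  have s1 : y * |wt s (l + 2) - wt s (k - 2)| ≤ s * (|(l : ℝ) - k| + 4) * (3 ^ s * wt s l) := by
    have : s * |((l + 2 : ℤ) : ℝ) - ((k - 2 : ℤ) : ℝ)| * (3 ^ s * wt s l) ≤ s * (|(l : ℝ) - k| + 4) * (3 ^ s * wt s l) := by
      gcongr
    have h0 : 0 ≤ y * |wt s (l + 2) - wt s (k - 2)| := by positivity
    nlinarith
  have s2 : y * |wt s l - wt s k| ≤ s * (|(l : ℝ) - k|) * (3 ^ s * wt s l) := by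
    have h0 : 0 ≤ y * |wt s l - wt s k| := by positivity
    nlinarith
  have s1' := mul_le_mul_of_nonneg_left s1 wl
  have s2' : wt s (k - 2) * (y * |wt s l - wt s k|) ≤ (3 ^ s * wt s l) * (s * (|(l : ℝ) - k|) * (3 ^ s * wt s l)) := by
    gcongr
  have t' := mul_le_mul_of_nonneg_left t (by linarith : 0 ≤ y)
  have h39 : (3 : ℝ) ^ s ≤ 9 ^ s := by rw [e9]; nlinarith
  have f1 : wt s l * (s * (|(l : ℝ) - k| + 4) * (3 ^ s * wt s l)) ≤ 9 ^ s * (s * (|(l : ℝ) - k| + 4) * wt s l ^ 2) := by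
    have : 0 ≤ s * (|(l : ℝ) - k| + 4) * wt s l ^ 2 := by positivity
    calc _ = 3 ^ s * (s * (|(l : ℝ) - k| + 4) * wt s l ^ 2) := by ring
      _ ≤ _ := by gcongr
  have f2 : (3 ^ s * wt s l) * (s * (|(l : ℝ) - k|) * (3 ^ s * wt s l)) = 9 ^ s * (s * (|(l : ℝ) - k|) * wt s l ^ 2) := by
    rw [e9]; ring
  have f3 : 0 ≤ 9 ^ s * (s * wt s l ^ 2) := by positivity
  have f4 : 0 ≤ 9 ^ s * (s * |(l : ℝ) - k| * wt s l ^ 2) := by positivity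
  nlinarith

lemma a2_neg (s : ℝ) (k : ℤ) : a2 s (-k) = a2 s (k - 2) := by
  unfold a2
  rw [wt_neg, sub_add_cancel, ← wt_neg s (k - 2), mul_comm]
  congr 2; ring

lemma adm_two {s : ℝ} (hs : 1 ≤ s) : Adm (a2 s) 2 (wt s) (5 * s * 9 ^ s) := by
  have h91 : 1 ≤ (9 : ℝ) ^ s := Real.one_le_rpow (by norm_num) (by linarith)
  have h39 : (3 : ℝ) ^ s ≤ 9 ^ s := Real.rpow_le_rpow (by norm_num) (by norm_num) (by linarith)
  have h59 : (5 : ℝ) ^ s ≤ 9 ^ s := Real.rpow_le_rpow (by norm_num) (by norm_num) (by linarith)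
  have hD : (9 : ℝ) ^ s ≤ 5 * s * 9 ^ s := by nlinarith
  have dif := a2_dif hs
  refine ⟨by linarith, by norm_num, wt_nonneg s, ?_, ?_, ?_, ?_, ?_, ?_⟩
  · intro k hk
    have := wt_nonneg s k
    have := wt_nonneg s (k + 2)
    rw [abs_of_nonneg (by unfold a2; positivity)]
    have h := wt_shift (by linarith : 0 ≤ s) hk 2 (by norm_num)
    calc a2 s k ≤ wt s k * ((5 * s * 9 ^ s) * wt s k) := by
          unfold a2
          have : 3 ^ s * wt s k ≤ (5 * s * 9 ^ s) * wt s k := by gcongr; linarith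
          gcongr; linarith
      _ = _ := by ring
  · intro k hk
    have := wt_nonneg s k
    have := wt_nonneg s (k - 2)
    have e : a2 s (k - 2) = wt s k * wt s (k - 2) := by unfold a2; rw [sub_add_cancel, mul_comm]
    rw [e, abs_of_nonneg (by positivity)]
    have h : wt s (k - 2) ≤ _ := wt_shift (by linarith : 0 ≤ s) hk (-2) (by norm_num)
    calc _ ≤ wt s k * ((5 * s * 9 ^ s) * wt s k) := by
          have : 3 ^ s * wt s k ≤ (5 * s * 9 ^ s) * wt s k := by gcongr; linarith
          gcongr; linarith
      _ = _ := by ring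
  · intro k l h
    have h' : |(k : ℝ)| ≤ |(l : ℝ)| := by exact_mod_cast h
    exact Real.rpow_le_rpow (abs_nonneg _) h' (by linarith)
  · intro k l hk hl h
    have h' : |(l : ℝ)| ≤ 5 * |(k : ℝ)| := by exact_mod_cast h
    have h2 : wt s l ≤ 5 ^ s * wt s k := by
      unfold wt
      rw [← Real.mul_rpow (by norm_num) (abs_nonneg _)]
      exact Real.rpow_le_rpow (abs_nonneg _) h' (by linarith)
    refine h2.trans ?_
    have := wt_nonneg s k
    gcongr
    linarith
  · intro k l hk hl h _
    exact dif k l hk hl h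
  · intro k l hk hl h _
    have := dif (-k) (-l) hk.neg hl.neg (by simpa using h)
    rw [a2_neg, wt_neg] at this
    have e : a2 s (-k - 2) = a2 s k := by
      rw [show -k - 2 = -(k + 2) by ring, a2_neg, add_sub_cancel_right]
    rw [e] at this
    have e2 : |((-l : ℤ) : ℝ) - ((-k : ℤ) : ℝ)| = |(l : ℝ) - k| := by
      push_cast; rw [← abs_neg]; congr 1; ring
    rw [e2] at this
    simpa using this
end

/-! Part D -/

noncomputable section
open Filter Topology

def cK (s : ℝ) (k l : ℤ) : ℝ :=
  if k = 1 ∧ l = 1 then -2 else if k = -1 ∧ l = -1 then -2 else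
  if k = 1 ∧ l = -1 then 4 * s - 2 else if k = -1 ∧ l = 1 then -(4 * s) - 2 else 0

def dK (k l : ℤ) : ℝ :=
  if k = 1 ∧ l = 1 then 4 else if k = -1 ∧ l = -1 then -4 else 0

lemma cK_zero (s : ℝ) (k l : ℤ) (h : k < -1 ∨ 1 < k ∨ l < -1 ∨ 1 < l) : cK s k l = 0 := by
  unfold cK
  rw [if_neg (by omega), if_neg (by omega), if_neg (by omega), if_neg (by omega)]

lemma dK_zero (k l : ℤ) (h : k < -1 ∨ 1 < k ∨ l < -1 ∨ 1 < l) : dK k l = 0 := by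
  unfold dK
  rw [if_neg (by omega), if_neg (by omega)]

lemma cK11 (s : ℝ) : cK s 1 1 = -2 := by simp [cK]
lemma cKmm (s : ℝ) : cK s (-1) (-1) = -2 := by norm_num [cK]
lemma cK1m (s : ℝ) : cK s 1 (-1) = 4 * s - 2 := by norm_num [cK]
lemma cKm1 (s : ℝ) : cK s (-1) 1 = -(4 * s) - 2 := by norm_num [cK]
lemma dK11 : dK 1 1 = 4 := by simp [dK]
lemma dKmm : dK (-1) (-1) = -4 := by norm_num [dK]
lemma dK1m : dK 1 (-1) = 0 := by norm_num [dK]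
lemma dKm1 : dK (-1) 1 = 0 := by norm_num [dK]

def MK (s : ℝ) (p : ℤ × ℤ × ℤ × ℤ) : ℝ :=
  cK s p.2.2.1 p.2.2.2 * (wt s p.1 * wt s p.2.1)
  + cK s p.1 p.2.2.2 * (wt s p.2.2.1 * wt s p.2.1)
  + cK s p.2.2.1 p.2.1 * (wt s p.1 * wt s p.2.2.2)
  + cK s p.1 p.2.1 * (wt s p.2.2.1 * wt s p.2.2.2)
  + dK p.1 p.2.2.1 * (wt s p.2.1 * wt s p.2.2.2)
  - dK p.2.1 p.2.2.2 * (wt s p.1 * wt s p.2.2.1)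

def rr (s : ℝ) (c k : ℤ) : ℝ := wt s (k + c) / wt s k

lemma ev_big (n : ℤ) : ∀ᶠ k : ℤ in cofinite, k < -n ∨ n < k := by
  have : {k : ℤ | ¬ (k < -n ∨ n < k)} ⊆ Set.Icc (-n) n := by
    intro k hk
    simp only [Set.mem_setOf_eq, not_or, not_lt] at hk
    exact ⟨hk.1, hk.2⟩
  exact (Set.finite_Icc _ _).subset this

lemma tendsto_inv_cof : Tendsto (fun k : ℤ => ((k : ℝ))⁻¹) cofinite (𝓝 0) := by
  have : Tendsto (fun k : ℤ => (k : ℝ)) cofinite (Bornology.cobounded ℝ) := by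
    exact Int.tendsto_coe_cofinite.mono_right (Metric.cobounded_eq_cocompact).ge
  exact tendsto_inv₀_cobounded.comp this

lemma rr_slope (s : ℝ) (c : ℤ) :
    Tendsto (fun k : ℤ => (k : ℝ) * (rr s c k - 1)) cofinite (𝓝 (c * s)) := by
  have hd : HasDerivAt (fun y : ℝ => (1 + c * y) ^ s) (c * s) 0 := by
    have h1 : HasDerivAt (fun y : ℝ => 1 + (c : ℝ) * y) (c : ℝ) 0 := by
      simpa using ((hasDerivAt_id (0 : ℝ)).const_mul (c : ℝ)).const_add 1
    have := h1.rpow_const (p := s) (Or.inl (by simp))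
    simpa using this
  rw [hasDerivAt_iff_tendsto_slope_zero] at hd
  have hy : Tendsto (fun k : ℤ => ((k : ℝ))⁻¹) cofinite (𝓝[≠] 0) := by
    rw [tendsto_nhdsWithin_iff]
    refine ⟨tendsto_inv_cof, ?_⟩
    filter_upwards [ev_big 0] with k hk
    have : (k : ℝ) ≠ 0 := by exact_mod_cast (by omega : k ≠ 0)
    simpa using this
  refine (hd.comp hy).congr' ?_
  filter_upwards [ev_big (|c| + 1)] with k hk
  have hc := abs_le.1 (le_refl |c|)
  have hk0 : (k : ℝ) ≠ 0 := by exact_mod_cast (by have := abs_nonneg c; omega : k ≠ 0)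
  have hpos : 0 ≤ 1 + (c : ℝ) / k := by
    have h1 : |(c : ℝ)| ≤ |(k : ℝ)| := by
      have : |c| ≤ |k| := by
        rcases hk with h | h
        · have := neg_abs_le k; omega
        · have := le_abs_self k; omega
      exact_mod_cast this
    have h2 : |(c : ℝ) / k| ≤ 1 := by
      rw [abs_div]; exact div_le_one_of_le₀ h1 (abs_nonneg _)
    have := (abs_le.1 h2).1
    linarith
  have hr : rr s c k = (1 + (c : ℝ) / k) ^ s := by
    unfold rr wt
    rw [← Real.div_rpow (abs_nonneg _) (abs_nonneg _), ← abs_div, ← abs_of_nonneg hpos]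
    congr 1
    skip
    congr 1; push_cast; field_simp
  simp only [Function.comp, zero_add, mul_zero, add_zero, Real.one_rpow, inv_inv, smul_eq_mul, hr]
  rw [div_eq_mul_inv]

lemma rr_tendsto (s : ℝ) (c : ℤ) : Tendsto (fun k : ℤ => rr s c k) cofinite (𝓝 1) := by
  have h := ((rr_slope s c).mul tendsto_inv_cof).add_const 1
  simp only [mul_zero, zero_add] at h
  refine h.congr' ?_
  filter_upwards [ev_big 0] with k hk
  have : (k : ℝ) ≠ 0 := by exact_mod_cast (by omega : k ≠ 0)
  field_simp
  ring

lemma wt_sq_ge {s : ℝ} (hs : 1 ≤ s) (k : ℤ) (hk : k ≠ 0) : (k : ℝ) ^ 2 ≤ wt s k ^ 2 := by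
  have h1 : (1 : ℝ) ≤ |(k : ℝ)| := by exact_mod_cast Int.one_le_abs hk
  rw [← sq_abs]
  have : |(k : ℝ)| ≤ wt s k := by
    conv_lhs => rw [← Real.rpow_one |(k : ℝ)|]
    exact Real.rpow_le_rpow_of_exponent_le h1 hs
  gcongr

lemma wt_pos (s : ℝ) {k : ℤ} (hk : k ≠ 0) : 0 < wt s k := by
  apply Real.rpow_pos_of_pos
  exact abs_pos.2 (by exact_mod_cast hk)

lemma q_tendsto {s : ℝ} (hs : 1 ≤ s) :
    Tendsto (fun k : ℤ => (k : ℝ) / wt s k ^ 2) cofinite (𝓝 0) := by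
  rw [tendsto_zero_iff_abs_tendsto_zero]
  have h := tendsto_inv_cof
  rw [tendsto_zero_iff_abs_tendsto_zero] at h
  refine tendsto_of_tendsto_of_tendsto_of_le_of_le' tendsto_const_nhds h 
    (Eventually.of_forall fun k => abs_nonneg _) ?_
  filter_upwards [ev_big 0] with k hk
  have hk0 : k ≠ 0 := by omega
  have hk' : 0 < |(k : ℝ)| := abs_pos.2 (by exact_mod_cast hk0)
  simp only [Function.comp]
  rw [abs_div, abs_of_nonneg (sq_nonneg (wt s k)), abs_inv, div_le_iff₀ (by have := wt_pos s hk0; positivity)]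
  have := wt_sq_ge hs k hk0
  rw [← sq_abs] at this
  rw [inv_mul_eq_div, le_div_iff₀ hk']
  linarith

lemma one_tendsto {s : ℝ} (hs : 1 ≤ s) :
    Tendsto (fun k : ℤ => 1 / wt s k ^ 2) cofinite (𝓝 0) := by
  have h := (q_tendsto hs).mul tendsto_inv_cof
  simp only [mul_zero] at h
  refine h.congr' ?_
  filter_upwards [ev_big 0] with k hk
  have : (k : ℝ) ≠ 0 := by exact_mod_cast (by omega : k ≠ 0)
  field_simp

lemma conf_close {s : ℝ} {f g : ℤ → ℝ} (hg0 : ∀ k, 0 ≤ g k)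
    (hf : Tendsto (fun k => f k / wt s k ^ 2) cofinite (𝓝 0))
    (hg : Tendsto (fun k => g k / wt s k ^ 2) cofinite (𝓝 1)) {η : ℝ} (hη : 0 < η) :
    ∃ C, 0 ≤ C ∧ ∀ k, |f k| ≤ η * g k + C := by
  have h1 : ∀ᶠ k in cofinite, |f k / wt s k ^ 2| < η / 2 := by
    have := (tendsto_zero_iff_abs_tendsto_zero _).1 hf
    exact this.eventually (gt_mem_nhds (by linarith))
  have h2 : ∀ᶠ k in cofinite, 1 / 2 < g k / wt s k ^ 2 :=
    hg.eventually (lt_mem_nhds (by norm_num))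
  have h3 : ∀ᶠ k in cofinite, |f k| ≤ η * g k := by
    filter_upwards [h1, h2, ev_big 0] with k a b c
    have hw : 0 < wt s k ^ 2 := by have := wt_pos s (by omega : k ≠ 0); positivity
    rw [abs_div, abs_of_pos hw, div_lt_iff₀ hw] at a
    rw [lt_div_iff₀ hw] at b
    nlinarith
  have hfin : Set.Finite {k | ¬ |f k| ≤ η * g k} := h3
  refine ⟨∑ k ∈ hfin.toFinset, |f k|, Finset.sum_nonneg fun _ _ => abs_nonneg _, fun k => ?_⟩
  by_cases h : |f k| ≤ η * g k
  · have : 0 ≤ ∑ k ∈ hfin.toFinset, |f k| := Finset.sum_nonneg fun _ _ => abs_nonneg _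
    linarith
  · have : |f k| ≤ ∑ k ∈ hfin.toFinset, |f k| :=
      Finset.single_le_sum (f := fun k => |f k|) (fun _ _ => abs_nonneg _) (by simpa using h)
    have := mul_nonneg hη.le (hg0 k)
    linarith

lemma wt_rr (s : ℝ) {k : ℤ} (hk : k ≠ 0) (c : ℤ) : wt s (k + c) = rr s c k * wt s k := by
  unfold rr
  rw [div_mul_cancel₀ _ (wt_pos s hk).ne']

lemma g_tend (s : ℝ) (c : ℤ) (j : ℤ → ℤ) (hj : ∀ k, wt s (j k) = wt s (k + c)) :
    Tendsto (fun k => (wt s k * wt s (j k)) / wt s k ^ 2) cofinite (𝓝 1) := by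
  refine (rr_tendsto s c).congr' ?_
  filter_upwards [ev_big 0] with k hk
  have h0 : k ≠ 0 := by omega
  rw [hj, wt_rr s h0]
  have := wt_pos s h0
  field_simp

lemma wt_nn (s : ℝ) (i j : ℤ) : 0 ≤ wt s i * wt s j := mul_nonneg (wt_nonneg _ _) (wt_nonneg _ _)

/-- generic closing lemma -/
lemma conf_main {s : ℝ} (P : ℤ → ℤ × ℤ × ℤ × ℤ) (c : ℤ) (j : ℤ → ℤ) (G : ℤ → ℝ)
    (hj : ∀ k, wt s (j k) = wt s (k + c)) 
    (hG : Tendsto G cofinite (𝓝 0))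
    (he : ∀ k : ℤ, (k < -9 ∨ 9 < k) → symb (a2 s) 2 (P k) - MK s (P k) = G k * wt s k ^ 2)
    {η : ℝ} (hη : 0 < η) :
    ∃ C, 0 ≤ C ∧ ∀ k, |symb (a2 s) 2 (P k) - MK s (P k)| ≤ η * (wt s k * wt s (j k)) + C := by
  refine conf_close (s := s) (fun k => wt_nn _ _ _) ?_ (g_tend s c j hj) hη
  refine hG.congr' ?_
  filter_upwards [ev_big 9] with k hk
  have := wt_pos s (by omega : k ≠ 0)
  rw [he k hk]
  field_simp

end

/-! Part E -/

noncomputable section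
open Filter Topology

section
variable {s : ℝ} (hs : 1 ≤ s) {η : ℝ} (hη : 0 < η)

lemma mk_simp_help (s : ℝ) (i j : ℤ) (h : i = -j) : wt s i = wt s j := by rw [h, wt_neg]

lemma tend_lin {s : ℝ} (hs : 1 ≤ s) (A B : ℝ) : 
   Tendsto (fun k : ℤ => A * ((k : ℝ) / wt s k ^ 2) + B * (1 / wt s k ^ 2)) cofinite (𝓝 0) := by
  have := ((q_tendsto hs).const_mul A).add ((one_tendsto hs).const_mul B)
  simpa using this

lemma conf_c11 {s : ℝ} (hs : 1 ≤ s) {η : ℝ} (hη : 0 < η) :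
    ∃ C, 0 ≤ C ∧ ∀ k, |symb (a2 s) 2 (k, k + 2, 1, 1) - MK s (k, k + 2, 1, 1)| ≤ 
      η * (wt s k * wt s (k + 2)) + C := by
  refine conf_main _ 2 _ (fun k => (a2 s (-1) - a2 s 1) * ((k : ℝ) / wt s k ^ 2) + 
    (a2 s (-1) - 3 * a2 s 1) * (1 / wt s k ^ 2)) (fun k => rfl) (tend_lin hs _ _) ?_ hη
  intro k hk
  have hw := wt_pos s (by omega : k ≠ 0)
  have e1 : symb (a2 s) 2 (k, k + 2, 1, 1) = (k + 1) * (a2 s k + a2 s (-1)) - (k + 3) * (a2 s k + a2 s 1) := by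
    simp only [symb]
    rw [show k + 2 - 2 = k by ring, show (1 : ℤ) - 2 = -1 by norm_num]
    push_cast; ring
  have e2 : MK s (k, k + 2, 1, 1) = -2 * a2 s k := by
    simp only [MK]
    rw [cK_zero s k 1 (by omega), cK_zero s 1 (k+2) (by omega), cK_zero s k (k+2) (by omega),
      dK_zero k 1 (by omega), dK_zero (k+2) 1 (by omega), cK11, a2]
    ring
  rw [e1, e2]
  field_simp
  ring

lemma conf_cmm {s : ℝ} (hs : 1 ≤ s) {η : ℝ} (hη : 0 < η) :
    ∃ C, 0 ≤ C ∧ ∀ k, |symb (a2 s) 2 (k, k + 2, -1, -1) - MK s (k, k + 2, -1, -1)| ≤ 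
      η * (wt s k * wt s (k + 2)) + C := by
  refine conf_main _ 2 _ (fun k => (a2 s (-3) - a2 s (-1)) * ((k : ℝ) / wt s k ^ 2) + 
    (- a2 s (-3) - a2 s (-1)) * (1 / wt s k ^ 2)) (fun k => rfl) (tend_lin hs _ _) ?_ hη
  intro k hk
  have hw := wt_pos s (by omega : k ≠ 0)
  have e1 : symb (a2 s) 2 (k, k + 2, -1, -1) = (k - 1) * (a2 s k + a2 s (-3)) - (k + 1) * (a2 s k + a2 s (-1)) := by
    simp only [symb]
    rw [show k + 2 - 2 = k by ring, show (-1 : ℤ) - 2 = -3 by norm_num]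
    push_cast; ring
  have e2 : MK s (k, k + 2, -1, -1) = -2 * a2 s k := by
    simp only [MK]
    rw [cK_zero s k (-1) (by omega), cK_zero s (-1) (k+2) (by omega), cK_zero s k (k+2) (by omega),
      dK_zero k (-1) (by omega), dK_zero (k+2) (-1) (by omega), cKmm, a2]
    ring
  rw [e1, e2]
  field_simp
  ring

lemma conf_c1m {s : ℝ} (hs : 1 ≤ s) {η : ℝ} (hη : 0 < η) :
    ∃ C, 0 ≤ C ∧ ∀ k, |symb (a2 s) 2 (k, k + 4, 1, -1) - MK s (k, k + 4, 1, -1)| ≤ 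
      η * (wt s k * wt s (k + 4)) + C := by
  refine conf_main _ 4 _ (fun k => rr s 2 k * (k * (rr s 4 k - 1)) + rr s 2 k * rr s 4 k - 3 * rr s 2 k 
    - (4 * s - 2) * rr s 4 k + ((a2 s (-3) - a2 s 1) * ((k : ℝ) / wt s k ^ 2) + 
    (a2 s (-3) - 3 * a2 s 1) * (1 / wt s k ^ 2))) (fun k => rfl) ?_ ?_ hη
  · have := ((((rr_tendsto s 2).mul (rr_slope s 4)).add ((rr_tendsto s 2).mul (rr_tendsto s 4))).sub
      ((rr_tendsto s 2).const_mul 3)).sub ((rr_tendsto s 4).const_mul (4 * s - 2)) |>.add 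
      (tend_lin hs (a2 s (-3) - a2 s 1) (a2 s (-3) - 3 * a2 s 1))
    convert this using 2
    push_cast; ring
  intro k hk
  have h0 : k ≠ 0 := by omega
  have hw := wt_pos s h0
  have e1 : symb (a2 s) 2 (k, k + 4, 1, -1) = (k + 1) * (wt s (k + 2) * wt s (k + 4) + a2 s (-3)) 
     - (k + 3) * (wt s k * wt s (k + 2) + a2 s 1) := by
    simp only [symb]
    rw [show k + 4 - 2 = k + 2 by ring, show (-1 : ℤ) - 2 = -3 by norm_num, show a2 s (k + 2) = wt s (k + 2) * wt s (k + 2 + 2) from rfl, show a2 s k = wt s k * wt s (k + 2) from rfl, show k + 2 + 2 = k + 4 by ring]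
    push_cast; ring
  have e2 : MK s (k, k + 4, 1, -1) = (4 * s - 2) * (wt s k * wt s (k + 4)) := by
    simp only [MK]
    rw [cK_zero s k (-1) (by omega), cK_zero s 1 (k+4) (by omega), cK_zero s k (k+4) (by omega),
      dK_zero k 1 (by omega), dK_zero (k+4) (-1) (by omega), cK1m]
    ring
  rw [e1, e2, wt_rr s h0, wt_rr s h0]
  field_simp
  ring

lemma conf_cm1 {s : ℝ} (hs : 1 ≤ s) {η : ℝ} (hη : 0 < η) :
    ∃ C, 0 ≤ C ∧ ∀ k, |symb (a2 s) 2 (k, k, -1, 1) - MK s (k, k, -1, 1)| ≤ 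
      η * (wt s k * wt s k) + C := by
  refine conf_main _ 0 (fun k => k) (fun k => (k * (rr s (-2) k - 1)) - (k * (rr s 2 k - 1)) - rr s (-2) k 
    - rr s 2 k + (4 * s + 2) + (0 * ((k : ℝ) / wt s k ^ 2) + 
    (- 2 * a2 s (-1)) * (1 / wt s k ^ 2))) (fun k => by simp) ?_ ?_ hη
  · have := (((((rr_slope s (-2)).sub (rr_slope s 2)).sub (rr_tendsto s (-2))).sub
      (rr_tendsto s 2)).add_const (4 * s + 2)).add 
      (tend_lin hs 0 (-2 * a2 s (-1)))
    convert this using 2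
    push_cast; ring
  intro k hk
  have h0 : k ≠ 0 := by omega
  have hw := wt_pos s h0
  have e1 : symb (a2 s) 2 (k, k, -1, 1) = (k - 1) * (wt s (k + -2) * wt s k + a2 s (-1)) 
     - (k + 1) * (wt s k * wt s (k + 2) + a2 s (-1)) := by
    simp only [symb]
    rw [show (1 : ℤ) - 2 = -1 by norm_num, show a2 s (k - 2) = wt s (k - 2) * wt s (k - 2 + 2) from rfl, show a2 s k = wt s k * wt s (k + 2) from rfl, sub_add_cancel, sub_eq_add_neg k 2]
    push_cast; ring
  have e2 : MK s (k, k, -1, 1) = (-(4 * s) - 2) * (wt s k * wt s k) := by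
    simp only [MK]
    rw [cK_zero s k 1 (by omega), cK_zero s (-1) k (by omega), cK_zero s k k (by omega),
      dK_zero k (-1) (by omega), dK_zero k 1 (by omega), cKm1]
    ring
  rw [e1, e2, wt_rr s h0, wt_rr s h0]
  field_simp
  ring

lemma conf_d11 {s : ℝ} (hs : 1 ≤ s) {η : ℝ} (hη : 0 < η) :
    ∃ C, 0 ≤ C ∧ ∀ k, |symb (a2 s) 2 (1, k, 1, 4 - k) - MK s (1, k, 1, 4 - k)| ≤ 
      η * (wt s k * wt s (4 - k)) + C := by
  refine conf_main _ (-4) (fun k => 4 - k) (fun k => 2 * rr s (-2) k + 2 * (rr s (-4) k * rr s (-2) k)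
    - 4 * rr s (-4) k + (0 * ((k : ℝ) / wt s k ^ 2) + 
    (- 8 * a2 s 1) * (1 / wt s k ^ 2))) (fun k => mk_simp_help _ _ _ (by ring)) ?_ ?_ hη
  · have := ((((rr_tendsto s (-2)).const_mul 2).add (((rr_tendsto s (-4)).mul (rr_tendsto s (-2))).const_mul 2)).sub
      ((rr_tendsto s (-4)).const_mul 4)).add 
      (tend_lin hs 0 (-8 * a2 s 1))
    convert this using 2
    push_cast; ring
  intro k hk
  have h0 : k ≠ 0 := by omega
  have hw := wt_pos s h0
  have e1 : symb (a2 s) 2 (1, k, 1, 4 - k) = 2 * (wt s (k + -2) * wt s k + wt s (k + -2) * wt s (k + -4)) 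
     - 8 * a2 s 1 := by
    simp only [symb]
    rw [a2, a2, sub_add_cancel, sub_add_cancel, sub_eq_add_neg k 2, mk_simp_help s (4 - k - 2) (k + -2) (by ring),
      mk_simp_help s (4 - k) (k + -4) (by ring)]
    push_cast; ring
  have e2 : MK s (1, k, 1, 4 - k) = 4 * (wt s k * wt s (k + -4)) := by
    simp only [MK]
    rw [cK_zero s 1 (4 - k) (by omega), cK_zero s 1 k (by omega), 
      dK_zero k (4 - k) (by omega), dK11, mk_simp_help s (4 - k) (k + -4) (by ring)]
    ring
  rw [e1, e2, wt_rr s h0, wt_rr s h0]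
  field_simp
  ring

lemma conf_dmm {s : ℝ} (hs : 1 ≤ s) {η : ℝ} (hη : 0 < η) :
    ∃ C, 0 ≤ C ∧ ∀ k, |symb (a2 s) 2 (-1, k, -1, -k) - MK s (-1, k, -1, -k)| ≤ 
      η * (wt s k * wt s (-k)) + C := by
  refine conf_main _ 0 (fun k => -k) (fun k => (-2) * rr s (-2) k + (-2) * (rr s 2 k)
    + 4) (fun k => by rw [wt_neg, add_zero]) ?_ ?_ hη
  · have := (((rr_tendsto s (-2)).const_mul (-2)).add ((rr_tendsto s 2).const_mul (-2))).add_const 4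
    convert this using 2
    push_cast; ring
  intro k hk
  have h0 : k ≠ 0 := by omega
  have hw := wt_pos s h0
  have e1 : symb (a2 s) 2 (-1, k, -1, -k) = (-2) * (wt s (k + -2) * wt s k + wt s (k + 2) * wt s k) := by
    simp only [symb]
    rw [a2, a2, sub_add_cancel, sub_add_cancel, sub_eq_add_neg k 2, mk_simp_help s (- k - 2) (k + 2) (by ring),
      wt_neg s k]
    push_cast; ring
  have e2 : MK s (-1, k, -1, -k) = (-4) * (wt s k * wt s k) := by
    simp only [MK]
    rw [cK_zero s (-1) (-k) (by omega), cK_zero s (-1) k (by omega), 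
      dK_zero k (-k) (by omega), dKmm, wt_neg s k]
    ring
  rw [e1, e2, wt_rr s h0, wt_rr s h0]
  field_simp
  ring

lemma conf_d1m {s : ℝ} (hs : 1 ≤ s) {η : ℝ} (hη : 0 < η) (τ : ℤ) (hτ : τ = 1 ∨ τ = -1) :
    ∃ C, 0 ≤ C ∧ ∀ k, |symb (a2 s) 2 (τ, k, -τ, 2 - k) - MK s (τ, k, -τ, 2 - k)| ≤ 
      η * (wt s k * wt s (2 - k)) + C := by
  refine conf_main _ (-2) (fun k => 2 - k) (fun k => (0 * ((k : ℝ) / wt s k ^ 2) + 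
    (-2 * (a2 s τ + a2 s (-τ))) * (1 / wt s k ^ 2)))
     (fun k => mk_simp_help _ _ _ (by ring)) (tend_lin hs _ _) ?_ hη
  intro k hk
  have h0 : k ≠ 0 := by omega
  have hw := wt_pos s h0
  have e1 : symb (a2 s) 2 (τ, k, -τ, 2 - k) = (-2) * (a2 s τ + a2 s (-τ)) := by
    simp only [symb]
    push_cast; ring
  have e2 : MK s (τ, k, -τ, 2 - k) = 0 := by
    simp only [MK]
    rw [cK_zero s (-τ) (2-k) (by omega), cK_zero s τ (2-k) (by omega), 
      cK_zero s τ k (by omega), cK_zero s (-τ) k (by omega),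
      dK_zero k (2 - k) (by omega)]
    rcases hτ with rfl | rfl
    · rw [dK1m]; ring
    · rw [neg_neg, dKm1]; ring
  rw [e1, e2]
  field_simp
  ring

lemma conf_e11 {s : ℝ} (hs : 1 ≤ s) {η : ℝ} (hη : 0 < η) :
    ∃ C, 0 ≤ C ∧ ∀ k, |symb (a2 s) 2 (k, 1, -k, 1) - MK s (k, 1, -k, 1)| ≤ 
      η * (wt s k * wt s (-k)) + C := by
  refine conf_main _ 0 (fun k => -k) (fun k => (-2) * rr s (-2) k + (-2) * (rr s 2 k)
    + 4) (fun k => by rw [wt_neg, add_zero]) ?_ ?_ hη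
  · have := (((rr_tendsto s (-2)).const_mul (-2)).add ((rr_tendsto s 2).const_mul (-2))).add_const 4
    convert this using 2
    push_cast; ring
  intro k hk
  have h0 : k ≠ 0 := by omega
  have hw := wt_pos s h0
  have e1 : symb (a2 s) 2 (k, 1, -k, 1) = (-2) * (wt s (k + -2) * wt s k + wt s (k + 2) * wt s k) := by
    simp only [symb]
    rw [a2_neg, show a2 s (k - 2) = wt s (k - 2) * wt s (k - 2 + 2) from rfl, show a2 s k = wt s k * wt s (k + 2) from rfl, sub_add_cancel, sub_eq_add_neg k 2]
    push_cast; ring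
  have e2 : MK s (k, 1, -k, 1) = (-4) * (wt s k * wt s k) := by
    simp only [MK]
    rw [cK_zero s (-k) 1 (by omega), cK_zero s k 1 (by omega), 
      dK_zero k (-k) (by omega), dK11, wt_neg s k]
    ring
  rw [e1, e2, wt_rr s h0, wt_rr s h0]
  field_simp
  ring

lemma conf_emm {s : ℝ} (hs : 1 ≤ s) {η : ℝ} (hη : 0 < η) :
    ∃ C, 0 ≤ C ∧ ∀ k, |symb (a2 s) 2 (k, -1, -4 - k, -1) - MK s (k, -1, -4 - k, -1)| ≤ 
      η * (wt s k * wt s (-4 - k)) + C := by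
  refine conf_main _ 4 (fun k => -4 - k) (fun k => 2 * rr s 2 k + 2 * (rr s 4 k * rr s 2 k)
    - 4 * rr s 4 k + (0 * ((k : ℝ) / wt s k ^ 2) + 
    (- 8 * a2 s (-3)) * (1 / wt s k ^ 2))) (fun k => mk_simp_help _ _ _ (by ring)) ?_ ?_ hη
  · have := ((((rr_tendsto s 2).const_mul 2).add (((rr_tendsto s 4).mul (rr_tendsto s 2)).const_mul 2)).sub
      ((rr_tendsto s 4).const_mul 4)).add 
      (tend_lin hs 0 (-8 * a2 s (-3)))
    convert this using 2
    push_cast; ring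
  intro k hk
  have h0 : k ≠ 0 := by omega
  have hw := wt_pos s h0
  have e1 : symb (a2 s) 2 (k, -1, -4 - k, -1) = 2 * (wt s (k + 2) * wt s k + wt s (k + 2) * wt s (k + 4)) 
     - 8 * a2 s (-3) := by
    simp only [symb]
    rw [show (-1 : ℤ) - 2 = -3 by norm_num, show a2 s (-4 - k) = wt s (k + 2) * wt s (k + 4) by
      rw [a2, mk_simp_help s (-4 - k) (k + 4) (by ring), mk_simp_help s (-4 - k + 2) (k + 2) (by ring)]; ring,
      show a2 s k = wt s k * wt s (k + 2) from rfl]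
    push_cast; ring
  have e2 : MK s (k, -1, -4 - k, -1) = 4 * (wt s k * wt s (k + 4)) := by
    simp only [MK]
    rw [cK_zero s (-4 - k) (-1) (by omega), cK_zero s k (-1) (by omega), 
      dK_zero k (-4 - k) (by omega), dKmm, mk_simp_help s (-4 - k) (k + 4) (by ring)]
    ring
  rw [e1, e2, wt_rr s h0, wt_rr s h0]
  field_simp
  ring

lemma conf_e1m {s : ℝ} (hs : 1 ≤ s) {η : ℝ} (hη : 0 < η) (τ : ℤ) (hτ : τ = 1 ∨ τ = -1) :
    ∃ C, 0 ≤ C ∧ ∀ k, |symb (a2 s) 2 (k, τ, -2 - k, -τ) - MK s (k, τ, -2 - k, -τ)| ≤ 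
      η * (wt s k * wt s (-2 - k)) + C := by
  refine conf_main _ 2 (fun k => -2 - k) (fun k => (0 * ((k : ℝ) / wt s k ^ 2) + 
    (-2 * (a2 s (τ - 2) + a2 s (-τ - 2))) * (1 / wt s k ^ 2)))
     (fun k => mk_simp_help _ _ _ (by ring)) (tend_lin hs _ _) ?_ hη
  intro k hk
  have h0 : k ≠ 0 := by omega
  have hw := wt_pos s h0
  have e1 : symb (a2 s) 2 (k, τ, -2 - k, -τ) = (-2) * (a2 s (τ - 2) + a2 s (-τ - 2)) := by
    simp only [symb]
    push_cast; ring
  have e2 : MK s (k, τ, -2 - k, -τ) = 0 := by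
    simp only [MK]
    rw [cK_zero s (-2 - k) τ (by omega), cK_zero s k τ (by omega), 
      cK_zero s (-2 - k) (-τ) (by omega), cK_zero s k (-τ) (by omega),
      dK_zero k (-2 - k) (by omega)]
    rcases hτ with rfl | rfl
    · rw [dK1m]; ring
    · rw [neg_neg, dKm1]; ring
  rw [e1, e2]
  field_simp
  ring
end
end

/-! Part F -/

noncomputable section
open Filter Topology

def DK (s : ℝ) (p : ℤ × ℤ × ℤ × ℤ) : ℝ := symb (a2 s) 2 p - MK s p

lemma cK_dK_symm (k l : ℤ) : dK k l = dK l k := by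
  unfold dK; simp only [and_comm]

lemma DK_swap13 (s : ℝ) (k1 k2 k3 k4 : ℤ) : DK s (k1, k2, k3, k4) = DK s (k3, k2, k1, k4) := by
  simp only [DK, symb, MK]
  rw [cK_dK_symm k1 k3]
  ring

lemma DK_swap24 (s : ℝ) (k1 k2 k3 k4 : ℤ) : DK s (k1, k2, k3, k4) = DK s (k1, k4, k3, k2) := by
  simp only [DK, symb, MK]
  rw [cK_dK_symm k2 k4]
  ring

def isP (k : ℤ) : Prop := k = 1 ∨ k = -1

instance (k : ℤ) : Decidable (isP k) := by unfold isP; infer_instance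

lemma cK_notP (s : ℝ) (k l : ℤ) (h : ¬ (isP k ∧ isP l)) : cK s k l = 0 := by
  unfold isP at h
  unfold cK
  rw [if_neg (by omega), if_neg (by omega), if_neg (by omega), if_neg (by omega)]

lemma dK_notP (k l : ℤ) (h : ¬ (isP k ∧ isP l)) : dK k l = 0 := by
  unfold isP at h
  unfold dK
  rw [if_neg (by omega), if_neg (by omega)]

lemma DK_confs {s : ℝ} (hs : 1 ≤ s) {η : ℝ} (hη : 0 < η) :
    ∃ C, 0 ≤ C ∧ ∀ k1 k2 k3 k4 : ℤ, k1 + k3 + 2 = k2 + k4 →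
      (isP k3 → isP k4 → |DK s (k1, k2, k3, k4)| ≤ η * (wt s k1 * wt s k2) + C) ∧
      (isP k1 → isP k3 → |DK s (k1, k2, k3, k4)| ≤ η * (wt s k2 * wt s k4) + C) ∧
      (isP k2 → isP k4 → |DK s (k1, k2, k3, k4)| ≤ η * (wt s k1 * wt s k3) + C) := by
  obtain ⟨C1, h1, H1⟩ := conf_c11 hs hη
  obtain ⟨C2, h2, H2⟩ := conf_cmm hs hη
  obtain ⟨C3, h3, H3⟩ := conf_c1m hs hη
  obtain ⟨C4, h4, H4⟩ := conf_cm1 hs hη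
  obtain ⟨C5, h5, H5⟩ := conf_d11 hs hη
  obtain ⟨C6, h6, H6⟩ := conf_dmm hs hη
  obtain ⟨C7, h7, H7⟩ := conf_d1m hs hη 1 (Or.inl rfl)
  obtain ⟨C8, h8, H8⟩ := conf_d1m hs hη (-1) (Or.inr rfl)
  obtain ⟨C9, h9, H9⟩ := conf_e11 hs hη
  obtain ⟨C10, h10, H10⟩ := conf_emm hs hη
  obtain ⟨C11, h11, H11⟩ := conf_e1m hs hη 1 (Or.inl rfl)
  obtain ⟨C12, h12, H12⟩ := conf_e1m hs hη (-1) (Or.inr rfl)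
  refine ⟨C1 + C2 + C3 + C4 + C5 + C6 + C7 + C8 + C9 + C10 + C11 + C12, by positivity, ?_⟩
  intro k1 k2 k3 k4 he
  refine ⟨?_, ?_, ?_⟩
  · rintro (rfl | rfl) (rfl | rfl)
    · obtain rfl : k2 = k1 + 2 := by omega
      exact (H1 k1).trans (by linarith)
    · obtain rfl : k2 = k1 + 4 := by omega
      exact (H3 k1).trans (by linarith)
    · obtain rfl : k1 = k2 := by omega
      exact (H4 k1).trans (by linarith)
    · obtain rfl : k2 = k1 + 2 := by omega
      exact (H2 k1).trans (by linarith)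
  · rintro (rfl | rfl) (rfl | rfl)
    · obtain rfl : k4 = 4 - k2 := by omega
      exact (H5 k2).trans (by linarith)
    · obtain rfl : k4 = 2 - k2 := by omega
      exact (H7 k2).trans (by linarith)
    · obtain rfl : k4 = 2 - k2 := by omega
      exact (H8 k2).trans (by linarith)
    · obtain rfl : k4 = -k2 := by omega
      exact (H6 k2).trans (by linarith)
  · rintro (rfl | rfl) (rfl | rfl)
    · obtain rfl : k3 = -k1 := by omega
      exact (H9 k1).trans (by linarith)
    · obtain rfl : k3 = -2 - k1 := by omega
      exact (H11 k1).trans (by linarith)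
    · obtain rfl : k3 = -2 - k1 := by omega
      exact (H12 k1).trans (by linarith)
    · obtain rfl : k3 = -4 - k1 := by omega
      exact (H10 k1).trans (by linarith)

/-- high part of |k| -/
def vk (k : ℤ) : ℝ := if isP k then 0 else |(k : ℝ)|

lemma vk_nonneg (k : ℤ) : 0 ≤ vk k := by
  unfold vk; split_ifs
  · exact le_rfl
  · exact abs_nonneg _

lemma vk_pair {l m : ℤ} (h : ¬ (isP l ∧ isP m)) : |(l : ℝ)| * |(m : ℝ)| ≤ |(l : ℝ)| * vk m + vk l * |(m : ℝ)| := by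
  have a := mul_nonneg (abs_nonneg (l : ℝ)) (vk_nonneg m)
  have b := mul_nonneg (vk_nonneg l) (abs_nonneg (m : ℝ)) 
  by_cases hl : isP l
  · have hm : ¬ isP m := fun hm => h ⟨hl, hm⟩
    have : vk m = |(m : ℝ)| := by unfold vk; rw [if_neg hm]
    rw [this]; linarith
  · have : vk l = |(l : ℝ)| := by unfold vk; rw [if_neg hl]
    rw [this]; linarith

lemma pairSum_nonneg {x y v : ℤ → ℝ} (hx : ∀ k, 0 ≤ x k) (hy : ∀ k, 0 ≤ y k) (hv : ∀ k, 0 ≤ v k)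
    (p : ℤ × ℤ × ℤ × ℤ) : 0 ≤ pairSum x y v p := by
  have h1 := fun i j => mul_nonneg (hx i) (hx j)
  have h2 := fun i j => add_nonneg (mul_nonneg (hy i) (hv j)) (mul_nonneg (hv i) (hy j))
  unfold pairSum
  have h := fun i j l m => mul_nonneg (h1 i j) (h2 l m)
  exact add_nonneg (add_nonneg (add_nonneg (add_nonneg (add_nonneg (h _ _ _ _) (h _ _ _ _)) (h _ _ _ _)) (h _ _ _ _)) (h _ _ _ _)) (h _ _ _ _)

set_option maxHeartbeats 1000000 in
lemma MK_pointwise {s : ℝ} (hs : 1 ≤ s) {η : ℝ} (hη : 0 < η) :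
    ∃ C, 0 ≤ C ∧ ∀ p : ℤ × ℤ × ℤ × ℤ, Odd p.1 → Odd p.2.1 → Odd p.2.2.1 → Odd p.2.2.2 → 
      p.1 + p.2.2.1 + 2 = p.2.1 + p.2.2.2 → ∀ ζ : ℤ → ℝ, (∀ k, 0 ≤ ζ k) →
      |DK s p| * (ζ p.1 * ζ p.2.1 * ζ p.2.2.1 * ζ p.2.2.2) ≤ 
        40 * (5 * s * 9 ^ s) ^ 2 * pairSum (fun k => wt s k * ζ k) (fun k => |(k : ℝ)| * ζ k) (fun k => vk k * ζ k) p
        + η * pairSum (fun k => wt s k * ζ k) ζ ζ p + C * pairSum ζ ζ ζ p := by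
  obtain ⟨C, hC, H⟩ := DK_confs hs hη
  refine ⟨C, hC, ?_⟩
  rintro ⟨k1, k2, k3, k4⟩ o1 o2 o3 o4 he ζ hζ
  simp only at o1 o2 o3 o4 he ⊢
  have hωζ : ∀ k, 0 ≤ wt s k * ζ k := fun k => mul_nonneg (wt_nonneg _ _) (hζ k)
  have n1 : 0 ≤ 40 * (5 * s * 9 ^ s) ^ 2 * pairSum (fun k => wt s k * ζ k) (fun k => |(k : ℝ)| * ζ k) (fun k => vk k * ζ k) (k1, k2, k3, k4) :=
    mul_nonneg (by positivity) (pairSum_nonneg hωζ (fun k => mul_nonneg (abs_nonneg _) (hζ k)) (fun k => mul_nonneg (vk_nonneg _) (hζ k)) _)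
  set X := ζ k1 * ζ k2 * ζ k3 * ζ k4 with hX
  have X0 : 0 ≤ X := mul_nonneg (mul_nonneg (mul_nonneg (hζ _) (hζ _)) (hζ _)) (hζ _)
  have hww := fun i j => wt_nn s i j
  have W : ∀ i j, 0 ≤ η * (wt s i * wt s j) * X := fun i j => mul_nonneg (mul_nonneg hη.le (hww i j)) X0
  have e2 : η * pairSum (fun k => wt s k * ζ k) ζ ζ (k1, k2, k3, k4) = 
     2 * (η * (wt s k1 * wt s k2) * X + η * (wt s k1 * wt s k3) * X + η * (wt s k1 * wt s k4) * X
      + η * (wt s k2 * wt s k3) * X + η * (wt s k2 * wt s k4) * X + η * (wt s k3 * wt s k4) * X) := by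
    simp only [pairSum]; ring
  have e3 : C * pairSum ζ ζ ζ (k1, k2, k3, k4) = 12 * (C * X) := by
    simp only [pairSum]; ring
  have CX : 0 ≤ C * X := mul_nonneg hC X0
  have fin : ∀ i j : ℤ, |DK s (k1, k2, k3, k4)| ≤ η * (wt s i * wt s j) + C → 
     |DK s (k1, k2, k3, k4)| * X ≤ η * (wt s i * wt s j) * X + C * X := by
    intro i j h
    have := mul_le_mul_of_nonneg_right h X0
    linarith
  have w12 := W k1 k2
  have w13 := W k1 k3
  have w14 := W k1 k4
  have w23 := W k2 k3
  have w24 := W k2 k4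
  have w34 := W k3 k4
  by_cases c34 : isP k3 ∧ isP k4
  · have := fin _ _ ((H k1 k2 k3 k4 he).1 c34.1 c34.2)
    linarith
  by_cases c14 : isP k1 ∧ isP k4
  · have h := (H k3 k2 k1 k4 (by omega)).1 c14.1 c14.2
    rw [DK_swap13] at h
    have := fin k2 k3 (by rw [mul_comm (wt s k2)]; exact h)
    linarith
  by_cases c23 : isP k2 ∧ isP k3
  · have h := (H k1 k4 k3 k2 (by omega)).1 c23.2 c23.1
    rw [DK_swap24] at h
    have := fin _ _ h
    linarith
  by_cases c12 : isP k1 ∧ isP k2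
  · have h := (H k3 k4 k1 k2 (by omega)).1 c12.1 c12.2
    rw [DK_swap24, DK_swap13] at h
    have := fin _ _ h
    linarith
  by_cases c13 : isP k1 ∧ isP k3
  · have := fin _ _ ((H k1 k2 k3 k4 he).2.1 c13.1 c13.2)
    linarith
  by_cases c24 : isP k2 ∧ isP k4
  · have := fin _ _ ((H k1 k2 k3 k4 he).2.2 c24.1 c24.2)
    linarith
  have hM : MK s (k1, k2, k3, k4) = 0 := by
    simp only [MK]
    rw [cK_notP _ _ _ c34, cK_notP _ _ _ c14, cK_notP s k3 k2 (fun h => c23 ⟨h.2, h.1⟩), cK_notP _ _ _ c12, dK_notP _ _ c13, dK_notP _ _ c24]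
    ring
  have hS := symb_bound (adm_two hs) (k1, k2, k3, k4) o1 o2 o3 o4 he
  have hDe : DK s (k1, k2, k3, k4) = symb (a2 s) 2 (k1, k2, k3, k4) := by
    unfold DK; rw [hM, sub_zero]
  have hD := hS
  rw [← hDe] at hD
  simp only at hD
  have p34 := mul_le_mul_of_nonneg_left (vk_pair c34) (hww k1 k2)
  have p24 := mul_le_mul_of_nonneg_left (vk_pair c24) (hww k1 k3)
  have p23 := mul_le_mul_of_nonneg_left (vk_pair c23) (hww k1 k4)
  have p14 := mul_le_mul_of_nonneg_left (vk_pair c14) (hww k2 k3)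
  have p13 := mul_le_mul_of_nonneg_left (vk_pair c13) (hww k2 k4)
  have p12 := mul_le_mul_of_nonneg_left (vk_pair c12) (hww k3 k4)
  have S := add_le_add (add_le_add (add_le_add (add_le_add (add_le_add p34 p24) p23) p14) p13) p12
  have hD2 := hD.trans (mul_le_mul_of_nonneg_left S (by positivity : (0:ℝ) ≤ 40 * (5 * s * 9 ^ s) ^ 2))
  have hD3 := mul_le_mul_of_nonneg_right hD2 X0
  have e1 : 40 * (5 * s * 9 ^ s) ^ 2 * pairSum (fun k => wt s k * ζ k) (fun k => |(k : ℝ)| * ζ k) (fun k => vk k * ζ k) (k1, k2, k3, k4)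
     = 40 * (5 * s * 9 ^ s) ^ 2 *
      (wt s k1 * wt s k2 * (|↑k3| * vk k4 + vk k3 * |↑k4|) + wt s k1 * wt s k3 * (|↑k2| * vk k4 + vk k2 * |↑k4|) +
              wt s k1 * wt s k4 * (|↑k2| * vk k3 + vk k2 * |↑k3|) +
            wt s k2 * wt s k3 * (|↑k1| * vk k4 + vk k1 * |↑k4|) +
          wt s k2 * wt s k4 * (|↑k1| * vk k3 + vk k1 * |↑k3|) +
        wt s k3 * wt s k4 * (|↑k1| * vk k2 + vk k1 * |↑k2|)) * X := by
    simp only [pairSum]; ring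
  rw [e1]
  linarith
end

/-! Part G -/

noncomputable section
open ComplexConjugate

/-- truncated cubic nonlinearity -/
def Nl (S : Finset ℤ) (z : ℤ → ℂ) (k : ℤ) : ℂ :=
  ∑ k1 ∈ S, ∑ k2 ∈ S, ∑ k3 ∈ S, if k1 + k3 = k2 + k then (k3 : ℂ) * z k1 * conj (z k2) * z k3 else 0

def quad (z : ℤ → ℂ) (p : ℤ × ℤ × ℤ × ℤ) : ℂ := z p.1 * conj (z p.2.1) * z p.2.2.1 * conj (z p.2.2.2)

lemma sum_QS {S : Finset ℤ} {e : ℤ} (f : ℤ × ℤ × ℤ × ℤ → ℂ) :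
    ∑ p ∈ QS S e, f p = ∑ k1 ∈ S, ∑ k2 ∈ S, ∑ k3 ∈ S, ∑ k4 ∈ S,
      if k1 + k3 + e = k2 + k4 then f (k1, k2, k3, k4) else 0 := by
  unfold QS
  rw [Finset.sum_filter, Finset.sum_product]
  simp_rw [Finset.sum_product]

lemma sum_rot {S : Finset ℤ} (f : ℤ → ℤ → ℤ → ℤ → ℂ) :
    ∑ d ∈ S, ∑ a ∈ S, ∑ b ∈ S, ∑ c ∈ S, f a b c d = ∑ a ∈ S, ∑ b ∈ S, ∑ c ∈ S, ∑ d ∈ S, f a b c d := by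
  rw [Finset.sum_comm]
  refine Finset.sum_congr rfl fun a _ => ?_
  rw [Finset.sum_comm]
  refine Finset.sum_congr rfl fun b _ => ?_
  rw [Finset.sum_comm]

lemma sum_N_left {S : Finset ℤ} {e : ℤ} (b : ℤ → ℂ) (z w : ℤ → ℂ) :
    ∑ m ∈ S, b m * Nl S z (m - e) * conj (w m) = 
      ∑ p ∈ QS S e, (p.2.2.1 : ℂ) * b p.2.2.2 * (z p.1 * conj (z p.2.1) * z p.2.2.1 * conj (w p.2.2.2)) := by
  rw [sum_QS, ← sum_rot]
  refine Finset.sum_congr rfl fun d _ => ?_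
  unfold Nl
  rw [Finset.mul_sum, Finset.sum_mul]
  refine Finset.sum_congr rfl fun a _ => ?_
  rw [Finset.mul_sum, Finset.sum_mul]
  refine Finset.sum_congr rfl fun a' _ => ?_
  rw [Finset.mul_sum, Finset.sum_mul]
  refine Finset.sum_congr rfl fun c _ => ?_
  by_cases h : a + c = a' + (d - e)
  · rw [if_pos h, if_pos (by omega)]; simp only; ring
  · rw [if_neg h, if_neg (by omega)]; ring

lemma sum_N_right {S : Finset ℤ} {e : ℤ} (b : ℤ → ℂ) (z w : ℤ → ℂ) :
    ∑ k ∈ S, b k * w k * conj (Nl S z (k + e)) = 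
      ∑ p ∈ QS S e, (p.2.2.2 : ℂ) * b p.1 * (w p.1 * conj (z p.2.1) * z p.2.2.1 * conj (z p.2.2.2)) := by
  rw [sum_QS]
  refine Finset.sum_congr rfl fun d _ => ?_
  unfold Nl
  rw [map_sum, Finset.mul_sum]
  refine Finset.sum_congr rfl fun a _ => ?_
  rw [map_sum, Finset.mul_sum]
  refine Finset.sum_congr rfl fun c _ => ?_
  rw [map_sum, Finset.mul_sum]
  refine Finset.sum_congr rfl fun b' _ => ?_
  by_cases h : a + b' = c + (d + e)
  · rw [if_pos h, if_pos (by omega)]; simp only [map_mul, Complex.conj_conj, map_intCast]; ring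
  · rw [if_neg h, if_neg (by omega)]; simp

lemma QS_swap13 {S : Finset ℤ} {e : ℤ} (f : ℤ × ℤ × ℤ × ℤ → ℂ) :
    ∑ p ∈ QS S e, f p = ∑ p ∈ QS S e, f (p.2.2.1, p.2.1, p.1, p.2.2.2) := by
  refine Finset.sum_nbij' (fun p => (p.2.2.1, p.2.1, p.1, p.2.2.2)) (fun p => (p.2.2.1, p.2.1, p.1, p.2.2.2)) ?_ ?_ ?_ ?_ ?_
  · intro p hp; rw [mem_QS] at *; simp only; refine ⟨by tauto, by omega⟩
  · intro p hp; rw [mem_QS] at *; simp only; refine ⟨by tauto, by omega⟩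
  · intro p _; rfl
  · intro p _; rfl
  · intro p _; rfl

lemma QS_swap24 {S : Finset ℤ} {e : ℤ} (f : ℤ × ℤ × ℤ × ℤ → ℂ) :
    ∑ p ∈ QS S e, f p = ∑ p ∈ QS S e, f (p.1, p.2.2.2, p.2.2.1, p.2.1) := by
  refine Finset.sum_nbij' (fun p => (p.1, p.2.2.2, p.2.2.1, p.2.1)) (fun p => (p.1, p.2.2.2, p.2.2.1, p.2.1)) ?_ ?_ ?_ ?_ ?_
  · intro p hp; rw [mem_QS] at *; simp only; refine ⟨by tauto, by omega⟩
  · intro p hp; rw [mem_QS] at *; simp only; refine ⟨by tauto, by omega⟩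
  · intro p _; rfl
  · intro p _; rfl
  · intro p _; rfl

/-- static symmetrisation -/
lemma static_symm {S : Finset ℤ} {e : ℤ} (a : ℤ → ℝ) (z : ℤ → ℂ) :
    ∑ m ∈ S, (a (m - e) : ℂ) * Nl S z (m - e) * conj (z m) - ∑ k ∈ S, (a k : ℂ) * z k * conj (Nl S z (k + e))
      = (1 / 4) * ∑ p ∈ QS S e, (symb a e p : ℂ) * quad z p := by
  rw [sum_N_left (fun m => (a (m - e) : ℂ)), sum_N_right (fun m => (a m : ℂ)), ← Finset.sum_sub_distrib]
  set f : ℤ × ℤ × ℤ × ℤ → ℂ := fun p => (p.2.2.1 : ℂ) * (a (p.2.2.2 - e) : ℂ) * 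
      (z p.1 * conj (z p.2.1) * z p.2.2.1 * conj (z p.2.2.2)) - (p.2.2.2 : ℂ) * (a p.1 : ℂ) * 
      (z p.1 * conj (z p.2.1) * z p.2.2.1 * conj (z p.2.2.2)) with hf
  have h1 := QS_swap13 (S := S) (e := e) f
  have h2 := QS_swap24 (S := S) (e := e) f
  have h3 := QS_swap24 (S := S) (e := e) (fun p => f (p.2.2.1, p.2.1, p.1, p.2.2.2))
  have : ∑ p ∈ QS S e, f p = (1/4) * (∑ p ∈ QS S e, f p + ∑ p ∈ QS S e, f (p.2.2.1, p.2.1, p.1, p.2.2.2)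
    + ∑ p ∈ QS S e, f (p.1, p.2.2.2, p.2.2.1, p.2.1) + 
    ∑ p ∈ QS S e, (fun p => f (p.2.2.1, p.2.1, p.1, p.2.2.2)) (p.1, p.2.2.2, p.2.2.1, p.2.1)) := by
    rw [← h3, ← h2, ← h1]; ring
  rw [this, ← Finset.sum_add_distrib, ← Finset.sum_add_distrib, ← Finset.sum_add_distrib]
  congr 1
  refine Finset.sum_congr rfl fun p _ => ?_
  simp only [hf, symb, quad]
  push_cast
  ring

/-- Galerkin solutions -/
structure GSol (S : Finset ℤ) (lam : ℤ → ℝ) (J : Set ℝ) (z : ℝ → ℤ → ℂ) : Prop where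
  supp : ∀ t, ∀ k, k ∉ S → z t k = 0
  der : ∀ t ∈ J, ∀ k ∈ S, HasDerivAt (fun τ => z τ k) (Complex.I * (lam k * z t k + Nl S (z t) k)) t

lemma GSol.der' {S : Finset ℤ} {lam : ℤ → ℝ} {J : Set ℝ} {z : ℝ → ℤ → ℂ} (H : GSol S lam J z)
    {t : ℝ} (ht : t ∈ J) (k : ℤ) :
    HasDerivAt (fun τ => z τ k) (Complex.I * (lam k * z t k + if k ∈ S then Nl S (z t) k else 0)) t := by
  by_cases hk : k ∈ S
  · rw [if_pos hk]; exact H.der t ht k hk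
  · rw [if_neg hk, H.supp t k hk]
    have : (fun τ => z τ k) = fun _ => 0 := by ext τ; exact H.supp τ k hk
    rw [this]
    simpa using hasDerivAt_const t (0 : ℂ)

def Ff (S : Finset ℤ) (e : ℤ) (a : ℤ → ℝ) (z : ℤ → ℂ) : ℂ := ∑ k ∈ S, (a k : ℂ) * z k * conj (z (k + e))

def Bd (S : Finset ℤ) (e : ℤ) (a : ℤ → ℝ) (z : ℤ → ℂ) : ℂ :=
  ∑ m ∈ S, (if m - e ∈ S then 0 else (a (m - e) : ℂ) * Nl S z (m - e) * conj (z m))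
  - ∑ k ∈ S, (if k + e ∈ S then 0 else (a k : ℂ) * z k * conj (Nl S z (k + e)))

lemma Ff_deriv {S : Finset ℤ} {lam : ℤ → ℝ} {J : Set ℝ} {z : ℝ → ℤ → ℂ} (H : GSol S lam J z)
    (e : ℤ) (a : ℤ → ℝ) {t : ℝ} (ht : t ∈ J) :
    HasDerivAt (fun τ => Ff S e a (z τ)) 
      (Complex.I * ((∑ k ∈ S, ((lam k - lam (k + e) : ℝ) : ℂ) * ((a k : ℂ) * z t k * conj (z t (k + e)))) 
        + (1 / 4) * ∑ p ∈ QS S e, (symb a e p : ℂ) * quad (z t) p - Bd S e a (z t))) t := by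
  have h1 : ∀ k ∈ S, HasDerivAt (fun τ => (a k : ℂ) * z τ k * conj (z τ (k + e)))
     ((a k : ℂ) * (Complex.I * (lam k * z t k + if k ∈ S then Nl S (z t) k else 0)) * conj (z t (k + e))
      + (a k : ℂ) * z t k * conj (Complex.I * (lam (k + e) * z t (k + e) + if k + e ∈ S then Nl S (z t) (k + e) else 0))) t := by
    intro k _
    have d1 := (H.der' ht k).const_mul (a k : ℂ)
    have d2 := (H.der' ht (k + e)).star
    exact d1.mul d2
  have h2 := HasDerivAt.fun_sum h1
  unfold Ff
  refine h2.congr_deriv (Eq.symm ?_)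
  rw [← static_symm]
  have e1 : ∑ m ∈ S, (a (m - e) : ℂ) * Nl S (z t) (m - e) * conj (z t m) - 
     ∑ m ∈ S, (if m - e ∈ S then 0 else (a (m - e) : ℂ) * Nl S (z t) (m - e) * conj (z t m)) = 
     ∑ k ∈ S, (a k : ℂ) * Nl S (z t) k * conj (z t (k + e)) := by
    rw [← Finset.sum_sub_distrib]
    have : ∀ m ∈ S, ((a (m - e) : ℂ) * Nl S (z t) (m - e) * conj (z t m) - 
      (if m - e ∈ S then 0 else (a (m - e) : ℂ) * Nl S (z t) (m - e) * conj (z t m))) = 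
      if m - e ∈ S then (a (m - e) : ℂ) * Nl S (z t) (m - e) * conj (z t m) else 0 := by
      intro m _; split_ifs <;> ring
    rw [Finset.sum_congr rfl this]
    have h3 : ∀ k ∈ S, (a k : ℂ) * Nl S (z t) k * conj (z t (k + e)) = 
       if k + e ∈ S then (a k : ℂ) * Nl S (z t) k * conj (z t (k + e)) else 0 := by
      intro k _
      split_ifs with h
      · rfl
      · rw [H.supp t _ h]; simp
    rw [Finset.sum_congr rfl h3, ← Finset.sum_filter, ← Finset.sum_filter]
    refine Finset.sum_nbij' (fun m => m - e) (fun k => k + e) ?_ ?_ ?_ ?_ ?_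
    · intro m hm; simp only [Finset.mem_filter] at *; simpa using hm.symm
    · intro m hm; simp only [Finset.mem_filter] at *; simpa using hm.symm
    · intro m _; simp
    · intro m _; simp
    · intro m _; simp
  have e2 : ∑ k ∈ S, (a k : ℂ) * z t k * conj (Nl S (z t) (k + e)) - 
     ∑ k ∈ S, (if k + e ∈ S then 0 else (a k : ℂ) * z t k * conj (Nl S (z t) (k + e))) = 
     ∑ k ∈ S, (a k : ℂ) * z t k * conj (if k + e ∈ S then Nl S (z t) (k + e) else 0) := by
    rw [← Finset.sum_sub_distrib]
    refine Finset.sum_congr rfl fun k _ => ?_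
    split_ifs <;> simp
  have e3 : (∑ k ∈ S, ((lam k - lam (k + e) : ℝ) : ℂ) * ((a k : ℂ) * z t k * conj (z t (k + e)))) +
     (∑ m ∈ S, (a (m - e) : ℂ) * Nl S (z t) (m - e) * conj (z t m) - ∑ k ∈ S, (a k : ℂ) * z t k * conj (Nl S (z t) (k + e)))
     - Bd S e a (z t) = (∑ k ∈ S, ((lam k - lam (k + e) : ℝ) : ℂ) * ((a k : ℂ) * z t k * conj (z t (k + e)))) +
     (∑ k ∈ S, (a k : ℂ) * Nl S (z t) k * conj (z t (k + e)) - 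
     ∑ k ∈ S, (a k : ℂ) * z t k * conj (if k + e ∈ S then Nl S (z t) (k + e) else 0)) := by
    rw [← e1, ← e2, Bd]; ring
  rw [e3, ← Finset.sum_sub_distrib, ← Finset.sum_add_distrib, Finset.mul_sum]
  refine Finset.sum_congr rfl fun k hk => ?_
  rw [if_pos hk]
  simp only [map_mul, map_add, Complex.conj_I, Complex.conj_ofReal]
  push_cast
  ring
end

/-! Part H -/

noncomputable section
open ComplexConjugate

lemma hasDerivAt_re {f : ℝ → ℂ} {f' : ℂ} {t : ℝ} (h : HasDerivAt f f' t) : HasDerivAt (fun τ => (f τ).re) f'.re t := by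
  have := Complex.reCLM.hasFDerivAt.comp_hasDerivAt t h
  exact this

lemma hasDerivAt_im {f : ℝ → ℂ} {f' : ℂ} {t : ℝ} (h : HasDerivAt f f' t) : HasDerivAt (fun τ => (f τ).im) f'.im t := by
  have := Complex.imCLM.hasFDerivAt.comp_hasDerivAt t h
  exact this

def Ys (S : Finset ℤ) (a : ℤ → ℝ) (z : ℤ → ℂ) : ℝ := ∑ k ∈ S, a k * ‖z k‖ ^ 2

def W1 (S : Finset ℤ) (z : ℤ → ℂ) : ℝ := ∑ k ∈ S, |(k : ℝ)| * ‖z k‖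

lemma Ff_zero (S : Finset ℤ) (a : ℤ → ℝ) (z : ℤ → ℂ) : Ff S 0 a z = (Ys S a z : ℂ) := by
  unfold Ff Ys
  rw [Complex.ofReal_sum]
  refine Finset.sum_congr rfl fun k _ => ?_
  rw [add_zero, mul_assoc, Complex.mul_conj, Complex.normSq_eq_norm_sq]
  push_cast; ring

lemma Bd_zero (S : Finset ℤ) (a : ℤ → ℝ) (z : ℤ → ℂ) : Bd S 0 a z = 0 := by
  unfold Bd
  rw [Finset.sum_eq_zero, Finset.sum_eq_zero, sub_zero]
  · intro k hk; simp [hk]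
  · intro k hk; simp [hk]

lemma Ys_deriv {S : Finset ℤ} {lam : ℤ → ℝ} {J : Set ℝ} {z : ℝ → ℤ → ℂ} (H : GSol S lam J z)
    (a : ℤ → ℝ) {t : ℝ} (ht : t ∈ J) :
    HasDerivAt (fun τ => Ys S a (z τ)) 
      (Complex.I * ((1 / 4) * ∑ p ∈ QS S 0, (symb a 0 p : ℂ) * quad (z t) p)).re t := by
  have h := hasDerivAt_re (Ff_deriv H 0 a ht)
  simp only [Ff_zero, Bd_zero, Complex.ofReal_re, add_zero, sub_self, Complex.ofReal_zero, zero_mul, Finset.sum_const_zero, zero_add, sub_zero] at h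
  exact h

lemma mass_deriv {S : Finset ℤ} {lam : ℤ → ℝ} {J : Set ℝ} {z : ℝ → ℤ → ℂ} (H : GSol S lam J z)
    {t : ℝ} (ht : t ∈ J) : HasDerivAt (fun τ => Ys S (fun _ => 1) (z τ)) 0 t := by
  refine (Ys_deriv H _ ht).congr_deriv ?_
  rw [Finset.sum_eq_zero]
  · simp
  intro p hp
  rw [mem_QS] at hp
  have : symb (fun _ => 1) 0 p = 0 := by
    unfold symb
    have : ((p.1 : ℝ) + p.2.2.1) + (0 : ℤ) = (p.2.1 : ℝ) + p.2.2.2 := by exact_mod_cast hp.2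
    simp only [Int.cast_zero, add_zero] at this
    rw [this]; ring
  rw [this]; simp

lemma mom_deriv {S : Finset ℤ} {lam : ℤ → ℝ} {J : Set ℝ} {z : ℝ → ℤ → ℂ} (H : GSol S lam J z)
    {t : ℝ} (ht : t ∈ J) : HasDerivAt (fun τ => Ys S (fun k => (k : ℝ)) (z τ)) 0 t := by
  refine (Ys_deriv H _ ht).congr_deriv ?_
  rw [Finset.sum_eq_zero]
  · simp
  intro p hp
  have : symb (fun k => (k : ℝ)) 0 p = 0 := by
    unfold symb
    push_cast
    ring
  rw [this]; simp

lemma norm_quad (z : ℤ → ℂ) (p : ℤ × ℤ × ℤ × ℤ) : ‖quad z p‖ = ‖z p.1‖ * ‖z p.2.1‖ * ‖z p.2.2.1‖ * ‖z p.2.2.2‖ := by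
  simp [quad]

lemma Ys_deriv_bound {S : Finset ℤ} (hS : ∀ k ∈ S, Odd k) {a : ℤ → ℝ} {w : ℤ → ℝ} {D : ℝ} (hA : Adm a 0 w D) (z : ℤ → ℂ) :
    |(Complex.I * ((1 / 4) * ∑ p ∈ QS S 0, (symb a 0 p : ℂ) * quad z p)).re| ≤ 
      120 * D ^ 2 * (W1 S z) ^ 2 * Ys S (fun k => w k ^ 2) z := by
  refine (Complex.abs_re_le_norm _).trans ?_
  rw [norm_mul, norm_mul, Complex.norm_I, one_mul]
  have h1 : ‖∑ p ∈ QS S 0, (symb a 0 p : ℂ) * quad z p‖ ≤ ∑ p ∈ QS S 0, 40 * D ^ 2 * 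
      pairSum (fun k => w k * ‖z k‖) (fun k => |(k : ℝ)| * ‖z k‖) (fun k => |(k : ℝ)| * ‖z k‖) p := by
    refine (norm_sum_le _ _).trans (Finset.sum_le_sum fun p hp => ?_)
    rw [mem_QS] at hp
    rw [norm_mul, norm_quad, Complex.norm_real, Real.norm_eq_abs]
    have h := symb_bound hA p (hS _ hp.1.1) (hS _ hp.1.2.1) (hS _ hp.1.2.2.1) (hS _ hp.1.2.2.2) hp.2
    have h2 := mul_le_mul_of_nonneg_right h (show 0 ≤ ‖z p.1‖ * ‖z p.2.1‖ * ‖z p.2.2.1‖ * ‖z p.2.2.2‖ by positivity)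
    refine h2.trans ?_
    have hD := hA.hD
    rw [mul_assoc (40 * D ^ 2)]
    refine mul_le_mul_of_nonneg_left ?_ (by positivity)
    unfold pairSum
    have g := fun k => hA.w0 k
    have e1 := g p.1
    have e2 := g p.2.1
    have e3 := g p.2.2.1
    have e4 := g p.2.2.2
    have : ∀ X Y : ℝ, 0 ≤ X → Y = 2 * X → X ≤ Y := fun X Y a b => by linarith
    refine this _ _ ?_ ?_
    · positivity
    · ring
  rw [← Finset.mul_sum] at h1
  have h2 := sum_pairSum_le (S := S) (e := 0) (fun k => w k * ‖z k‖) (fun k => |(k : ℝ)| * ‖z k‖) (fun k => |(k : ℝ)| * ‖z k‖)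
     (fun k => mul_nonneg (hA.w0 k) (norm_nonneg _)) (fun k => by positivity) (fun k => by positivity)
  have h3 := mul_le_mul_of_nonneg_left h2 (show 0 ≤ 40 * D ^ 2 by positivity)
  have h4 : ∑ k ∈ S, (w k * ‖z k‖) ^ 2 = Ys S (fun k => w k ^ 2) z := by
    unfold Ys; refine Finset.sum_congr rfl fun k _ => by ring
  rw [h4] at h3
  change _ ≤ 40 * D ^ 2 * (12 * (_ * W1 S z * W1 S z)) at h3
  have : ‖(1 / 4 : ℂ)‖ = 1 / 4 := by norm_num
  rw [this]
  linarith

/-- Gronwall for the energy estimate -/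
lemma gronwall_basic {f f' : ℝ → ℝ} {C T : ℝ} (hd : ∀ t ∈ Set.Icc 0 T, HasDerivAt f (f' t) t)
    (hb : ∀ t ∈ Set.Icc 0 T, f' t ≤ C * f t) : ∀ t ∈ Set.Icc 0 T, f t ≤ Real.exp (C * t) * f 0 := by
  intro t ht
  have hanti : AntitoneOn (fun τ => Real.exp (-(C * τ)) * f τ) (Set.Icc 0 T) := by
    have hd2 : ∀ τ ∈ Set.Icc 0 T, HasDerivAt (fun τ => Real.exp (-(C * τ)) * f τ) 
       (Real.exp (-(C * τ)) * (-C) * f τ + Real.exp (-(C * τ)) * f' τ) τ := by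
      intro τ hτ
      have h1 : HasDerivAt (fun τ : ℝ => -(C * τ)) (-C) τ := by
        exact (((hasDerivAt_id τ).const_mul C).neg).congr_deriv (by simp)
      exact h1.exp.mul (hd τ hτ)
    refine antitoneOn_of_deriv_nonpos (convex_Icc _ _) (fun τ hτ => (hd2 τ hτ).continuousAt.continuousWithinAt) 
      (fun τ hτ => (hd2 τ (interior_subset hτ)).differentiableAt.differentiableWithinAt) ?_
    intro τ hτ
    have hτ' := interior_subset hτ
    rw [(hd2 τ hτ').deriv]
    have := hb τ hτ'
    have e := Real.exp_pos (-(C * τ))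
    nlinarith
  have h0 : (0 : ℝ) ∈ Set.Icc 0 T := ⟨le_rfl, ht.1.trans ht.2⟩
  have := hanti h0 ht ht.1
  simp only [mul_zero, neg_zero, Real.exp_zero, one_mul] at this
  rw [Real.exp_neg] at this
  have e := Real.exp_pos (C * t)
  rw [inv_mul_le_iff₀ e] at this
  exact this

lemma const_of_deriv_zero {E : Type*} [NormedAddCommGroup E] [NormedSpace ℝ E] {f : ℝ → E} {T : ℝ} (hd : ∀ t ∈ Set.Icc 0 T, HasDerivAt f 0 t) : 
    ∀ t ∈ Set.Icc 0 T, f t = f 0 := by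
  intro t ht
  refine constant_of_has_deriv_right_zero (fun τ hτ => (hd τ hτ).continuousAt.continuousWithinAt) 
    (fun τ hτ => (hd τ ⟨hτ.1, hτ.2.le⟩).hasDerivWithinAt) t ht

def CE (σ : ℝ) : ℝ := 120 * ((5 : ℝ) ^ σ + 2 * σ + 1) ^ 2 * 16

lemma energy_est {S : Finset ℤ} (hS : ∀ k ∈ S, Odd k) {lam : ℤ → ℝ} {T : ℝ} {z : ℝ → ℤ → ℂ} (H : GSol S lam (Set.Icc 0 T) z)
    {σ R : ℝ} (hσ : 1 / 2 ≤ σ) (hR : 1 ≤ R) (hW : ∀ t ∈ Set.Icc 0 T, W1 S (z t) ≤ 4) :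
    ∀ t ∈ Set.Icc 0 T, Ys S (fun k => wR σ R k ^ 2) (z t) ≤ Real.exp (CE σ * t) * Ys S (fun k => wR σ R k ^ 2) (z 0) := by
  refine gronwall_basic (fun t ht => Ys_deriv H _ ht) ?_
  intro t ht
  refine (le_abs_self _).trans ((Ys_deriv_bound hS (adm_min hσ hR) (z t)).trans ?_)
  have h1 := hW t ht
  have h0 : 0 ≤ W1 S (z t) := Finset.sum_nonneg fun k _ => by positivity
  have hY : 0 ≤ Ys S (fun k => wR σ R k ^ 2) (z t) := Finset.sum_nonneg fun k _ => by positivity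
  refine mul_le_mul_of_nonneg_right ?_ hY
  unfold CE
  refine mul_le_mul_of_nonneg_left (by nlinarith) (by positivity)

/-! energy -/
def Pq (S : Finset ℤ) (z : ℤ → ℂ) : ℂ := ∑ p ∈ QS S 0, ((p.1 : ℂ) + p.2.2.1) * quad z p

lemma Pq_poly {S : Finset ℤ} (z w : ℤ → ℂ) : 
    ∑ p ∈ QS S 0, ((p.1 : ℂ) + p.2.2.1) * (w p.1 * conj (z p.2.1) * z p.2.2.1 * conj (z p.2.2.2) + z p.1 * conj (w p.2.1) * z p.2.2.1 * conj (z p.2.2.2)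
      + z p.1 * conj (z p.2.1) * w p.2.2.1 * conj (z p.2.2.2) + z p.1 * conj (z p.2.1) * z p.2.2.1 * conj (w p.2.2.2))
     = 4 * ∑ k ∈ S, (Nl S z k * conj (w k) + w k * conj (Nl S z k)) := by
  have h1 := sum_N_left (S := S) (e := 0) (fun _ => 1) z w
  have h2 := sum_N_right (S := S) (e := 0) (fun _ => 1) z w
  simp only [one_mul, mul_one, sub_zero, add_zero] at h1 h2
  rw [Finset.sum_add_distrib, h1, h2]
  simp only [mul_add, Finset.sum_add_distrib]
  have s1 := QS_swap13 (S := S) (e := 0) (fun p => ((p.1 : ℂ) + p.2.2.1) * (z p.1 * conj (z p.2.1) * w p.2.2.1 * conj (z p.2.2.2)))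
  have s2 := QS_swap24 (S := S) (e := 0) (fun p => ((p.1 : ℂ) + p.2.2.1) * (z p.1 * conj (w p.2.1) * z p.2.2.1 * conj (z p.2.2.2)))
  have s3 := QS_swap13 (S := S) (e := 0) (fun p => (p.1 : ℂ) * (z p.1 * conj (z p.2.1) * z p.2.2.1 * conj (w p.2.2.2)))
  have s4 := QS_swap24 (S := S) (e := 0) (fun p => (p.2.1 : ℂ) * (w p.1 * conj (z p.2.1) * z p.2.2.1 * conj (z p.2.2.2)))
  have s5 : ∑ p ∈ QS S 0, ((p.1 : ℂ) + p.2.2.1) * (w p.1 * conj (z p.2.1) * z p.2.2.1 * conj (z p.2.2.2)) = 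
     ∑ p ∈ QS S 0, ((p.2.1 : ℂ) + p.2.2.2) * (w p.1 * conj (z p.2.1) * z p.2.2.1 * conj (z p.2.2.2)) := by
    refine Finset.sum_congr rfl fun p hp => ?_
    rw [mem_QS] at hp
    have : ((p.1 : ℂ) + p.2.2.1) + (0 : ℤ) = (p.2.1 : ℂ) + p.2.2.2 := by exact_mod_cast hp.2
    simp only [Int.cast_zero, add_zero] at this
    rw [this]
  have s6 : ∑ p ∈ QS S 0, ((p.1 : ℂ) + p.2.2.1) * (z p.1 * conj (z p.2.1) * w p.2.2.1 * conj (z p.2.2.2)) = 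
     ∑ p ∈ QS S 0, ((p.1 : ℂ) + p.2.2.1) * (w p.1 * conj (z p.2.1) * z p.2.2.1 * conj (z p.2.2.2)) := by
    rw [s1]; refine Finset.sum_congr rfl fun p hp => ?_
    simp only; ring
  have s7 : ∑ p ∈ QS S 0, ((p.1 : ℂ) + p.2.2.1) * (z p.1 * conj (w p.2.1) * z p.2.2.1 * conj (z p.2.2.2)) = 
     ∑ p ∈ QS S 0, ((p.1 : ℂ) + p.2.2.1) * (z p.1 * conj (z p.2.1) * z p.2.2.1 * conj (w p.2.2.2)) := by
    rw [s2]; refine Finset.sum_congr rfl fun p hp => ?_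
    simp only; ring
  have s3' : ∑ p ∈ QS S 0, (p.1 : ℂ) * (z p.1 * conj (z p.2.1) * z p.2.2.1 * conj (w p.2.2.2)) = 
     ∑ p ∈ QS S 0, (p.2.2.1 : ℂ) * (z p.1 * conj (z p.2.1) * z p.2.2.1 * conj (w p.2.2.2)) := by
    rw [s3]; refine Finset.sum_congr rfl fun p hp => ?_
    simp only; ring
  have s4' : ∑ p ∈ QS S 0, (p.2.1 : ℂ) * (w p.1 * conj (z p.2.1) * z p.2.2.1 * conj (z p.2.2.2)) = 
     ∑ p ∈ QS S 0, (p.2.2.2 : ℂ) * (w p.1 * conj (z p.2.1) * z p.2.2.1 * conj (z p.2.2.2)) := by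
    rw [s4]; refine Finset.sum_congr rfl fun p hp => ?_
    simp only; ring
  have s8 : ∑ p ∈ QS S 0, ((p.1 : ℂ) + p.2.2.1) * (z p.1 * conj (z p.2.1) * z p.2.2.1 * conj (w p.2.2.2)) = 
     2 * ∑ p ∈ QS S 0, (p.2.2.1 : ℂ) * (z p.1 * conj (z p.2.1) * z p.2.2.1 * conj (w p.2.2.2)) := by
    simp only [add_mul, Finset.sum_add_distrib]; rw [s3']; ring
  have s9 : ∑ p ∈ QS S 0, ((p.2.1 : ℂ) + p.2.2.2) * (w p.1 * conj (z p.2.1) * z p.2.2.1 * conj (z p.2.2.2)) = 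
     2 * ∑ p ∈ QS S 0, (p.2.2.2 : ℂ) * (w p.1 * conj (z p.2.1) * z p.2.2.1 * conj (z p.2.2.2)) := by
    simp only [add_mul, Finset.sum_add_distrib]; rw [s4']; ring
  rw [s6, s7, s5, s8, s9]
  ring

lemma energy_deriv {S : Finset ℤ} {lam : ℤ → ℝ} {J : Set ℝ} {z : ℝ → ℤ → ℂ} (H : GSol S lam J z)
    {t : ℝ} (ht : t ∈ J) : HasDerivAt (fun τ => (Ys S lam (z τ) : ℂ) + (1 / 4) * Pq S (z τ)) 0 t := by
  set w : ℤ → ℂ := fun k => Complex.I * (lam k * z t k + if k ∈ S then Nl S (z t) k else 0) with hw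
  have hd : ∀ k, HasDerivAt (fun τ => z τ k) (w k) t := fun k => H.der' ht k
  have h1 : ∀ p ∈ QS S 0, HasDerivAt (fun τ => ((p.1 : ℂ) + p.2.2.1) * quad (z τ) p) (((p.1 : ℂ) + p.2.2.1) * 
     (w p.1 * conj (z t p.2.1) * z t p.2.2.1 * conj (z t p.2.2.2) + z t p.1 * conj (w p.2.1) * z t p.2.2.1 * conj (z t p.2.2.2)
      + z t p.1 * conj (z t p.2.1) * w p.2.2.1 * conj (z t p.2.2.2) + z t p.1 * conj (z t p.2.1) * z t p.2.2.1 * conj (w p.2.2.2))) t := by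
    intro p _
    have d2 : HasDerivAt (fun τ => conj (z τ p.2.1)) (conj (w p.2.1)) t := (hd p.2.1).star
    have d4 : HasDerivAt (fun τ => conj (z τ p.2.2.2)) (conj (w p.2.2.2)) t := (hd p.2.2.2).star
    have := ((((hd p.1).mul d2).mul (hd p.2.2.1)).mul d4).const_mul ((p.1 : ℂ) + p.2.2.1)
    refine this.congr_deriv ?_
    simp only [Pi.mul_apply]
    ring
  have h2 := HasDerivAt.fun_sum h1
  rw [Pq_poly] at h2
  have h3 : ∀ k ∈ S, HasDerivAt (fun τ => (lam k : ℂ) * (z τ k * conj (z τ k))) (lam k * (w k * conj (z t k) + z t k * conj (w k))) t := by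
    intro k _
    have d2 : HasDerivAt (fun τ => conj (z τ k)) (conj (w k)) t := (hd k).star
    exact ((hd k).mul d2).const_mul (lam k : ℂ)
  have h4 := HasDerivAt.fun_sum h3
  have h5 : ∀ τ, (Ys S lam (z τ) : ℂ) = ∑ k ∈ S, (lam k : ℂ) * (z τ k * conj (z τ k)) := by
    intro τ
    rw [← Ff_zero]; unfold Ff
    refine Finset.sum_congr rfl fun k _ => by rw [add_zero]; ring
  simp only [h5]
  have h6 := h4.add (h2.const_mul (1 / 4 : ℂ))
  refine h6.congr_deriv ?_
  rw [← mul_assoc, show (1 / 4 : ℂ) * 4 = 1 by norm_num, one_mul, ← Finset.sum_add_distrib]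
  refine Finset.sum_eq_zero fun k hk => ?_
  have hwk : w k = Complex.I * (lam k * z t k + Nl S (z t) k) := by simp only [hw, if_pos hk]
  rw [hwk]
  simp only [map_mul, map_add, Complex.conj_I, Complex.conj_ofReal]
  ring

lemma norm_le_abs_mul {k : ℤ} (hk : Odd k) {x : ℝ} (hx : 0 ≤ x) : x ≤ |(k : ℝ)| * x := by
  have := odd_abs_ge hk
  nlinarith

lemma W1_nonneg (S : Finset ℤ) (z : ℤ → ℂ) : 0 ≤ W1 S z := Finset.sum_nonneg fun k _ => by positivity

lemma W0_le {S : Finset ℤ} (hS : ∀ k ∈ S, Odd k) (z : ℤ → ℂ) : ∑ k ∈ S, ‖z k‖ ≤ W1 S z :=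
  Finset.sum_le_sum fun k hk => norm_le_abs_mul (hS k hk) (norm_nonneg _)

lemma norm_le_W1 {S : Finset ℤ} (hS : ∀ k ∈ S, Odd k) (z : ℤ → ℂ) {k : ℤ} (hk : k ∈ S) : ‖z k‖ ≤ W1 S z :=
  (Finset.single_le_sum (f := fun k => ‖z k‖) (fun k _ => norm_nonneg _) hk).trans (W0_le hS z)

lemma Nl_bound {S : Finset ℤ} (hS : ∀ k ∈ S, Odd k) (z : ℤ → ℂ) (k : ℤ) : ‖Nl S z k‖ ≤ W1 S z ^ 3 := by
  unfold Nl
  have : W1 S z ^ 3 = ∑ k1 ∈ S, ∑ k2 ∈ S, ∑ k3 ∈ S, (|(k1 : ℝ)| * ‖z k1‖) * (|(k2 : ℝ)| * ‖z k2‖) * (|(k3 : ℝ)| * ‖z k3‖) := by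
    have e1 : ∀ k1 ∈ S, ∑ k2 ∈ S, ∑ k3 ∈ S, (|(k1 : ℝ)| * ‖z k1‖) * (|(k2 : ℝ)| * ‖z k2‖) * (|(k3 : ℝ)| * ‖z k3‖) = (|(k1 : ℝ)| * ‖z k1‖) * (W1 S z * W1 S z) := by
      intro k1 _
      simp_rw [← Finset.mul_sum]
      rw [← Finset.sum_mul, ← Finset.mul_sum]
      unfold W1; ring
    rw [Finset.sum_congr rfl e1, ← Finset.sum_mul]
    change _ = W1 S z * _
    ring
  rw [this]
  refine (norm_sum_le _ _).trans (Finset.sum_le_sum fun k1 h1 => ?_)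
  refine (norm_sum_le _ _).trans (Finset.sum_le_sum fun k2 h2 => ?_)
  refine (norm_sum_le _ _).trans (Finset.sum_le_sum fun k3 h3 => ?_)
  have a1 := norm_le_abs_mul (hS k1 h1) (norm_nonneg (z k1))
  have a2 := norm_le_abs_mul (hS k2 h2) (norm_nonneg (z k2))
  split_ifs
  · have : ‖(k3 : ℂ) * z k1 * conj (z k2) * z k3‖ = ‖z k1‖ * ‖z k2‖ * (|(k3 : ℝ)| * ‖z k3‖) := by
      simp; ring
    rw [this]
    gcongr
  · simp; positivity

lemma Pq_bound {S : Finset ℤ} (hS : ∀ k ∈ S, Odd k) (z : ℤ → ℂ) : ‖Pq S z‖ ≤ 2 * W1 S z ^ 4 := by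
  have h1 : Pq S z = 2 * ∑ k ∈ S, Nl S z k * conj (z k) := by
    have h1 := sum_N_left (S := S) (e := 0) (fun _ => 1) z z
    simp only [one_mul, mul_one, sub_zero] at h1
    rw [h1]
    have s3 := QS_swap13 (S := S) (e := 0) (fun p => (p.1 : ℂ) * (z p.1 * conj (z p.2.1) * z p.2.2.1 * conj (z p.2.2.2)))
    unfold Pq quad
    simp only [add_mul, Finset.sum_add_distrib]; rw [s3, two_mul]
    congr 1
    refine Finset.sum_congr rfl fun p hp => ?_
    simp only; ring
  rw [h1, norm_mul]
  have : ‖∑ k ∈ S, Nl S z k * conj (z k)‖ ≤ W1 S z ^ 3 * W1 S z := by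
    refine (norm_sum_le _ _).trans ?_
    have : ∑ k ∈ S, ‖Nl S z k * conj (z k)‖ ≤ ∑ k ∈ S, W1 S z ^ 3 * ‖z k‖ := by
      refine Finset.sum_le_sum fun k hk => ?_
      rw [norm_mul, RCLike.norm_conj]
      exact mul_le_mul_of_nonneg_right (Nl_bound hS z k) (norm_nonneg _)
    refine this.trans ?_
    rw [← Finset.mul_sum]
    exact mul_le_mul_of_nonneg_left (W0_le hS z) (pow_nonneg (W1_nonneg _ _) _)
  have e : ‖(2 : ℂ)‖ = 2 := by norm_num
  rw [e]; nlinarith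
end

/-! Part I -/

noncomputable section
open ComplexConjugate

lemma sum_isP {M : Type*} [AddCommMonoid M] {S : Finset ℤ} (h1 : (1 : ℤ) ∈ S) (hm : (-1 : ℤ) ∈ S) (f : ℤ → M) :
    ∑ k ∈ S, (if isP k then f k else 0) = f 1 + f (-1) := by
  rw [← Finset.sum_filter]
  have : S.filter isP = {1, -1} := by
    ext k
    simp only [Finset.mem_filter, Finset.mem_insert, Finset.mem_singleton, isP]
    constructor
    · exact fun h => h.2
    · rintro (rfl | rfl)
      · exact ⟨h1, Or.inl rfl⟩
      · exact ⟨hm, Or.inr rfl⟩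
  rw [this, Finset.sum_pair (by norm_num)]

lemma sum_isP' {M : Type*} [AddCommMonoid M] {S : Finset ℤ} (h1 : (1 : ℤ) ∈ S) (hm : (-1 : ℤ) ∈ S) (f : ℤ → M) :
    ∑ k ∈ ({1, -1} : Finset ℤ), f k = ∑ k ∈ S, (if isP k then f k else 0) := by
  rw [sum_isP h1 hm, Finset.sum_pair (by norm_num)]

def Vh (S : Finset ℤ) (z : ℤ → ℂ) : ℝ := ∑ k ∈ S, vk k * ‖z k‖
def Xh (S : Finset ℤ) (z : ℤ → ℂ) : ℝ := Ys S (fun k => if isP k then 0 else 1) z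

lemma Vh_nonneg (S : Finset ℤ) (z : ℤ → ℂ) : 0 ≤ Vh S z := Finset.sum_nonneg fun k _ => mul_nonneg (vk_nonneg k) (norm_nonneg _)

lemma Xh_nonneg (S : Finset ℤ) (z : ℤ → ℂ) : 0 ≤ Xh S z := Finset.sum_nonneg fun k _ => by
  refine mul_nonneg ?_ (by positivity)
  dsimp only
  split_ifs <;> norm_num

lemma isP_abs {k : ℤ} (h : isP k) : |(k : ℝ)| = 1 := by
  rcases h with rfl | rfl <;> simp

lemma notP_abs {k : ℤ} (hk : Odd k) (h : ¬ isP k) : 3 ≤ |(k : ℝ)| := by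
  unfold isP at h
  obtain ⟨m, rfl⟩ := hk
  have : 3 ≤ |2 * m + 1| := by
    rcases abs_cases (2 * m + 1) with h' | h' <;> omega
  exact_mod_cast this

lemma W1_eq {S : Finset ℤ} (h1 : (1 : ℤ) ∈ S) (hm : (-1 : ℤ) ∈ S) (z : ℤ → ℂ) : W1 S z = ‖z 1‖ + ‖z (-1)‖ + Vh S z := by
  rw [← sum_isP h1 hm (fun k => ‖z k‖)]
  unfold W1 Vh
  rw [← Finset.sum_add_distrib]
  refine Finset.sum_congr rfl fun k _ => ?_
  unfold vk
  split_ifs with h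
  · rw [isP_abs h]; ring
  · ring

lemma Ys_eq {S : Finset ℤ} (h1 : (1 : ℤ) ∈ S) (hm : (-1 : ℤ) ∈ S) (a : ℤ → ℝ) (z : ℤ → ℂ) : 
    Ys S a z = a 1 * ‖z 1‖ ^ 2 + a (-1) * ‖z (-1)‖ ^ 2 + Ys S (fun k => if isP k then 0 else a k) z := by
  rw [← sum_isP h1 hm (fun k => a k * ‖z k‖ ^ 2)]
  unfold Ys
  rw [← Finset.sum_add_distrib]
  refine Finset.sum_congr rfl fun k _ => ?_
  dsimp only
  split_ifs with h <;> ring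

lemma wt_wR {S : Finset ℤ} : ∃ R : ℝ, 1 ≤ R ∧ ∀ σ, ∀ k ∈ S, wR σ R k = wt σ k := by
  refine ⟨1 + ∑ k ∈ S, |(k : ℝ)|, ?_, ?_⟩
  · have : 0 ≤ ∑ k ∈ S, |(k : ℝ)| := Finset.sum_nonneg fun k _ => abs_nonneg _
    linarith
  · intro σ k hk
    unfold wR wt
    rw [min_eq_left]
    have := Finset.single_le_sum (f := fun k : ℤ => |(k : ℝ)|) (fun k _ => abs_nonneg _) hk
    linarith

lemma energy_est_wt {S : Finset ℤ} (hS : ∀ k ∈ S, Odd k) {lam : ℤ → ℝ} {T : ℝ} {z : ℝ → ℤ → ℂ} (H : GSol S lam (Set.Icc 0 T) z)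
    {σ : ℝ} (hσ : 1 / 2 ≤ σ) (hW : ∀ t ∈ Set.Icc 0 T, W1 S (z t) ≤ 4) :
    ∀ t ∈ Set.Icc 0 T, Ys S (fun k => wt σ k ^ 2) (z t) ≤ Real.exp (CE σ * t) * Ys S (fun k => wt σ k ^ 2) (z 0) := by
  obtain ⟨R, hR, h⟩ := wt_wR (S := S)
  have : ∀ t, Ys S (fun k => wt σ k ^ 2) (z t) = Ys S (fun k => wR σ R k ^ 2) (z t) := by
    intro t; unfold Ys; refine Finset.sum_congr rfl fun k hk => ?_
    simp only [h σ k hk]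
  simp only [this]
  exact energy_est hS H hσ hR hW

def cZ : ℝ := ∑' k : ℤ, 1 / (k : ℝ) ^ 2

lemma cZ_le (S : Finset ℤ) : ∑ k ∈ S, 1 / (k : ℝ) ^ 2 ≤ cZ := by
  refine Summable.sum_le_tsum S (fun k _ => by positivity) ?_
  exact Real.summable_one_div_int_pow.mpr (by norm_num)

lemma cZ_nonneg : 0 ≤ cZ := tsum_nonneg fun k => by positivity

lemma wt_four (k : ℤ) : wt 4 k ^ 2 = (k : ℝ) ^ 8 := by
  unfold wt
  rw [show (4 : ℝ) = (4 : ℕ) by norm_num, Real.rpow_natCast, ← pow_mul]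
  exact Even.pow_abs (by decide) _

lemma interp {S : Finset ℤ} (hS : ∀ k ∈ S, Odd k) (z : ℤ → ℂ) {ε A B : ℝ} (hε : 0 < ε) (hX : Xh S z ≤ A * ε ^ 2)
    (hY : Ys S (fun k => wt 4 k ^ 2) z ≤ B) : Vh S z ≤ (cZ + A + B) * Real.sqrt ε := by
  set θ := Real.sqrt ε with hθ
  have hθ0 : 0 < θ := Real.sqrt_pos.mpr hε
  have hθ2 : θ ^ 2 = ε := Real.sq_sqrt hε.le
  have h1 : ∀ k ∈ S, vk k * ‖z k‖ ≤ θ * (1 / (k : ℝ) ^ 2) + θ⁻¹ * (ε⁻¹ * ((if isP k then 0 else 1) * ‖z k‖ ^ 2) + ε * (wt 4 k ^ 2 * ‖z k‖ ^ 2)) := by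
    intro k hk
    unfold vk
    rw [wt_four]
    split_ifs with h
    · rw [zero_mul]; positivity
    have h3 := notP_abs (hS k hk) h
    set x := |(k : ℝ)| with hx
    have hx2 : (k : ℝ) ^ 2 = x ^ 2 := by rw [hx, sq_abs]
    have hx8 : (k : ℝ) ^ 8 = x ^ 8 := by rw [show (8 : ℕ) = 2 * 4 by norm_num, pow_mul, pow_mul, hx2]
    rw [hx2, hx8]
    set y := ‖z k‖ with hy
    have hx0 : 0 < x := by linarith
    have a1 : x * y ≤ θ * (1 / x ^ 2) + θ⁻¹ * (x ^ 4 * y ^ 2) := by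
      have e : θ * (1 / x ^ 2) + θ⁻¹ * (x ^ 4 * y ^ 2) - x * y = (θ / x - x ^ 2 * y / 2) ^ 2 / θ + (3 / 4) * (x ^ 4 * y ^ 2) / θ := by
        field_simp; ring
      have : 0 ≤ (θ / x - x ^ 2 * y / 2) ^ 2 / θ + (3 / 4) * (x ^ 4 * y ^ 2) / θ := by positivity
      linarith
    have a2 : x ^ 4 * y ^ 2 ≤ ε⁻¹ * (1 * y ^ 2) + ε * (x ^ 8 * y ^ 2) := by
      have e : ε⁻¹ * (1 * y ^ 2) + ε * (x ^ 8 * y ^ 2) - x ^ 4 * y ^ 2 = y ^ 2 * ((1 - ε * x ^ 4 / 2) ^ 2 / ε + (3 / 4) * ε * x ^ 8) := by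
        field_simp; ring
      have : 0 ≤ y ^ 2 * ((1 - ε * x ^ 4 / 2) ^ 2 / ε + (3 / 4) * ε * x ^ 8) := by positivity
      linarith
    have a3 := mul_le_mul_of_nonneg_left a2 (inv_nonneg.mpr hθ0.le)
    linarith
  have h2 := Finset.sum_le_sum h1
  rw [Finset.sum_add_distrib, ← Finset.mul_sum, ← Finset.mul_sum, Finset.sum_add_distrib, ← Finset.mul_sum, ← Finset.mul_sum] at h2
  change Vh S z ≤ _ + θ⁻¹ * (ε⁻¹ * Xh S z + ε * Ys S (fun k => wt 4 k ^ 2) z) at h2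
  have h3 : θ⁻¹ * (ε⁻¹ * Xh S z + ε * Ys S (fun k => wt 4 k ^ 2) z) ≤ θ⁻¹ * (ε⁻¹ * (A * ε ^ 2) + ε * B) := by gcongr
  have h4 : θ⁻¹ * (ε⁻¹ * (A * ε ^ 2) + ε * B) = (A + B) * θ := by
    rw [← hθ2]; field_simp
  have h5 := mul_le_mul_of_nonneg_left (cZ_le S) hθ0.le
  nlinarith

lemma boot {f : ℝ → ℝ} {T : ℝ} (hc : ContinuousOn f (Set.Icc 0 T)) (h0 : f 0 < 4)
    (hb : ∀ t ∈ Set.Icc 0 T, (∀ s ∈ Set.Icc 0 t, f s ≤ 4) → f t < 4) : ∀ t ∈ Set.Icc 0 T, f t ≤ 4 := by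
  intro t1 ht1
  by_contra hcon
  push Not at hcon
  set A := {t ∈ Set.Icc 0 t1 | f t = 4} with hA
  have hc1 : ContinuousOn f (Set.Icc 0 t1) := hc.mono (Set.Icc_subset_Icc le_rfl ht1.2)
  have hAc : IsClosed A := by
    have := hc1.preimage_isClosed_of_isClosed isClosed_Icc (isClosed_singleton (x := (4 : ℝ)))
    have e : A = Set.Icc 0 t1 ∩ f ⁻¹' {4} := by ext x; simp [hA]
    rw [e]; exact this
  have hne : A.Nonempty := by
    have := intermediate_value_Icc ht1.1 hc1
    obtain ⟨c, hc, hc'⟩ := this ⟨h0.le, hcon.le⟩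
    exact ⟨c, hc, hc'⟩
  have hbb : BddBelow A := ⟨0, fun x hx => hx.1.1⟩
  have hmem := hAc.csInf_mem hne hbb
  set τ := sInf A with hτ
  have : f τ < 4 := by
    refine hb τ ⟨hmem.1.1, hmem.1.2.trans ht1.2⟩ ?_
    intro s hs
    by_contra hs4
    push Not at hs4
    have := intermediate_value_Icc hs.1 (hc1.mono (Set.Icc_subset_Icc le_rfl (hs.2.trans hmem.1.2)))
    obtain ⟨c, hcc, hc'⟩ := this ⟨h0.le, hs4.le⟩
    have hcA : c ∈ A := ⟨⟨hcc.1, hcc.2.trans (hs.2.trans hmem.1.2)⟩, hc'⟩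
    have h1 := csInf_le hbb hcA
    have : c = s := le_antisymm hcc.2 (hs.2.trans h1)
    rw [this] at hc'; linarith
  linarith [hmem.2]

lemma Nl_P_bound {S : Finset ℤ} (hS : ∀ k ∈ S, Odd k) (h1 : (1 : ℤ) ∈ S) (hm : (-1 : ℤ) ∈ S) (z : ℤ → ℂ) (k : ℤ) :
    ‖Nl S z k - Nl {1, -1} z k‖ ≤ 3 * Vh S z * W1 S z ^ 2 := by
  have e1 : Nl ({1, -1} : Finset ℤ) z k = ∑ k1 ∈ S, ∑ k2 ∈ S, ∑ k3 ∈ S, if isP k1 ∧ isP k2 ∧ isP k3 then 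
     (if k1 + k3 = k2 + k then (k3 : ℂ) * z k1 * conj (z k2) * z k3 else 0) else 0 := by
    unfold Nl
    rw [sum_isP' h1 hm]
    refine Finset.sum_congr rfl fun k1 _ => ?_
    by_cases p1 : isP k1
    · rw [if_pos p1, sum_isP' h1 hm]
      refine Finset.sum_congr rfl fun k2 _ => ?_
      by_cases p2 : isP k2
      · rw [if_pos p2, sum_isP' h1 hm]
        refine Finset.sum_congr rfl fun k3 _ => ?_
        simp only [p1, p2, true_and]
      · rw [if_neg p2, Finset.sum_eq_zero]; intro k3 _; simp [p2]
    · rw [if_neg p1, Finset.sum_eq_zero]; intro k2 _; rw [Finset.sum_eq_zero]; intro k3 _; simp [p1]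
  rw [e1]
  unfold Nl
  rw [← Finset.sum_sub_distrib]
  have e2 : 3 * Vh S z * W1 S z ^ 2 = ∑ k1 ∈ S, ∑ k2 ∈ S, ∑ k3 ∈ S, 
     ((vk k1 * ‖z k1‖) * (|(k2 : ℝ)| * ‖z k2‖) * (|(k3 : ℝ)| * ‖z k3‖) + (|(k1 : ℝ)| * ‖z k1‖) * (vk k2 * ‖z k2‖) * (|(k3 : ℝ)| * ‖z k3‖)
      + (|(k1 : ℝ)| * ‖z k1‖) * (|(k2 : ℝ)| * ‖z k2‖) * (vk k3 * ‖z k3‖)) := by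
    have : ∀ a b c : ℤ → ℝ, ∑ k1 ∈ S, ∑ k2 ∈ S, ∑ k3 ∈ S, a k1 * b k2 * c k3 = (∑ k ∈ S, a k) * (∑ k ∈ S, b k) * (∑ k ∈ S, c k) := by
      intro a b c
      have e : ∀ k1 ∈ S, ∑ k2 ∈ S, ∑ k3 ∈ S, a k1 * b k2 * c k3 = a k1 * ((∑ k ∈ S, b k) * (∑ k ∈ S, c k)) := by
        intro k1 _
        simp_rw [← Finset.mul_sum]
        rw [← Finset.sum_mul, ← Finset.mul_sum]; ring
      rw [Finset.sum_congr rfl e, ← Finset.sum_mul]; ring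
    simp only [Finset.sum_add_distrib]
    rw [this (fun k => vk k * ‖z k‖) (fun k => |(k : ℝ)| * ‖z k‖) (fun k => |(k : ℝ)| * ‖z k‖),
      this (fun k => |(k : ℝ)| * ‖z k‖) (fun k => vk k * ‖z k‖) (fun k => |(k : ℝ)| * ‖z k‖),
      this (fun k => |(k : ℝ)| * ‖z k‖) (fun k => |(k : ℝ)| * ‖z k‖) (fun k => vk k * ‖z k‖)]
    unfold Vh W1; ring
  rw [e2]
  refine (norm_sum_le _ _).trans (Finset.sum_le_sum fun k1 h1 => ?_)
  rw [← Finset.sum_sub_distrib]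
  refine (norm_sum_le _ _).trans (Finset.sum_le_sum fun k2 h2 => ?_)
  rw [← Finset.sum_sub_distrib]
  refine (norm_sum_le _ _).trans (Finset.sum_le_sum fun k3 h3 => ?_)
  have a1 := norm_le_abs_mul (hS k1 h1) (norm_nonneg (z k1))
  have a2 := norm_le_abs_mul (hS k2 h2) (norm_nonneg (z k2))
  have v1 := vk_nonneg k1
  have v2 := vk_nonneg k2
  have v3 := vk_nonneg k3
  have hz : ‖(0 : ℂ)‖ ≤ vk k1 * ‖z k1‖ * (|(k2 : ℝ)| * ‖z k2‖) * (|(k3 : ℝ)| * ‖z k3‖) + |(k1 : ℝ)| * ‖z k1‖ * (vk k2 * ‖z k2‖) * (|(k3 : ℝ)| * ‖z k3‖) +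
      |(k1 : ℝ)| * ‖z k1‖ * (|(k2 : ℝ)| * ‖z k2‖) * (vk k3 * ‖z k3‖) := by
    rw [norm_zero]; positivity
  by_cases hP : isP k1 ∧ isP k2 ∧ isP k3
  · rw [if_pos hP, sub_self]; exact hz
  rw [if_neg hP]
  by_cases heq : k1 + k3 = k2 + k
  swap
  · rw [if_neg heq, sub_self]; exact hz
  · rw [if_pos heq, sub_zero]
    have e : ‖(k3 : ℂ) * z k1 * conj (z k2) * z k3‖ = ‖z k1‖ * ‖z k2‖ * (|(k3 : ℝ)| * ‖z k3‖) := by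
      simp; ring
    rw [e]
    have e' : ‖z k1‖ * ‖z k2‖ * (|(k3 : ℝ)| * ‖z k3‖) ≤ (|(k1 : ℝ)| * ‖z k1‖) * (|(k2 : ℝ)| * ‖z k2‖) * (|(k3 : ℝ)| * ‖z k3‖) := by gcongr
    refine e'.trans ?_
    have q1 : 0 ≤ (vk k1 * ‖z k1‖) * (|(k2 : ℝ)| * ‖z k2‖) * (|(k3 : ℝ)| * ‖z k3‖) := by positivity
    have q2 : 0 ≤ (|(k1 : ℝ)| * ‖z k1‖) * (vk k2 * ‖z k2‖) * (|(k3 : ℝ)| * ‖z k3‖) := by positivity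
    have q3 : 0 ≤ (|(k1 : ℝ)| * ‖z k1‖) * (|(k2 : ℝ)| * ‖z k2‖) * (vk k3 * ‖z k3‖) := by positivity
    by_cases p1 : isP k1
    · by_cases p2 : isP k2
      · have p3 : ¬ isP k3 := fun h => hP ⟨p1, p2, h⟩
        have : vk k3 = |(k3 : ℝ)| := if_neg p3
        simp only [this] at q1 q2 q3 ⊢; linarith
      · have : vk k2 = |(k2 : ℝ)| := if_neg p2
        simp only [this] at q1 q2 q3 ⊢; linarith
    · have : vk k1 = |(k1 : ℝ)| := if_neg p1
      simp only [this] at q1 q2 q3 ⊢; linarith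

lemma Nl_P_one (z : ℤ → ℂ) : Nl {1, -1} z 1 = (‖z 1‖ ^ 2 : ℝ) * z 1 := by
  have h : z 1 * conj (z 1) = (‖z 1‖ ^ 2 : ℝ) := by rw [Complex.mul_conj, Complex.normSq_eq_norm_sq]
  unfold Nl
  simp only [Finset.sum_pair (show (1 : ℤ) ≠ -1 by norm_num)]
  norm_num
  have h' : z 1 * conj (z 1) = (‖z 1‖ : ℂ) ^ 2 := by rw [h]; push_cast; rfl
  rw [← h']; ring

lemma Nl_P_neg (z : ℤ → ℂ) : Nl {1, -1} z (-1) = -((‖z (-1)‖ ^ 2 : ℝ) * z (-1)) := by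
  have h : z (-1) * conj (z (-1)) = (‖z (-1)‖ ^ 2 : ℝ) := by rw [Complex.mul_conj, Complex.normSq_eq_norm_sq]
  unfold Nl
  simp only [Finset.sum_pair (show (1 : ℤ) ≠ -1 by norm_num)]
  norm_num
  have h' : z (-1) * conj (z (-1)) = (‖z (-1)‖ : ℂ) ^ 2 := by rw [h]; push_cast; rfl
  rw [← h']; ring
end

/-! Part J -/

noncomputable section
open ComplexConjugate

def lamE (α ε : ℝ) (k : ℤ) : ℝ := (ε ^ 2)⁻¹ * (1 - |(k : ℝ)| ^ α) - k

/-- initial data hypothesis -/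
structure Dat (S : Finset ℤ) (ε : ℝ) (y : ℤ → ℂ) : Prop where
  one : y 1 = 1
  neg : y (-1) = 1
  hi : Ys S (fun k => if isP k then 0 else wt 4 k ^ 2) y ≤ ε ^ 2

lemma Ys_mono {S : Finset ℤ} {a b : ℤ → ℝ} (h : ∀ k ∈ S, a k ≤ b k) (z : ℤ → ℂ) : Ys S a z ≤ Ys S b z :=
  Finset.sum_le_sum fun k hk => mul_le_mul_of_nonneg_right (h k hk) (by positivity)

lemma Ys_smul {S : Finset ℤ} (c : ℝ) (a : ℤ → ℝ) (z : ℤ → ℂ) : Ys S (fun k => c * a k) z = c * Ys S a z := by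
  unfold Ys; rw [Finset.mul_sum]; refine Finset.sum_congr rfl fun k _ => by ring

lemma Ys_sub {S : Finset ℤ} (a b : ℤ → ℝ) (z : ℤ → ℂ) : Ys S (fun k => a k - b k) z = Ys S a z - Ys S b z := by
  unfold Ys; rw [← Finset.sum_sub_distrib]; refine Finset.sum_congr rfl fun k _ => by ring

lemma wt4_ge {k : ℤ} (hk : Odd k) : |(k : ℝ)| ≤ wt 4 k ^ 2 ∧ 1 ≤ wt 4 k ^ 2 := by
  have h := odd_abs_ge hk
  rw [wt_four]
  have : (k : ℝ) ^ 8 = |(k : ℝ)| ^ 8 := (Even.pow_abs (by decide) _).symm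
  rw [this]
  exact ⟨le_self_pow₀ h (by norm_num), one_le_pow₀ h⟩

lemma Dat.X0 {S : Finset ℤ} (hS : ∀ k ∈ S, Odd k) {ε : ℝ} {y : ℤ → ℂ} (D : Dat S ε y) : Xh S y ≤ ε ^ 2 := by
  refine (Ys_mono (fun k hk => ?_) y).trans D.hi
  split_ifs
  · exact le_rfl
  · exact (wt4_ge (hS k hk)).2

lemma Dat.Y0 {S : Finset ℤ} (h1 : (1 : ℤ) ∈ S) (hm : (-1 : ℤ) ∈ S) {ε : ℝ} {y : ℤ → ℂ} (D : Dat S ε y) :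
    Ys S (fun k => wt 4 k ^ 2) y ≤ 2 + ε ^ 2 := by
  rw [Ys_eq h1 hm, D.one, D.neg]
  have := D.hi
  simp only [wt_four, norm_one] at *
  push_cast
  linarith

def gam (α : ℝ) : ℝ := 3 ^ α - 1

lemma gam_pos {α : ℝ} (hα : 0 < α) : 0 < gam α := by
  have : 1 < (3 : ℝ) ^ α := Real.one_lt_rpow (by norm_num) hα
  unfold gam; linarith

lemma gam_le {α : ℝ} (hα : α ≤ 1) : gam α ≤ 2 := by
  have : (3 : ℝ) ^ α ≤ 3 ^ (1 : ℝ) := Real.rpow_le_rpow_of_exponent_le (by norm_num) hα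
  rw [Real.rpow_one] at this
  unfold gam; linarith

/-- energy control of high modes -/
lemma energy_X {α ε : ℝ} (hα : 0 < α) (hα1 : α < 1) (hε : 0 < ε) {S : Finset ℤ} (hS : ∀ k ∈ S, Odd k) (h1 : (1 : ℤ) ∈ S) (hm : (-1 : ℤ) ∈ S)
    {T : ℝ} {z : ℝ → ℤ → ℂ} (H : GSol S (lamE α ε) (Set.Icc 0 T) z) (D : Dat S ε (z 0))
    (hW : ∀ t ∈ Set.Icc 0 T, W1 S (z t) ≤ 4) : ∀ t ∈ Set.Icc 0 T, Xh S (z t) ≤ (257 / gam α) * ε ^ 2 := by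
  intro t ht
  have h0 : (0 : ℝ) ∈ Set.Icc 0 T := ⟨le_rfl, ht.1.trans ht.2⟩
  have cE := congrArg Complex.re (const_of_deriv_zero (fun t ht => energy_deriv H ht) t ht)
  have cM := const_of_deriv_zero (fun t ht => mass_deriv H ht) t ht
  have cP := const_of_deriv_zero (fun t ht => mom_deriv H ht) t ht
  have hl : ∀ y, Ys S (lamE α ε) y = -((ε ^ 2)⁻¹ * Ys S (fun k => |(k : ℝ)| ^ α - 1) y) - Ys S (fun k => (k : ℝ)) y := by
    intro y
    rw [← Ys_smul]; unfold Ys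
    rw [← Finset.sum_neg_distrib, ← Finset.sum_sub_distrib]
    refine Finset.sum_congr rfl fun k _ => ?_
    unfold lamE; ring
  have hPb : ∀ t ∈ Set.Icc 0 T, |((1 / 4 : ℂ) * Pq S (z t)).re| ≤ 128 := by
    intro t ht
    refine (Complex.abs_re_le_norm _).trans ?_
    rw [norm_mul]
    have := Pq_bound hS (z t)
    have h4 : W1 S (z t) ^ 4 ≤ 4 ^ 4 := pow_le_pow_left₀ (W1_nonneg _ _) (hW t ht) 4
    have e : ‖(1 / 4 : ℂ)‖ = 1 / 4 := by norm_num
    rw [e]; linarith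
  have b1 := abs_le.mp (hPb t ht)
  have b0 := abs_le.mp (hPb 0 h0)
  simp only [Complex.add_re, Complex.ofReal_re] at cE
  rw [hl, hl, cP] at cE
  have hD0 : Ys S (fun k => |(k : ℝ)| ^ α - 1) (z 0) ≤ ε ^ 2 := by
    refine (Ys_mono (fun k hk => ?_) (z 0)).trans D.hi
    split_ifs with h
    · rw [isP_abs h]; simp
    · have o := odd_abs_ge (hS k hk)
      have : |(k : ℝ)| ^ α ≤ |(k : ℝ)| ^ (1 : ℝ) := Real.rpow_le_rpow_of_exponent_le o hα1.le
      rw [Real.rpow_one] at this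
      linarith [(wt4_ge (hS k hk)).1]
  have hDt : gam α * Xh S (z t) ≤ Ys S (fun k => |(k : ℝ)| ^ α - 1) (z t) := by
    unfold Xh
    rw [← Ys_smul]
    refine Ys_mono (fun k hk => ?_) _
    split_ifs with h
    · rw [isP_abs h]; simp
    · have o := notP_abs (hS k hk) h
      have : (3 : ℝ) ^ α ≤ |(k : ℝ)| ^ α := Real.rpow_le_rpow (by norm_num) o hα.le
      unfold gam; linarith
  have hε2 : 0 < ε ^ 2 := by positivity
  have key : (ε ^ 2)⁻¹ * Ys S (fun k => |(k : ℝ)| ^ α - 1) (z t) ≤ 257 := by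
    have : (ε ^ 2)⁻¹ * Ys S (fun k => |(k : ℝ)| ^ α - 1) (z 0) ≤ 1 := by
      rw [inv_mul_le_iff₀ hε2]; linarith
    linarith
  rw [inv_mul_le_iff₀ hε2] at key
  have g := gam_pos hα
  rw [div_mul_eq_mul_div, le_div_iff₀ g]
  linarith

lemma W1_le {S : Finset ℤ} (h1 : (1 : ℤ) ∈ S) (hm : (-1 : ℤ) ∈ S) (z : ℤ → ℂ) {M : ℝ} (hM : Ys S (fun _ => 1) z ≤ M) :
    W1 S z ≤ 1 + M / 2 + Vh S z := by
  rw [W1_eq h1 hm]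
  rw [Ys_eq h1 hm] at hM
  have hX := Xh_nonneg S z
  unfold Xh at hX
  nlinarith [sq_nonneg (‖z 1‖ - 1), sq_nonneg (‖z (-1)‖ - 1)]

lemma GSol.cont {S : Finset ℤ} {lam : ℤ → ℝ} {J : Set ℝ} {z : ℝ → ℤ → ℂ} (H : GSol S lam J z) (k : ℤ) : ContinuousOn (fun τ => z τ k) J :=
  fun t ht => (H.der' ht k).continuousAt.continuousWithinAt

lemma GSol.mono {S : Finset ℤ} {lam : ℤ → ℝ} {J J' : Set ℝ} {z : ℝ → ℤ → ℂ} (H : GSol S lam J z) (h : J' ⊆ J) : GSol S lam J' z :=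
  ⟨H.supp, fun t ht => H.der t (h ht)⟩

def Bap (T : ℝ) : ℝ := 3 * Real.exp (CE 4 * T)
def Cap (α T : ℝ) : ℝ := cZ + 257 / gam α + Bap T

lemma CE_nonneg {σ : ℝ} : 0 ≤ CE σ := by unfold CE; positivity

lemma Bap_ge {T : ℝ} (hT : 0 ≤ T) : 3 ≤ Bap T := by
  have : 1 ≤ Real.exp (CE 4 * T) := Real.one_le_exp (mul_nonneg CE_nonneg hT)
  unfold Bap; linarith

lemma Y4_bound {S : Finset ℤ} (hS : ∀ k ∈ S, Odd k) (h1 : (1 : ℤ) ∈ S) (hm : (-1 : ℤ) ∈ S) {ε : ℝ} (hε : 0 < ε) (hε1 : ε ≤ 1) {lam : ℤ → ℝ} {T T' : ℝ} 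
    {z : ℝ → ℤ → ℂ} (H : GSol S lam (Set.Icc 0 T) z) (D : Dat S ε (z 0)) (hT : T ≤ T')
    (hW : ∀ t ∈ Set.Icc 0 T, W1 S (z t) ≤ 4) : ∀ t ∈ Set.Icc 0 T, Ys S (fun k => wt 4 k ^ 2) (z t) ≤ Bap T' := by
  intro t ht
  refine (energy_est_wt hS H (by norm_num) hW t ht).trans ?_
  have := D.Y0 h1 hm
  have : Ys S (fun k => wt 4 k ^ 2) (z 0) ≤ 3 := by nlinarith
  have e : Real.exp (CE 4 * t) ≤ Real.exp (CE 4 * T') := Real.exp_le_exp.mpr (mul_le_mul_of_nonneg_left (ht.2.trans hT) CE_nonneg)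
  have hY : 0 ≤ Ys S (fun k => wt 4 k ^ 2) (z 0) := Finset.sum_nonneg fun k _ => by positivity
  unfold Bap
  nlinarith [Real.exp_pos (CE 4 * T')]

lemma apriori1 {α T ε : ℝ} (hα : 0 < α) (hα1 : α < 1) (hT : 0 ≤ T) (hε : 0 < ε) (hε1 : ε ≤ 1) (hC : Cap α T * Real.sqrt ε ≤ 1)
    {S : Finset ℤ} (hS : ∀ k ∈ S, Odd k) (h1 : (1 : ℤ) ∈ S) (hm : (-1 : ℤ) ∈ S)
    {z : ℝ → ℤ → ℂ} (H : GSol S (lamE α ε) (Set.Icc 0 T) z) (D : Dat S ε (z 0)) :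
    ∀ t ∈ Set.Icc 0 T, W1 S (z t) ≤ 4 := by
  have hM0 : Ys S (fun _ => 1) (z 0) ≤ 2 + ε ^ 2 := by
    refine (Ys_mono (fun k hk => ?_) (z 0)).trans (D.Y0 h1 hm)
    exact (wt4_ge (hS k hk)).2
  refine boot ?_ ?_ ?_
  · unfold W1
    refine continuousOn_finset_sum _ fun k _ => ?_
    exact continuousOn_const.mul (H.cont k).norm
  · have hX : Xh S (z 0) ≤ (257 / gam α) * ε ^ 2 := by
      refine (D.X0 hS).trans (le_mul_of_one_le_left (by positivity) ?_)
      rw [le_div_iff₀ (gam_pos hα)]; linarith [gam_le hα1.le]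
    have hY : Ys S (fun k => wt 4 k ^ 2) (z 0) ≤ Bap T := by
      have := D.Y0 h1 hm
      have := Bap_ge hT
      nlinarith
    have hv := interp hS (z 0) hε hX hY
    have := W1_le h1 hm (z 0) hM0
    change Vh S (z 0) ≤ Cap α T * Real.sqrt ε at hv
    nlinarith
  · intro t ht hb
    have Ht := H.mono (Set.Icc_subset_Icc (le_refl 0) ht.2)
    have tt : t ∈ Set.Icc 0 t := ⟨ht.1, le_rfl⟩
    have hX := energy_X hα hα1 hε hS h1 hm Ht D hb t tt
    have hY := Y4_bound hS h1 hm hε hε1 Ht D ht.2 hb t tt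
    have hv := interp hS (z t) hε hX hY
    have hM := (const_of_deriv_zero (fun t ht => mass_deriv H ht) t ht).le.trans hM0
    have := W1_le h1 hm (z t) hM
    change Vh S (z t) ≤ Cap α T * Real.sqrt ε at hv
    nlinarith

lemma apriori2 {α T ε : ℝ} (hα : 0 < α) (hα1 : α < 1) (hT : 0 ≤ T) (hε : 0 < ε) (hε1 : ε ≤ 1) (hC : Cap α T * Real.sqrt ε ≤ 1)
    {S : Finset ℤ} (hS : ∀ k ∈ S, Odd k) (h1 : (1 : ℤ) ∈ S) (hm : (-1 : ℤ) ∈ S)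
    {z : ℝ → ℤ → ℂ} (H : GSol S (lamE α ε) (Set.Icc 0 T) z) (D : Dat S ε (z 0)) :
    ∀ t ∈ Set.Icc 0 T, Xh S (z t) ≤ (257 / gam α) * ε ^ 2 ∧ Ys S (fun k => wt 4 k ^ 2) (z t) ≤ Bap T ∧ 
      Vh S (z t) ≤ Cap α T * Real.sqrt ε := by
  have hW := apriori1 hα hα1 hT hε hε1 hC hS h1 hm H D
  intro t ht
  have hX := energy_X hα hα1 hε hS h1 hm H D hW t ht
  have hY := Y4_bound hS h1 hm hε hε1 H D le_rfl hW t ht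
  exact ⟨hX, hY, interp hS (z t) hε hX hY⟩

lemma Phi_bound {S : Finset ℤ} (hS : ∀ k ∈ S, Odd k) (z : ℤ → ℂ) (hW : W1 S z ≤ 4) : 
    |Ys S (fun k => if isP k then 0 else (k : ℝ)) z| ≤ 4 * Vh S z := by
  unfold Ys Vh
  rw [Finset.mul_sum]
  refine (Finset.abs_sum_le_sum_abs _ _).trans (Finset.sum_le_sum fun k hk => ?_)
  have h4 := (norm_le_W1 hS z hk).trans hW
  unfold vk
  dsimp only
  split_ifs
  · simp
  · rw [abs_mul, abs_of_nonneg (by positivity : 0 ≤ ‖z k‖ ^ 2)]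
    have := mul_nonneg (abs_nonneg (k : ℝ)) (norm_nonneg (z k))
    nlinarith

lemma apriori3 {α T ε : ℝ} (hα : 0 < α) (hα1 : α < 1) (hT : 0 ≤ T) (hε : 0 < ε) (hε1 : ε ≤ 1) (hC : Cap α T * Real.sqrt ε ≤ 1)
    {S : Finset ℤ} (hS : ∀ k ∈ S, Odd k) (h1 : (1 : ℤ) ∈ S) (hm : (-1 : ℤ) ∈ S)
    {z : ℝ → ℤ → ℂ} (H : GSol S (lamE α ε) (Set.Icc 0 T) z) (D : Dat S ε (z 0)) :
    ∀ t ∈ Set.Icc 0 T, ‖z t 1 - 1‖ ≤ (100 * Cap α T * T) * Real.sqrt ε ∧ ‖z t (-1) - 1‖ ≤ (100 * Cap α T * T) * Real.sqrt ε := by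
  have hW := apriori1 hα hα1 hT hε hε1 hC hS h1 hm H D
  have hA := apriori2 hα hα1 hT hε hε1 hC hS h1 hm H D
  have h0 : (0 : ℝ) ∈ Set.Icc 0 T := ⟨le_rfl, hT⟩
  have hse : ε ≤ Real.sqrt ε := by
    rw [Real.le_sqrt hε.le hε.le]; nlinarith
  have hs0 := Real.sqrt_nonneg ε
  have hCA : 257 / gam α ≤ Cap α T := by
    have := cZ_nonneg
    have := Bap_ge hT
    unfold Cap; linarith
  have hA0 : 0 < 257 / gam α := div_pos (by norm_num) (gam_pos hα)
  have hXs : ∀ t ∈ Set.Icc 0 T, Xh S (z t) ≤ Cap α T * Real.sqrt ε := by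
    intro t ht
    refine (hA t ht).1.trans ?_
    have : ε ^ 2 ≤ Real.sqrt ε := by nlinarith
    exact mul_le_mul hCA this (by positivity) (by linarith)
  have hmod : ∀ t ∈ Set.Icc 0 T, |‖z t 1‖ ^ 2 - 1| ≤ 5 * (Cap α T * Real.sqrt ε) ∧ |‖z t (-1)‖ ^ 2 - 1| ≤ 5 * (Cap α T * Real.sqrt ε) := by
    intro t ht
    have cM := const_of_deriv_zero (fun t ht => mass_deriv H ht) t ht
    have cP := const_of_deriv_zero (fun t ht => mom_deriv H ht) t ht
    rw [Ys_eq h1 hm, Ys_eq h1 hm _ (z 0), D.one, D.neg] at cM cP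
    change _ + Xh S (z t) = _ + Xh S (z 0) at cM
    have p1 := abs_le.mp (Phi_bound hS (z t) (hW t ht))
    have p0 := abs_le.mp (Phi_bound hS (z 0) (hW 0 h0))
    have x1 := hXs t ht
    have x0 := hXs 0 h0
    have y1 := Xh_nonneg S (z t)
    have y0 := Xh_nonneg S (z 0)
    have v1 := (hA t ht).2.2
    have v0 := (hA 0 h0).2.2
    norm_num at cM cP
    constructor <;> rw [abs_le] <;> constructor <;> linarith
  have hder : ∀ σ : ℤ, (σ = 1 ∨ σ = -1) → ∀ t ∈ Set.Icc 0 T, ‖Complex.I * (lamE α ε σ * z t σ + Nl S (z t) σ)‖ ≤ 100 * (Cap α T * Real.sqrt ε) := by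
    intro σ hσ t ht
    rw [norm_mul, Complex.norm_I, one_mul]
    have hN := Nl_P_bound hS h1 hm (z t) σ
    have hv := (hA t ht).2.2
    have hv0 := Vh_nonneg S (z t)
    have hw := hW t ht
    have hw0 := W1_nonneg S (z t)
    have hN2 : 3 * Vh S (z t) * W1 S (z t) ^ 2 ≤ 48 * (Cap α T * Real.sqrt ε) := by
      have : W1 S (z t) ^ 2 ≤ 16 := by nlinarith
      nlinarith
    have hP : ‖lamE α ε σ * z t σ + Nl {1, -1} (z t) σ‖ ≤ 20 * (Cap α T * Real.sqrt ε) := by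
      rcases hσ with rfl | rfl
      · rw [Nl_P_one]
        have : (lamE α ε 1 : ℂ) * z t 1 + (‖z t 1‖ ^ 2 : ℝ) * z t 1 = ((‖z t 1‖ ^ 2 - 1 : ℝ) : ℂ) * z t 1 := by
          have e : lamE α ε 1 = -1 := by simp [lamE]
          rw [e]; push_cast; ring
        rw [this, norm_mul, Complex.norm_real, Real.norm_eq_abs]
        have a := (hmod t ht).1
        have b := (norm_le_W1 hS (z t) h1).trans hw
        have := mul_le_mul a b (norm_nonneg _) (le_trans (abs_nonneg _) a)
        linarith
      · rw [Nl_P_neg]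
        have : (lamE α ε (-1) : ℂ) * z t (-1) + -((‖z t (-1)‖ ^ 2 : ℝ) * z t (-1)) = -(((‖z t (-1)‖ ^ 2 - 1 : ℝ) : ℂ) * z t (-1)) := by
          have e : lamE α ε (-1) = 1 := by simp [lamE]
          rw [e]; push_cast; ring
        rw [this, norm_neg, norm_mul, Complex.norm_real, Real.norm_eq_abs]
        have a := (hmod t ht).2
        have b := (norm_le_W1 hS (z t) hm).trans hw
        have := mul_le_mul a b (norm_nonneg _) (le_trans (abs_nonneg _) a)
        linarith
    have e : lamE α ε σ * z t σ + Nl S (z t) σ = (lamE α ε σ * z t σ + Nl {1, -1} (z t) σ) + (Nl S (z t) σ - Nl {1, -1} (z t) σ) := by ring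
    rw [e]
    refine (norm_add_le _ _).trans ?_
    have : 0 ≤ Cap α T * Real.sqrt ε := le_trans hv0 hv
    linarith
  have fin : ∀ σ : ℤ, σ ∈ S → (σ = 1 ∨ σ = -1) → z 0 σ = 1 → ∀ t ∈ Set.Icc 0 T, ‖z t σ - 1‖ ≤ (100 * Cap α T * T) * Real.sqrt ε := by
    intro σ hσ hσ' hσ0 t ht
    have := norm_image_sub_le_of_norm_deriv_le_segment' (f := fun τ => z τ σ) (a := 0) (b := T) 
      (fun t ht => (H.der t ht σ hσ).hasDerivWithinAt) (fun t ht => hder σ hσ' t ⟨ht.1, ht.2.le⟩) t ht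
    rw [hσ0, sub_zero] at this
    refine this.trans ?_
    have h := mul_nonneg (hCA.trans' hA0.le) hs0
    have := mul_le_mul_of_nonneg_left ht.2 h
    nlinarith
  intro t ht
  exact ⟨fin 1 h1 (Or.inl rfl) D.one t ht, fin (-1) hm (Or.inr rfl) D.neg t ht⟩
end

/-! Part K -/

noncomputable section
open ComplexConjugate

def Gn (S : Finset ℤ) (g : ℤ → ℂ) : ℝ := ∑ k ∈ S, ‖g k‖ ^ 2
def Ac (S : Finset ℤ) (c : ℤ) (g : ℤ → ℂ) : ℂ := ∑ k ∈ S, g k * conj (g (k + c))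
def Bc (S : Finset ℤ) (c : ℤ) (g : ℤ → ℂ) : ℂ := ∑ k ∈ S, g k * g (c - k)

lemma Gn_nonneg (S : Finset ℤ) (g : ℤ → ℂ) : 0 ≤ Gn S g := Finset.sum_nonneg fun k _ => by positivity

lemma sum_inj_le {S : Finset ℤ} {f : ℤ → ℝ} (hf : ∀ k, 0 ≤ f k) (hg : ∀ k, k ∉ S → f k = 0) {φ : ℤ → ℤ} (hφ : Function.Injective φ) :
    ∑ k ∈ S, f (φ k) ≤ ∑ k ∈ S, f k := by
  rw [← Finset.sum_image (f := f) (g := φ) (s := S) (fun x _ y _ h => hφ h)]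
  have h1 : ∑ k ∈ S.image φ, f k = ∑ k ∈ (S.image φ).filter (· ∈ S), f k := by
    rw [Finset.sum_filter]
    refine Finset.sum_congr rfl fun k _ => ?_
    split_ifs with h
    · rfl
    · exact hg k h
  rw [h1]
  refine Finset.sum_le_sum_of_subset_of_nonneg ?_ (fun k _ _ => hf k)
  intro k hk
  exact (Finset.mem_filter.mp hk).2

lemma Gn_inj {S : Finset ℤ} {g : ℤ → ℂ} (hg : ∀ k, k ∉ S → g k = 0) {φ : ℤ → ℤ} (hφ : Function.Injective φ) :
    ∑ k ∈ S, ‖g (φ k)‖ ^ 2 ≤ Gn S g := 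
  sum_inj_le (f := fun k => ‖g k‖ ^ 2) (fun k => by positivity) (fun k hk => by simp [hg k hk]) hφ

lemma corr_le {S : Finset ℤ} {g : ℤ → ℂ} (hg : ∀ k, k ∉ S → g k = 0) {φ : ℤ → ℤ} (hφ : Function.Injective φ) :
    ∑ k ∈ S, ‖g k‖ * ‖g (φ k)‖ ≤ Gn S g := by
  have h1 : ∑ k ∈ S, ‖g k‖ * ‖g (φ k)‖ ≤ ∑ k ∈ S, (1 / 2) * (‖g k‖ ^ 2 + ‖g (φ k)‖ ^ 2) := by
    refine Finset.sum_le_sum fun k _ => ?_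
    nlinarith [sq_nonneg (‖g k‖ - ‖g (φ k)‖)]
  rw [← Finset.mul_sum, Finset.sum_add_distrib] at h1
  have := Gn_inj hg hφ
  unfold Gn at *
  linarith

lemma Ac_le {S : Finset ℤ} {g : ℤ → ℂ} (hg : ∀ k, k ∉ S → g k = 0) (c : ℤ) : ‖Ac S c g‖ ≤ Gn S g := by
  refine (norm_sum_le _ _).trans ?_
  simp only [norm_mul, RCLike.norm_conj]
  exact corr_le hg (add_left_injective c)

lemma Bc_le {S : Finset ℤ} {g : ℤ → ℂ} (hg : ∀ k, k ∉ S → g k = 0) (c : ℤ) : ‖Bc S c g‖ ≤ Gn S g := by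
  refine (norm_sum_le _ _).trans ?_
  simp only [norm_mul]
  exact corr_le hg sub_right_injective

lemma Ac_zero (S : Finset ℤ) (g : ℤ → ℂ) : Ac S 0 g = (Gn S g : ℂ) := by
  unfold Ac Gn
  rw [Complex.ofReal_sum]
  refine Finset.sum_congr rfl fun k _ => ?_
  rw [add_zero, Complex.mul_conj, Complex.normSq_eq_norm_sq]

section tsums
variable {S : Finset ℤ} {g : ℤ → ℂ} (hg : ∀ k, k ∉ S → g k = 0)

lemma fs_summable (hg : ∀ k, k ∉ S → g k = 0) (e : ℤ ≃ ℤ) (f : ℤ → ℂ) : Summable (fun k => g (e k) * f k) := by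
  have h1 : (Function.support g).Finite := by
    refine S.finite_toSet.subset fun k hk => ?_
    by_contra h
    exact hk (hg k h)
  refine summable_of_finite_support ((h1.preimage e.injective.injOn).subset ?_)
  intro k hk
  simp only [Function.mem_support, ne_eq, mul_eq_zero, not_or] at hk
  exact hk.1

lemma Ac_tsum (hg : ∀ k, k ∉ S → g k = 0) (a b : ℤ) : ∑' k : ℤ, g (k + a) * conj (g (k + b)) = Ac S (b - a) g := by
  have : ∑' k : ℤ, g (k + a) * conj (g (k + b)) = ∑' k : ℤ, g k * conj (g (k + (b - a))) := by
    rw [← (Equiv.addRight a).tsum_eq (fun k => g k * conj (g (k + (b - a))))]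
    refine tsum_congr fun k => ?_
    simp only [Equiv.coe_addRight]
    congr 3; ring
  rw [this]
  exact tsum_eq_sum (fun k hk => by rw [hg k hk, zero_mul])

lemma Bc_tsum (hg : ∀ k, k ∉ S → g k = 0) (a b : ℤ) : ∑' k : ℤ, g (k + a) * g (b - k) = Bc S (a + b) g := by
  have : ∑' k : ℤ, g (k + a) * g (b - k) = ∑' k : ℤ, g k * g (a + b - k) := by
    rw [← (Equiv.addRight a).tsum_eq (fun k => g k * g (a + b - k))]
    refine tsum_congr fun k => ?_
    simp only [Equiv.coe_addRight]
    congr 2; ring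
  rw [this]
  exact tsum_eq_sum (fun k hk => by rw [hg k hk, zero_mul])

lemma main_form (hg : ∀ k, k ∉ S → g k = 0) {s : ℝ} (hs : 1 ≤ s) :
    2 * Gn S g ≤ (4 * s + 2) * Gn S g - (4 * s - 2) * (Ac S 4 g).re + 2 * (Ac S 2 g).re - (Bc S 4 g - 2 * Bc S 0 g + Bc S (-4) g).re := by
  set h : ℤ → ℂ := fun k => g (k + 2) - g (k - 2) with hh
  have ea : ∀ (a : ℤ) (f : ℤ → ℂ), Summable (fun k => g (k + a) * f k) := fun a f => fs_summable hg (Equiv.addRight a) f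
  have e1 : ∑' k, h k * conj (h k) = 2 * (Gn S g : ℂ) - Ac S 4 g - Ac S (-4) g := by
    have : ∀ k, h k * conj (h k) = g (k + 2) * conj (g (k + 2)) - g (k + 2) * conj (g (k + -2)) - (g (k + -2) * conj (g (k + 2)) - g (k + -2) * conj (g (k + -2))) := by
      intro k; simp only [hh]; rw [show k - 2 = k + -2 by ring, map_sub]; ring
    rw [tsum_congr this, Summable.tsum_sub, Summable.tsum_sub, Summable.tsum_sub, Ac_tsum hg, Ac_tsum hg, Ac_tsum hg, Ac_tsum hg]
    · norm_num
      rw [Ac_zero]; ring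
    · exact ea (-2) _
    · exact ea (-2) _
    · exact ea 2 _
    · exact ea 2 _
    · exact (ea 2 _).sub (ea 2 _)
    · exact (ea (-2) _).sub (ea (-2) _)
  have e2 : ∑' k, h k * h (-k) = Bc S 4 g - 2 * Bc S 0 g + Bc S (-4) g := by
    have : ∀ k, h k * h (-k) = g (k + 2) * g (2 - k) - g (k + 2) * g (-2 - k) - (g (k + -2) * g (2 - k) - g (k + -2) * g (-2 - k)) := by
      intro k; simp only [hh]
      rw [show -k + 2 = 2 - k by ring, show -k - 2 = -2 - k by ring, show k - 2 = k + -2 by ring]; ring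
    rw [tsum_congr this, Summable.tsum_sub, Summable.tsum_sub, Summable.tsum_sub, Bc_tsum hg, Bc_tsum hg, Bc_tsum hg, Bc_tsum hg]
    · norm_num
      ring
    · exact ea (-2) _
    · exact ea (-2) _
    · exact ea 2 _
    · exact ea 2 _
    · exact (ea 2 _).sub (ea 2 _)
    · exact (ea (-2) _).sub (ea (-2) _)
  have hsh : ∀ f : ℤ → ℂ, Summable (fun k => h k * f k) := by
    intro f
    have : (fun k => h k * f k) = fun k => g (k + 2) * f k - g (k + -2) * f k := by
      ext k; simp only [hh, sub_eq_add_neg]; ring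
    rw [this]; exact (ea 2 f).sub (ea (-2) f)
  have e3 : (∑' k, h k * conj (h k)) = ((∑' k, ‖h k‖ ^ 2 : ℝ) : ℂ) := by
    rw [Complex.ofReal_tsum]
    refine tsum_congr fun k => ?_
    rw [Complex.mul_conj, Complex.normSq_eq_norm_sq]
  have hs2 : Summable (fun k => ‖h k‖ ^ 2) := by
    have := (hsh (fun k => conj (h k))).norm
    refine this.congr fun k => ?_
    rw [norm_mul, RCLike.norm_conj, sq]
  have hs2' : Summable (fun k => ‖h (-k)‖ ^ 2) := (Equiv.neg ℤ).summable_iff.mpr hs2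
  have e4 : ‖∑' k, h k * h (-k)‖ ≤ ∑' k, ‖h k‖ ^ 2 := by
    refine (norm_tsum_le_tsum_norm (hsh fun k => h (-k)).norm).trans ?_
    have e5 : ∑' k, ‖h (-k)‖ ^ 2 = ∑' k, ‖h k‖ ^ 2 := (Equiv.neg ℤ).tsum_eq (fun k => ‖h k‖ ^ 2)
    have e6 : ∑' k, ‖h k * h (-k)‖ ≤ ∑' k, (1 / 2) * (‖h k‖ ^ 2 + ‖h (-k)‖ ^ 2) := by
      refine Summable.tsum_le_tsum (fun k => ?_) (hsh fun k => h (-k)).norm ((hs2.add hs2').mul_left _)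
      rw [norm_mul]
      nlinarith [sq_nonneg (‖h k‖ - ‖h (-k)‖)]
    rw [tsum_mul_left, hs2.tsum_add hs2', e5] at e6
    linarith
  have e7 : Ac S (-4) g = conj (Ac S 4 g) := by
    have h1 := Ac_tsum hg 4 0
    have h2 := Ac_tsum hg 0 4
    norm_num at h1 h2
    rw [← h1, ← h2, Complex.conj_tsum]
    refine tsum_congr fun k => ?_
    simp only [map_mul, Complex.conj_conj]; ring
  set Hn := ∑' k, ‖h k‖ ^ 2 with hHn
  have e8 : Hn = 2 * Gn S g - 2 * (Ac S 4 g).re := by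
    have := e3.symm.trans e1
    rw [e7] at this
    have := congrArg Complex.re this
    simp only [Complex.sub_re, Complex.mul_re, Complex.ofReal_re, Complex.ofReal_im, Complex.conj_re] at this
    norm_num at this
    linarith
  have hHn0 : 0 ≤ Hn := tsum_nonneg fun k => by positivity
  rw [e2] at e4
  have b1 := (abs_le.mp (Complex.abs_re_le_norm (Bc S 4 g - 2 * Bc S 0 g + Bc S (-4) g))).2
  have b2 := (abs_le.mp ((Complex.abs_re_le_norm (Ac S 2 g)).trans (Ac_le hg 2))).1
  nlinarith
end tsums

lemma sum_notP {M : Type*} [AddCommMonoid M] {S : Finset ℤ} (h1 : (1 : ℤ) ∈ S) (hm : (-1 : ℤ) ∈ S) {f : ℤ → M} (hf : ∀ k, ¬ isP k → f k = 0) :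
    ∑ k ∈ S, f k = f 1 + f (-1) := by
  rw [← sum_isP h1 hm]
  refine Finset.sum_congr rfl fun k _ => ?_
  split_ifs with h
  · rfl
  · exact hf k h

lemma inner_A {S : Finset ℤ} {g : ℤ → ℂ} (hg : ∀ k, k ∉ S → g k = 0) (k3 k4 : ℤ) :
    ∑ k1 ∈ S, ∑ k2 ∈ S, (if k1 + k3 + 2 = k2 + k4 then g k1 * conj (g k2) else 0) = Ac S (k3 - k4 + 2) g := by
  refine Finset.sum_congr rfl fun k1 _ => ?_
  have : ∀ k2 ∈ S, (if k1 + k3 + 2 = k2 + k4 then g k1 * conj (g k2) else 0) = if k2 = k1 + (k3 - k4 + 2) then g k1 * conj (g k2) else 0 := by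
    intro k2 _
    refine if_congr (by omega) rfl rfl
  rw [Finset.sum_congr rfl this, Finset.sum_ite_eq']
  split_ifs with h
  · rfl
  · rw [hg _ h]; simp

lemma inner_B {S : Finset ℤ} {g : ℤ → ℂ} (hg : ∀ k, k ∉ S → g k = 0) (c : ℤ) :
    ∑ k1 ∈ S, ∑ k2 ∈ S, (if k1 + k2 = c then g k1 * g k2 else 0) = Bc S c g := by
  refine Finset.sum_congr rfl fun k1 _ => ?_
  have : ∀ k2 ∈ S, (if k1 + k2 = c then g k1 * g k2 else 0) = if k2 = c - k1 then g k1 * g k2 else 0 := by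
    intro k2 _
    refine if_congr (by omega) rfl rfl
  rw [Finset.sum_congr rfl this, Finset.sum_ite_eq']
  split_ifs with h
  · rfl
  · rw [hg _ h]; simp

lemma MK_c {S : Finset ℤ} (h1 : (1 : ℤ) ∈ S) (hm : (-1 : ℤ) ∈ S) {g : ℤ → ℂ} (hg : ∀ k, k ∉ S → g k = 0) (s : ℝ) (z : ℤ → ℂ) :
    ∑ p ∈ QS S 2, (cK s p.2.2.1 p.2.2.2 : ℂ) * (z p.2.2.1 * conj (z p.2.2.2)) * (g p.1 * conj (g p.2.1)) = 
      -2 * (z 1 * conj (z 1)) * Ac S 2 g + (4 * s - 2) * (z 1 * conj (z (-1))) * Ac S 4 g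
      + (-(4 * s) - 2) * (z (-1) * conj (z 1)) * Ac S 0 g + -2 * (z (-1) * conj (z (-1))) * Ac S 2 g := by
  have e : ∑ p ∈ QS S 2, (cK s p.2.2.1 p.2.2.2 : ℂ) * (z p.2.2.1 * conj (z p.2.2.2)) * (g p.1 * conj (g p.2.1)) = 
     ∑ k3 ∈ S, ∑ k4 ∈ S, (cK s k3 k4 : ℂ) * (z k3 * conj (z k4)) * Ac S (k3 - k4 + 2) g := by
    rw [sum_QS]
    have : ∀ f : ℤ → ℤ → ℤ → ℤ → ℂ, ∑ a ∈ S, ∑ b ∈ S, ∑ c ∈ S, ∑ d ∈ S, f a b c d = ∑ c ∈ S, ∑ d ∈ S, ∑ a ∈ S, ∑ b ∈ S, f a b c d := by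
      intro f
      rw [← sum_rot (fun c d a b => f a b c d), ← sum_rot (fun b c d a => f a b c d)]
    rw [this]
    refine Finset.sum_congr rfl fun k3 _ => Finset.sum_congr rfl fun k4 _ => ?_
    rw [← inner_A hg, Finset.mul_sum]
    refine Finset.sum_congr rfl fun k1 _ => ?_
    rw [Finset.mul_sum]
    refine Finset.sum_congr rfl fun k2 _ => ?_
    simp only
    split_ifs <;> ring
  rw [e, sum_notP h1 hm, sum_notP h1 hm, sum_notP h1 hm]
  · rw [cK11, cK1m, cKm1, cKmm]; push_cast; norm_num; ring
  · intro k hk; rw [cK_notP _ _ _ (fun h => hk h.2)]; simp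
  · intro k hk; rw [cK_notP _ _ _ (fun h => hk h.2)]; simp
  · intro k hk; refine Finset.sum_eq_zero fun l _ => ?_; rw [cK_notP _ _ _ (fun h => hk h.1)]; simp

lemma MK_d13 {S : Finset ℤ} (h1 : (1 : ℤ) ∈ S) (hm : (-1 : ℤ) ∈ S) {g : ℤ → ℂ} (hg : ∀ k, k ∉ S → g k = 0) (z : ℤ → ℂ) :
    ∑ p ∈ QS S 2, (dK p.1 p.2.2.1 : ℂ) * (z p.1 * z p.2.2.1) * (conj (g p.2.1) * conj (g p.2.2.2)) = 
      4 * (z 1 * z 1) * conj (Bc S 4 g) - 4 * (z (-1) * z (-1)) * conj (Bc S 0 g) := by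
  have e : ∑ p ∈ QS S 2, (dK p.1 p.2.2.1 : ℂ) * (z p.1 * z p.2.2.1) * (conj (g p.2.1) * conj (g p.2.2.2)) = 
     ∑ k1 ∈ S, ∑ k3 ∈ S, (dK k1 k3 : ℂ) * (z k1 * z k3) * conj (Bc S (k1 + k3 + 2) g) := by
    rw [sum_QS]
    refine Finset.sum_congr rfl fun k1 _ => ?_
    rw [Finset.sum_comm]
    refine Finset.sum_congr rfl fun k3 _ => ?_
    rw [← inner_B hg, map_sum, Finset.mul_sum]
    refine Finset.sum_congr rfl fun k2 _ => ?_
    rw [map_sum, Finset.mul_sum]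
    refine Finset.sum_congr rfl fun k4 _ => ?_
    simp only
    by_cases h : k1 + k3 + 2 = k2 + k4
    · rw [if_pos h, if_pos h.symm]; simp only [map_mul]
    · rw [if_neg h, if_neg (fun h' => h h'.symm)]; simp
  rw [e, sum_notP h1 hm, sum_notP h1 hm, sum_notP h1 hm]
  · rw [dK11, dK1m, dKm1, dKmm]; push_cast; norm_num; ring
  · intro k hk; rw [dK_notP _ _ (fun h => hk h.2)]; simp
  · intro k hk; rw [dK_notP _ _ (fun h => hk h.2)]; simp
  · intro k hk; refine Finset.sum_eq_zero fun l _ => ?_; rw [dK_notP _ _ (fun h => hk h.1)]; simp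

lemma MK_d24 {S : Finset ℤ} (h1 : (1 : ℤ) ∈ S) (hm : (-1 : ℤ) ∈ S) {g : ℤ → ℂ} (hg : ∀ k, k ∉ S → g k = 0) (z : ℤ → ℂ) :
    ∑ p ∈ QS S 2, (dK p.2.1 p.2.2.2 : ℂ) * (conj (z p.2.1) * conj (z p.2.2.2)) * (g p.1 * g p.2.2.1) = 
      4 * (conj (z 1) * conj (z 1)) * (Bc S 0 g) - 4 * (conj (z (-1)) * conj (z (-1))) * (Bc S (-4) g) := by
  have e : ∑ p ∈ QS S 2, (dK p.2.1 p.2.2.2 : ℂ) * (conj (z p.2.1) * conj (z p.2.2.2)) * (g p.1 * g p.2.2.1) = 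
     ∑ k2 ∈ S, ∑ k4 ∈ S, (dK k2 k4 : ℂ) * (conj (z k2) * conj (z k4)) * (Bc S (k2 + k4 - 2) g) := by
    rw [sum_QS, Finset.sum_comm]
    refine Finset.sum_congr rfl fun k2 _ => ?_
    have : ∀ f : ℤ → ℤ → ℤ → ℂ, ∑ a ∈ S, ∑ b ∈ S, ∑ c ∈ S, f a b c = ∑ c ∈ S, ∑ a ∈ S, ∑ b ∈ S, f a b c := by
      intro f
      have h3 : ∀ a ∈ S, ∑ b ∈ S, ∑ c ∈ S, f a b c = ∑ c ∈ S, ∑ b ∈ S, f a b c := fun a _ => Finset.sum_comm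
      rw [Finset.sum_congr rfl h3, Finset.sum_comm]
    rw [this]
    refine Finset.sum_congr rfl fun k4 _ => ?_
    rw [← inner_B hg, Finset.mul_sum]
    refine Finset.sum_congr rfl fun k1 _ => ?_
    rw [Finset.mul_sum]
    refine Finset.sum_congr rfl fun k3 _ => ?_
    simp only
    by_cases h : k1 + k3 + 2 = k2 + k4
    · rw [if_pos h, if_pos (by omega)]
    · rw [if_neg h, if_neg (by omega)]; simp
  rw [e, sum_notP h1 hm, sum_notP h1 hm, sum_notP h1 hm]
  · rw [dK11, dK1m, dKm1, dKmm]; push_cast; norm_num; ring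
  · intro k hk; rw [dK_notP _ _ (fun h => hk h.2)]; simp
  · intro k hk; rw [dK_notP _ _ (fun h => hk h.2)]; simp
  · intro k hk; refine Finset.sum_eq_zero fun l _ => ?_; rw [dK_notP _ _ (fun h => hk h.1)]; simp

lemma MK_sum {S : Finset ℤ} (s : ℝ) (z : ℤ → ℂ) {g : ℤ → ℂ} (hgz : ∀ k, g k = (wt s k : ℂ) * z k) :
    ∑ p ∈ QS S 2, (MK s p : ℂ) * quad z p = 
      4 * (∑ p ∈ QS S 2, (cK s p.2.2.1 p.2.2.2 : ℂ) * (z p.2.2.1 * conj (z p.2.2.2)) * (g p.1 * conj (g p.2.1)))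
      + (∑ p ∈ QS S 2, (dK p.1 p.2.2.1 : ℂ) * (z p.1 * z p.2.2.1) * (conj (g p.2.1) * conj (g p.2.2.2)))
      - ∑ p ∈ QS S 2, (dK p.2.1 p.2.2.2 : ℂ) * (conj (z p.2.1) * conj (z p.2.2.2)) * (g p.1 * g p.2.2.1) := by
  set f : ℤ × ℤ × ℤ × ℤ → ℂ := fun p => (cK s p.2.2.1 p.2.2.2 : ℂ) * (z p.2.2.1 * conj (z p.2.2.2)) * (g p.1 * conj (g p.2.1)) with hf
  have a1 := QS_swap13 (S := S) (e := 2) f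
  have a2 := QS_swap24 (S := S) (e := 2) f
  have a3 := QS_swap24 (S := S) (e := 2) (fun p => f (p.2.2.1, p.2.1, p.1, p.2.2.2))
  have : 4 * ∑ p ∈ QS S 2, f p = (∑ p ∈ QS S 2, f p + ∑ p ∈ QS S 2, f (p.2.2.1, p.2.1, p.1, p.2.2.2)
    + ∑ p ∈ QS S 2, f (p.1, p.2.2.2, p.2.2.1, p.2.1) + 
    ∑ p ∈ QS S 2, (fun p => f (p.2.2.1, p.2.1, p.1, p.2.2.2)) (p.1, p.2.2.2, p.2.2.1, p.2.1)) := by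
    rw [← a3, ← a2, ← a1]; ring
  rw [this, ← Finset.sum_add_distrib, ← Finset.sum_add_distrib, ← Finset.sum_add_distrib, ← Finset.sum_add_distrib, ← Finset.sum_sub_distrib]
  refine Finset.sum_congr rfl fun p _ => ?_
  simp only [hf, MK, quad, hgz, map_mul, Complex.conj_ofReal]
  push_cast
  ring
end

/-! Part L -/

noncomputable section
open ComplexConjugate

lemma prod_near {a b : ℂ} {ρ : ℝ} (hρ : ρ ≤ 1) (ha : ‖a - 1‖ ≤ ρ) (hb : ‖b - 1‖ ≤ ρ) : ‖a * b - 1‖ ≤ 3 * ρ := by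
  have e : a * b - 1 = (a - 1) * (b - 1) + (a - 1) + (b - 1) := by ring
  rw [e]
  have h1 := norm_add_le ((a - 1) * (b - 1) + (a - 1)) (b - 1)
  have h2 := norm_add_le ((a - 1) * (b - 1)) (a - 1)
  rw [norm_mul] at h2
  have h0 : 0 ≤ ‖a - 1‖ := norm_nonneg _
  have h3 : ‖a - 1‖ * ‖b - 1‖ ≤ ρ * 1 := mul_le_mul ha (hb.trans hρ) (norm_nonneg _) (h0.trans ha)
  linarith

lemma conj_near {a : ℂ} {ρ : ℝ} (ha : ‖a - 1‖ ≤ ρ) : ‖conj a - 1‖ ≤ ρ := by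
  have : conj a - 1 = conj (a - 1) := by simp
  rw [this, RCLike.norm_conj]; exact ha

lemma re_near {c : ℝ} {w A : ℂ} {μ G : ℝ} (hw : ‖w - 1‖ ≤ μ) (hA : ‖A‖ ≤ G) : |((c : ℂ) * w * A).re - c * A.re| ≤ |c| * μ * G := by
  have : ((c : ℂ) * w * A).re - c * A.re = ((c : ℂ) * ((w - 1) * A)).re := by
    rw [show (c : ℂ) * ((w - 1) * A) = (c : ℂ) * w * A - (c : ℂ) * A by ring, Complex.sub_re, Complex.re_ofReal_mul c A]
  rw [this]
  refine (Complex.abs_re_le_norm _).trans ?_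
  rw [norm_mul, norm_mul, Complex.norm_real, Real.norm_eq_abs, mul_assoc]
  have := (norm_nonneg (w - 1)).trans hw
  gcongr

lemma MK_re {S : Finset ℤ} (h1 : (1 : ℤ) ∈ S) (hm : (-1 : ℤ) ∈ S) {s ρ : ℝ} (hs : 1 ≤ s) (hρ1 : ρ ≤ 1) {z g : ℤ → ℂ}
    (hgz : ∀ k, g k = (wt s k : ℂ) * z k) (hz : ∀ k, k ∉ S → z k = 0) (hz1 : ‖z 1 - 1‖ ≤ ρ) (hzm : ‖z (-1) - 1‖ ≤ ρ) :
    2 * Gn S g - 24 * (s + 1) * ρ * Gn S g ≤ -(1 / 4) * (∑ p ∈ QS S 2, (MK s p : ℂ) * quad z p).re - 2 * (Ac S 2 g).re := by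
  have hg : ∀ k, k ∉ S → g k = 0 := fun k hk => by rw [hgz, hz k hk, mul_zero]
  have c1 := conj_near hz1
  have cm := conj_near hzm
  have hA := Ac_le hg
  have hB := Bc_le hg
  have hBc : ∀ c, ‖conj (Bc S c g)‖ ≤ Gn S g := fun c => by rw [RCLike.norm_conj]; exact hB c
  have e1 := re_near (c := -2) (prod_near hρ1 hz1 c1) (hA 2)
  have e2 := re_near (c := 4 * s - 2) (prod_near hρ1 hz1 cm) (hA 4)
  have e3 := re_near (c := -(4 * s) - 2) (prod_near hρ1 hzm c1) (hA 0)
  have e4 := re_near (c := -2) (prod_near hρ1 hzm cm) (hA 2)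
  have e5 := re_near (c := 4) (prod_near hρ1 hz1 hz1) (hBc 4)
  have e6 := re_near (c := 4) (prod_near hρ1 hzm hzm) (hBc 0)
  have e7 := re_near (c := 4) (prod_near hρ1 c1 c1) (hB 0)
  have e8 := re_near (c := 4) (prod_near hρ1 cm cm) (hB (-4))
  have hmain := main_form hg hs
  rw [MK_sum s z hgz, MK_c h1 hm hg, MK_d13 h1 hm hg, MK_d24 h1 hm hg]
  rw [abs_of_nonneg (show (0:ℝ) ≤ 4 * s - 2 by linarith)] at e2
  rw [abs_of_nonpos (show -(4 * s) - 2 ≤ (0:ℝ) by linarith)] at e3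
  rw [show |(-2:ℝ)| = 2 by norm_num] at e1 e4
  rw [show |(4:ℝ)| = 4 by norm_num] at e5 e6 e7 e8
  push_cast at e1 e2 e3 e4 e5 e6 e7 e8
  have hA0 : (Ac S 0 g).re = Gn S g := by rw [Ac_zero]; simp
  rw [hA0] at e3
  rw [Complex.conj_re] at e5 e6
  simp only [Complex.sub_re, Complex.add_re] at hmain ⊢
  have h2B : (2 * Bc S 0 g).re = 2 * (Bc S 0 g).re := by simp
  rw [h2B] at hmain
  have h4 : ∀ w : ℂ, (4 * w).re = 4 * w.re := fun w => by simp
  rw [h4]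
  simp only [Complex.sub_re, Complex.add_re]
  rw [abs_le] at e1 e2 e3 e4 e5 e6 e7 e8
  linarith [e1.1, e1.2, e2.1, e2.2, e3.1, e3.2, e4.1, e4.2, e5.1, e5.2, e6.1, e6.2, e7.1, e7.2, e8.1, e8.2]

lemma sym_lower {s : ℝ} (hs : 1 ≤ s) : ∃ C, 0 ≤ C ∧ ∀ (S : Finset ℤ) (hS : ∀ k ∈ S, Odd k) (h1 : (1 : ℤ) ∈ S) (hm : (-1 : ℤ) ∈ S)
    (z : ℤ → ℂ) (hz : ∀ k, k ∉ S → z k = 0) (ρ : ℝ) (hρ : ρ ≤ 1) (hz1 : ‖z 1 - 1‖ ≤ ρ) (hzm : ‖z (-1) - 1‖ ≤ ρ)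
    (hW : W1 S z ≤ 4) (hρs : 24 * (s + 1) * ρ ≤ 1 / 4) (hV : 480 * (5 * s * 9 ^ s) ^ 2 * Vh S z ≤ 1 / 4),
    (5 / 4) * Ys S (fun k => wt s k ^ 2) z - C ≤ 
     -(1 / 4) * (∑ p ∈ QS S 2, (symb (a2 s) 2 p : ℂ) * quad z p).re - 2 * (Ff S 2 (a2 s) z).re := by
  obtain ⟨C, hC, hpt⟩ := MK_pointwise hs (η := 1 / 200) (by norm_num)
  refine ⟨768 * C, by positivity, ?_⟩
  intro S hS h1 hm z hz ρ hρ hz1 hzm hW hρs hV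
  set g : ℤ → ℂ := fun k => (wt s k : ℂ) * z k with hg
  have hgn : ∀ k, ‖g k‖ = wt s k * ‖z k‖ := fun k => by
    simp only [hg]; rw [norm_mul, Complex.norm_real, Real.norm_eq_abs, abs_of_nonneg (wt_nonneg s k)]
  have hG : Ys S (fun k => wt s k ^ 2) z = Gn S g := by
    unfold Ys Gn
    refine Finset.sum_congr rfl fun k _ => ?_
    rw [hgn]; ring
  have hF : Ff S 2 (a2 s) z = Ac S 2 g := by
    unfold Ff Ac
    refine Finset.sum_congr rfl fun k _ => ?_
    simp only [hg, a2, map_mul, Complex.conj_ofReal]; push_cast; ring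
  have hM := MK_re h1 hm hs hρ (fun k => rfl : ∀ k, g k = (wt s k : ℂ) * z k) hz hz1 hzm
  rw [hG, hF]
  have hsplit : ∑ p ∈ QS S 2, (symb (a2 s) 2 p : ℂ) * quad z p = ∑ p ∈ QS S 2, (MK s p : ℂ) * quad z p + ∑ p ∈ QS S 2, (DK s p : ℂ) * quad z p := by
    rw [← Finset.sum_add_distrib]
    refine Finset.sum_congr rfl fun p _ => ?_
    simp only [DK]; push_cast; ring
  rw [hsplit, Complex.add_re]
  have hx0 : ∀ k, 0 ≤ wt s k * ‖z k‖ := fun k => mul_nonneg (wt_nonneg _ _) (norm_nonneg _)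
  have hy0 : ∀ k : ℤ, 0 ≤ |(k:ℝ)| * ‖z k‖ := fun k => by positivity
  have hv0 : ∀ k : ℤ, 0 ≤ vk k * ‖z k‖ := fun k => mul_nonneg (vk_nonneg _) (norm_nonneg _)
  have hz0 : ∀ k : ℤ, 0 ≤ ‖z k‖ := fun k => norm_nonneg _
  have p1 := sum_pairSum_le (S := S) (e := 2) (fun k => wt s k * ‖z k‖) (fun k => |(k:ℝ)| * ‖z k‖) (fun k => vk k * ‖z k‖) hx0 hy0 hv0
  have p2 := sum_pairSum_le (S := S) (e := 2) (fun k => wt s k * ‖z k‖) (fun k => ‖z k‖) (fun k => ‖z k‖) hx0 hz0 hz0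
  have p3 := sum_pairSum_le (S := S) (e := 2) (fun k => ‖z k‖) (fun k => ‖z k‖) (fun k => ‖z k‖) hz0 hz0 hz0
  have hGx : ∑ k ∈ S, (wt s k * ‖z k‖) ^ 2 = Gn S g := by
    unfold Gn; refine Finset.sum_congr rfl fun k _ => ?_; rw [hgn]
  have hW0 : ∑ k ∈ S, ‖z k‖ ≤ 4 := (W0_le hS z).trans hW
  have hW0n : 0 ≤ ∑ k ∈ S, ‖z k‖ := Finset.sum_nonneg fun k _ => norm_nonneg _
  have hGn := Gn_nonneg S g
  have hVn := Vh_nonneg S z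
  have hL2 : ∑ k ∈ S, ‖z k‖ ^ 2 ≤ 16 := by
    have : ∑ k ∈ S, ‖z k‖ ^ 2 ≤ (∑ k ∈ S, ‖z k‖) ^ 2 := by
      rw [sq, Finset.sum_mul]
      refine Finset.sum_le_sum fun k hk => ?_
      rw [sq]
      exact mul_le_mul_of_nonneg_left (Finset.single_le_sum (f := fun k => ‖z k‖) (fun k _ => norm_nonneg _) hk) (norm_nonneg _)
    nlinarith
  have hD : |(∑ p ∈ QS S 2, (DK s p : ℂ) * quad z p).re| ≤ 1920 * (5 * s * 9 ^ s) ^ 2 * Vh S z * Gn S g + (192 / 200) * Gn S g + 3072 * C := by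
    refine (Complex.abs_re_le_norm _).trans ((norm_sum_le _ _).trans ?_)
    have : ∀ p ∈ QS S 2, ‖(DK s p : ℂ) * quad z p‖ ≤ 40 * (5 * s * 9 ^ s) ^ 2 * pairSum (fun k => wt s k * ‖z k‖) (fun k => |(k:ℝ)| * ‖z k‖) (fun k => vk k * ‖z k‖) p
        + (1 / 200) * pairSum (fun k => wt s k * ‖z k‖) (fun k => ‖z k‖) (fun k => ‖z k‖) p + C * pairSum (fun k => ‖z k‖) (fun k => ‖z k‖) (fun k => ‖z k‖) p := by
      intro p hp
      rw [mem_QS] at hp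
      rw [norm_mul, norm_quad, Complex.norm_real, Real.norm_eq_abs]
      exact hpt p (hS _ (by tauto)) (hS _ (by tauto)) (hS _ (by tauto)) (hS _ (by tauto)) (by tauto) (fun k => ‖z k‖) hz0
    refine (Finset.sum_le_sum this).trans ?_
    rw [Finset.sum_add_distrib, Finset.sum_add_distrib, ← Finset.mul_sum, ← Finset.mul_sum, ← Finset.mul_sum]
    have q1 : 40 * (5 * s * 9 ^ s) ^ 2 * ∑ p ∈ QS S 2, pairSum (fun k => wt s k * ‖z k‖) (fun k => |(k:ℝ)| * ‖z k‖) (fun k => vk k * ‖z k‖) p ≤ 1920 * (5 * s * 9 ^ s) ^ 2 * Vh S z * Gn S g := by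
      have hW1 : ∑ k ∈ S, |(k:ℝ)| * ‖z k‖ = W1 S z := rfl
      have hV1 : ∑ k ∈ S, vk k * ‖z k‖ = Vh S z := rfl
      rw [hW1, hV1, hGx] at p1
      calc _ ≤ 40 * (5 * s * 9 ^ s) ^ 2 * (12 * (Gn S g * W1 S z * Vh S z)) := by gcongr
        _ ≤ 40 * (5 * s * 9 ^ s) ^ 2 * (12 * (Gn S g * 4 * Vh S z)) := by gcongr
        _ = _ := by ring
    have q2 : (1 / 200) * ∑ p ∈ QS S 2, pairSum (fun k => wt s k * ‖z k‖) (fun k => ‖z k‖) (fun k => ‖z k‖) p ≤ (192 / 200) * Gn S g := by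
      rw [hGx] at p2
      calc _ ≤ (1 / 200) * (12 * (Gn S g * (∑ k ∈ S, ‖z k‖) * (∑ k ∈ S, ‖z k‖))) := by gcongr
        _ ≤ (1 / 200) * (12 * (Gn S g * 4 * 4)) := by gcongr
        _ = _ := by ring
    have q3 : C * ∑ p ∈ QS S 2, pairSum (fun k => ‖z k‖) (fun k => ‖z k‖) (fun k => ‖z k‖) p ≤ 3072 * C := by
      calc _ ≤ C * (12 * ((∑ k ∈ S, ‖z k‖ ^ 2) * (∑ k ∈ S, ‖z k‖) * (∑ k ∈ S, ‖z k‖))) := by gcongr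
        _ ≤ C * (12 * (16 * 4 * 4)) := by gcongr
        _ = _ := by ring
    linarith
  rw [abs_le] at hD
  have r1 : 480 * (5 * s * 9 ^ s) ^ 2 * Vh S z * Gn S g ≤ 1 / 4 * Gn S g := by gcongr
  have r2 : 24 * (s + 1) * ρ * Gn S g ≤ 1 / 4 * Gn S g := by gcongr
  linarith [hD.2]
end

/-! Part M -/

noncomputable section
open ComplexConjugate

lemma rpow_diff_aux {α R x y : ℝ} (hα : 0 < α) (hα1 : α < 1) (hR : 1 ≤ R) (hy : R ≤ y) (hyx : y ≤ x) (hxy : x - y ≤ 2) :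
    x ^ α - y ^ α ≤ 2 * R ^ (α - 1) := by
  have hy0 : 0 < y := by linarith
  have h := rpow_one_add_le_one_add_mul_self (s := (x - y) / y) (p := α) (by
    have : 0 ≤ (x - y) / y := div_nonneg (by linarith) hy0.le
    linarith) hα.le hα1.le
  have e : x = y * (1 + (x - y) / y) := by field_simp; ring
  have e2 : x ^ α = y ^ α * (1 + (x - y) / y) ^ α := by
    rw [← Real.mul_rpow hy0.le (by
      have : 0 ≤ (x - y) / y := div_nonneg (by linarith) hy0.le
      linarith), ← e]
  have hya : 0 < y ^ α := Real.rpow_pos_of_pos hy0 _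
  have e3 : y ^ (α - 1) = y ^ α / y := Real.rpow_sub_one hy0.ne' α
  have h5 : x ^ α - y ^ α ≤ α * (x - y) * y ^ (α - 1) := by
    rw [e2, e3]
    calc y ^ α * (1 + (x - y) / y) ^ α - y ^ α ≤ y ^ α * (1 + α * ((x - y) / y)) - y ^ α := by gcongr
      _ = _ := by field_simp; ring
  have h6 : y ^ (α - 1) ≤ R ^ (α - 1) := Real.rpow_le_rpow_of_nonpos (by linarith) hy (by linarith)
  have h7 : 0 ≤ y ^ (α - 1) := Real.rpow_nonneg hy0.le _
  have h8 : α * (x - y) ≤ 2 := by nlinarith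
  calc _ ≤ _ := h5
    _ ≤ 2 * R ^ (α - 1) := by gcongr

lemma rpow_diff {α R x y : ℝ} (hα : 0 < α) (hα1 : α < 1) (hR : 1 ≤ R) (hx : R ≤ x) (hy : R ≤ y) (hxy : |x - y| ≤ 2) :
    |x ^ α - y ^ α| ≤ 2 * R ^ (α - 1) := by
  rw [abs_le] at hxy
  have h0 : 0 ≤ R ^ (α - 1) := Real.rpow_nonneg (by linarith) _
  rcases le_total y x with h | h
  · have h1 := rpow_diff_aux hα hα1 hR hy h (by linarith)
    have h2 : y ^ α ≤ x ^ α := Real.rpow_le_rpow (by linarith) h hα.le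
    rw [abs_le]; constructor <;> linarith
  · have h1 := rpow_diff_aux hα hα1 hR hx h (by linarith)
    have h2 : x ^ α ≤ y ^ α := Real.rpow_le_rpow (by linarith) h hα.le
    rw [abs_le]; constructor <;> linarith

lemma abs_shift_diff (k : ℤ) : |(|((k + 2 : ℤ) : ℝ)| - |(k : ℝ)|)| ≤ 2 := by
  refine (abs_abs_sub_abs_le _ _).trans ?_
  push_cast
  rw [show (k:ℝ) + 2 - k = 2 by ring]; norm_num

/-- low frequency product bound -/
lemma low_prod {s R μ : ℝ} (hs : 1 ≤ s) (hμ : 0 < μ) {i j : ℤ} (hi : Odd i) (hij : |j - i| ≤ 2) (hiR : |(i:ℝ)| ≤ R + 2) (x y : ℝ) :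
    2 * ((wt s i * x) * (wt s j * y)) ≤ μ * 9 ^ s * (wR (2 * s) (R + 2) i ^ 2 * x ^ 2) + μ⁻¹ * y ^ 2 := by
  have hw : wR (2 * s) (R + 2) i = wt s i * wt s i := by
    unfold wR wt
    rw [min_eq_left hiR, two_mul, Real.rpow_add_of_nonneg (abs_nonneg _) (by linarith) (by linarith)]
  have hsh : wt s j ≤ 3 ^ s * wt s i := by
    have := wt_shift (s := s) (by linarith) hi (j - i) hij
    simpa using this
  have h9 : (9:ℝ) ^ s = (3 ^ s) ^ 2 := by
    rw [← Real.rpow_natCast, ← Real.rpow_mul (by norm_num), mul_comm s, Real.rpow_mul (by norm_num)]; norm_num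
  have hwi := wt_nonneg s i
  have hwj := wt_nonneg s j
  have hb : 2 * ((wt s i * x) * (wt s j * y)) ≤ 2 * ((3 ^ s * (wt s i * wt s i)) * |x| * |y|) := by
    have : (wt s i * x) * (wt s j * y) ≤ wt s i * wt s j * (|x| * |y|) := by
      calc _ = wt s i * wt s j * (x * y) := by ring
        _ ≤ _ := by
          refine mul_le_mul_of_nonneg_left ?_ (mul_nonneg hwi hwj)
          rw [← abs_mul]; exact le_abs_self _
    have h2 : wt s i * wt s j * (|x| * |y|) ≤ wt s i * (3 ^ s * wt s i) * (|x| * |y|) := by gcongr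
    linarith [this, h2, show wt s i * (3 ^ s * wt s i) * (|x| * |y|) = (3 ^ s * (wt s i * wt s i)) * |x| * |y| by ring]
  refine hb.trans ?_
  rw [hw, h9]
  set P := (3:ℝ) ^ s * (wt s i * wt s i) * |x| with hP
  have e1 : μ * (3 ^ s) ^ 2 * ((wt s i * wt s i) ^ 2 * x ^ 2) = μ * P ^ 2 := by
    rw [hP, mul_pow, mul_pow, sq_abs]; ring
  rw [e1, ← sq_abs y]
  have e2 : μ * P ^ 2 + μ⁻¹ * |y| ^ 2 - 2 * (P * |y|) = μ⁻¹ * (μ * P - |y|) ^ 2 := by field_simp; ring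
  have : 0 ≤ μ⁻¹ * (μ * P - |y|) ^ 2 := by positivity
  linarith

lemma disp_pt {α s R μ : ℝ} (hα : 0 < α) (hα1 : α < 1) (hs : 1 ≤ s) (hR : 1 ≤ R) (hμ : 0 < μ) (z : ℤ → ℂ) {k : ℤ} (hk : Odd k) :
    |(|((k + 2 : ℤ) : ℝ)| ^ α - |(k : ℝ)| ^ α)| * ((wt s k * ‖z k‖) * (wt s (k + 2) * ‖z (k + 2)‖)) ≤ 
      2 * R ^ (α - 1) * ((wt s k * ‖z k‖) * (wt s (k + 2) * ‖z (k + 2)‖)) + 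
      (μ * 9 ^ s * (wR (2 * s) (R + 2) k ^ 2 * ‖z k‖ ^ 2 + wR (2 * s) (R + 2) (k + 2) ^ 2 * ‖z (k + 2)‖ ^ 2)
        + μ⁻¹ * ((if isP k then 0 else 1) * ‖z k‖ ^ 2 + (if isP (k + 2) then 0 else 1) * ‖z (k + 2)‖ ^ 2)) := by
  have hX : 0 ≤ (wt s k * ‖z k‖) * (wt s (k + 2) * ‖z (k + 2)‖) := by
    have := wt_nonneg s k; have := wt_nonneg s (k + 2); positivity
  have hR0 : 0 ≤ R ^ (α - 1) := Real.rpow_nonneg (by linarith) _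
  have hk2 : Odd (k + 2) := by
    obtain ⟨m, rfl⟩ := hk; exact ⟨m + 1, by ring⟩
  have i1 : (0:ℝ) ≤ if isP k then 0 else 1 := by split_ifs <;> norm_num
  have i2 : (0:ℝ) ≤ if isP (k + 2) then 0 else 1 := by split_ifs <;> norm_num
  have hmi : 0 < μ⁻¹ := by positivity
  have hrest : 0 ≤ (μ * 9 ^ s * (wR (2 * s) (R + 2) k ^ 2 * ‖z k‖ ^ 2 + wR (2 * s) (R + 2) (k + 2) ^ 2 * ‖z (k + 2)‖ ^ 2)
        + μ⁻¹ * ((if isP k then 0 else 1) * ‖z k‖ ^ 2 + (if isP (k + 2) then 0 else 1) * ‖z (k + 2)‖ ^ 2)) := by positivity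
  by_cases hh : R ≤ |((k + 2 : ℤ) : ℝ)| ∧ R ≤ |(k : ℝ)|
  · have := rpow_diff hα hα1 hR hh.1 hh.2 (abs_shift_diff k)
    have := mul_le_mul_of_nonneg_right this hX
    linarith
  · have hd := rpow_diff hα hα1 le_rfl (odd_abs_ge hk2) (odd_abs_ge hk) (abs_shift_diff k)
    rw [Real.one_rpow, mul_one] at hd
    have hsd := abs_le.1 (abs_shift_diff k)
    have hkR : |(k:ℝ)| ≤ R + 2 ∧ |((k + 2 : ℤ) : ℝ)| ≤ R + 2 := by
      by_contra hc
      apply hh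
      rw [not_and_or, not_le, not_le] at hc
      rcases hc with hc | hc <;> constructor <;> linarith [hsd.1, hsd.2]
    have hhi : 0 ≤ 2 * R ^ (α - 1) * ((wt s k * ‖z k‖) * (wt s (k + 2) * ‖z (k + 2)‖)) := by positivity
    have hup := mul_le_mul_of_nonneg_right hd hX
    by_cases hP2 : isP (k + 2)
    · by_cases hP : isP k
      · have : |((k + 2 : ℤ) : ℝ)| ^ α - |(k : ℝ)| ^ α = 0 := by rw [isP_abs hP2, isP_abs hP]; simp
        rw [this, abs_zero, zero_mul]; linarith
      · have hl := low_prod (s := s) (R := R) hs hμ (i := k + 2) (j := k) hk2 (by simp) hkR.2 ‖z (k + 2)‖ ‖z k‖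
        rw [if_neg hP, if_pos hP2]
        have : 0 ≤ μ * 9 ^ s * (wR (2 * s) (R + 2) k ^ 2 * ‖z k‖ ^ 2) := by positivity
        nlinarith
    · have hl := low_prod (s := s) (R := R) hs hμ (i := k) (j := k + 2) hk (by simp) hkR.1 ‖z k‖ ‖z (k + 2)‖
      rw [if_neg hP2]
      have : 0 ≤ μ * 9 ^ s * (wR (2 * s) (R + 2) (k + 2) ^ 2 * ‖z (k + 2)‖ ^ 2) := by positivity
      have : 0 ≤ μ⁻¹ * ((if isP k then 0 else 1) * ‖z k‖ ^ 2) := by positivity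
      nlinarith

lemma disp_sum {α s R μ : ℝ} (hα : 0 < α) (hα1 : α < 1) (hs : 1 ≤ s) (hR : 1 ≤ R) (hμ : 0 < μ) {S : Finset ℤ} (hS : ∀ k ∈ S, Odd k)
    {z : ℤ → ℂ} (hz : ∀ k, k ∉ S → z k = 0) :
    ∑ k ∈ S, |(|((k + 2 : ℤ) : ℝ)| ^ α - |(k : ℝ)| ^ α)| * ((wt s k * ‖z k‖) * (wt s (k + 2) * ‖z (k + 2)‖)) ≤ 
      2 * R ^ (α - 1) * Ys S (fun k => wt s k ^ 2) z + 
      (2 * μ * 9 ^ s * Ys S (fun k => wR (2 * s) (R + 2) k ^ 2) z + 2 * μ⁻¹ * Xh S z) := by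
  refine (Finset.sum_le_sum fun k hk => disp_pt hα hα1 hs hR hμ z (hS k hk)).trans ?_
  rw [Finset.sum_add_distrib, Finset.sum_add_distrib, ← Finset.mul_sum, ← Finset.mul_sum, ← Finset.mul_sum, Finset.sum_add_distrib, Finset.sum_add_distrib]
  have hinj : Function.Injective (fun k : ℤ => k + 2) := add_left_injective 2
  have hR0 : 0 ≤ R ^ (α - 1) := Real.rpow_nonneg (by linarith) _
  set g : ℤ → ℂ := fun k => (wt s k : ℂ) * z k with hg
  have hgn : ∀ k, ‖g k‖ = wt s k * ‖z k‖ := fun k => by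
    simp only [hg]; rw [norm_mul, Complex.norm_real, Real.norm_eq_abs, abs_of_nonneg (wt_nonneg s k)]
  have hG : Ys S (fun k => wt s k ^ 2) z = Gn S g := by
    unfold Ys Gn
    refine Finset.sum_congr rfl fun k _ => ?_
    rw [hgn]; ring
  have t1 := corr_le (S := S) (g := g) (fun k hk => by simp only [hg]; rw [hz k hk, mul_zero]) hinj
  simp only [hgn] at t1
  rw [← hG] at t1
  have t2 := sum_inj_le (S := S) (f := fun k => wR (2 * s) (R + 2) k ^ 2 * ‖z k‖ ^ 2) (fun k => by positivity) (fun k hk => by rw [hz k hk]; simp) hinj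
  have t3 := sum_inj_le (S := S) (f := fun k => (if isP k then 0 else 1) * ‖z k‖ ^ 2) (fun k => by split_ifs <;> positivity) (fun k hk => by rw [hz k hk]; simp) hinj
  have e2 : ∑ k ∈ S, wR (2 * s) (R + 2) k ^ 2 * ‖z k‖ ^ 2 = Ys S (fun k => wR (2 * s) (R + 2) k ^ 2) z := rfl
  have e3 : ∑ k ∈ S, (if isP k then 0 else 1) * ‖z k‖ ^ 2 = Xh S z := rfl
  rw [e2] at t2 ⊢
  rw [e3] at t3 ⊢
  have hmi : 0 < μ⁻¹ := by positivity
  have u1 := mul_le_mul_of_nonneg_left t1 (show 0 ≤ 2 * R ^ (α - 1) by positivity)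
  have u2 := mul_le_mul_of_nonneg_left t2 (show 0 ≤ μ * 9 ^ s by positivity)
  have u3 := mul_le_mul_of_nonneg_left t3 hmi.le
  linarith

/-- growth of the virial functional -/
lemma growth {α s : ℝ} (hα : 0 < α) (hα1 : α < 1) (hs : 1 ≤ s) : ∃ C, 0 ≤ C ∧ ∀ (ε R ρ Y A T : ℝ) (hε : 0 < ε) (hε1 : ε ≤ 1) 
    (hR : 1 ≤ R) (hRε : 2 * R ^ (α - 1) ≤ ε ^ 2 / 4) (hρ : ρ ≤ 1) (hρs : 24 * (s + 1) * ρ ≤ 1 / 4)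
    (S : Finset ℤ) (hS : ∀ k ∈ S, Odd k) (h1 : (1 : ℤ) ∈ S) (hm : (-1 : ℤ) ∈ S) (z : ℝ → ℤ → ℂ)
    (H : GSol S (lamE α ε) (Set.Icc 0 T) z)
    (hz1 : ∀ t ∈ Set.Icc 0 T, ‖z t 1 - 1‖ ≤ ρ ∧ ‖z t (-1) - 1‖ ≤ ρ)
    (hW : ∀ t ∈ Set.Icc 0 T, W1 S (z t) ≤ 4) 
    (hV : ∀ t ∈ Set.Icc 0 T, 480 * (5 * s * 9 ^ s) ^ 2 * Vh S (z t) ≤ 1 / 4)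
    (hY : ∀ t ∈ Set.Icc 0 T, Ys S (fun k => wR (2 * s) (R + 2) k ^ 2) (z t) ≤ Y)
    (hX : ∀ t ∈ Set.Icc 0 T, Xh S (z t) ≤ A * ε ^ 2)
    (hB : ∀ t ∈ Set.Icc 0 T, ‖Bd S 2 (a2 s) (z t)‖ ≤ 1),
    ∀ t ∈ Set.Icc 0 T, Real.exp t * (-(Ff S 2 (a2 s) (z 0)).im - (C + 1 + 2 * 9 ^ s * Y + 2 * A) / ε) ≤ Ys S (fun k => wt s k ^ 2) (z t) := by
  obtain ⟨C, hC, hlow⟩ := sym_lower hs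
  refine ⟨C, hC, ?_⟩
  intro ε R ρ Y A T hε hε1 hR hRε hρ hρs S hS h1 hm z H hz1 hW hV hY hX hB
  have hFn : ∀ y : ℤ → ℂ, (∀ k, k ∉ S → y k = 0) → ‖Ff S 2 (a2 s) y‖ ≤ Ys S (fun k => wt s k ^ 2) y := by
    intro y hy
    set g : ℤ → ℂ := fun k => (wt s k : ℂ) * y k with hg
    have hgn : ∀ k, ‖g k‖ = wt s k * ‖y k‖ := fun k => by
      simp only [hg]; rw [norm_mul, Complex.norm_real, Real.norm_eq_abs, abs_of_nonneg (wt_nonneg s k)]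
    have hG : Ys S (fun k => wt s k ^ 2) y = Gn S g := by
      unfold Ys Gn
      refine Finset.sum_congr rfl fun k _ => ?_
      rw [hgn]; ring
    have hF : Ff S 2 (a2 s) y = Ac S 2 g := by
      unfold Ff Ac
      refine Finset.sum_congr rfl fun k _ => ?_
      simp only [hg, a2, map_mul, Complex.conj_ofReal]; push_cast; ring
    rw [hG, hF]
    exact Ac_le (fun k hk => by simp only [hg]; rw [hy k hk, mul_zero]) 2
  set Q := (C + 1 + 2 * 9 ^ s * Y + 2 * A) / ε with hQ
  have hder := fun t (ht : t ∈ Set.Icc 0 T) => (hasDerivAt_im (Ff_deriv H 2 (a2 s) ht)).const_add Q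
  have hY0 : ∀ t ∈ Set.Icc 0 T, 0 ≤ Ys S (fun k => wt s k ^ 2) (z t) := fun t ht => (norm_nonneg _).trans (hFn _ (H.supp t))
  have hcmp := gronwall_basic (C := 1) hder (fun t ht => by
    have hX4 := hlow S hS h1 hm (z t) (H.supp t) ρ hρ (hz1 t ht).1 (hz1 t ht).2 (hW t ht) hρs (hV t ht)
    have hds := disp_sum (α := α) hα hα1 hs hR hε hS (H.supp t)
    have hFt := (Complex.abs_im_le_norm _).trans (hFn _ (H.supp t))
    rw [Complex.I_mul_im, Complex.sub_re, Complex.add_re]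
    have hb := (Complex.abs_re_le_norm _).trans (hB t ht)
    have e1 : ∑ k ∈ S, ((lamE α ε k - lamE α ε (k + 2) : ℝ) : ℂ) * ((a2 s k : ℂ) * z t k * conj (z t (k + 2)))
       = (∑ k ∈ S, (((ε ^ 2)⁻¹ * (|((k + 2 : ℤ) : ℝ)| ^ α - |(k : ℝ)| ^ α) : ℝ) : ℂ) * ((a2 s k : ℂ) * z t k * conj (z t (k + 2)))) + 2 * Ff S 2 (a2 s) (z t) := by
      unfold Ff
      rw [Finset.mul_sum, ← Finset.sum_add_distrib]
      refine Finset.sum_congr rfl fun k _ => ?_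
      have : lamE α ε k - lamE α ε (k + 2) = (ε ^ 2)⁻¹ * (|((k + 2 : ℤ) : ℝ)| ^ α - |(k : ℝ)| ^ α) + 2 := by
        unfold lamE; push_cast; ring
      rw [this]; push_cast; ring
    have e2 : |(∑ k ∈ S, (((ε ^ 2)⁻¹ * (|((k + 2 : ℤ) : ℝ)| ^ α - |(k : ℝ)| ^ α) : ℝ) : ℂ) * ((a2 s k : ℂ) * z t k * conj (z t (k + 2)))).re| ≤ (1 / 4) * Ys S (fun k => wt s k ^ 2) (z t) + (2 * 9 ^ s * Y + 2 * A) / ε := by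
      refine (Complex.abs_re_le_norm _).trans ((norm_sum_le _ _).trans ?_)
      have : ∀ k ∈ S, ‖(((ε ^ 2)⁻¹ * (|((k + 2 : ℤ) : ℝ)| ^ α - |(k : ℝ)| ^ α) : ℝ) : ℂ) * ((a2 s k : ℂ) * z t k * conj (z t (k + 2)))‖ = (ε ^ 2)⁻¹ * (|(|((k + 2 : ℤ) : ℝ)| ^ α - |(k : ℝ)| ^ α)| * ((wt s k * ‖z t k‖) * (wt s (k + 2) * ‖z t (k + 2)‖))) := by
        intro k _
        rw [norm_mul, Complex.norm_real, Real.norm_eq_abs, abs_mul, abs_of_pos (show 0 < (ε ^ 2)⁻¹ by positivity), norm_mul, norm_mul, RCLike.norm_conj, Complex.norm_real, Real.norm_eq_abs, a2, abs_of_nonneg (mul_nonneg (wt_nonneg _ _) (wt_nonneg _ _))]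
        ring
      rw [Finset.sum_congr rfl this, ← Finset.mul_sum]
      have h9 : (0:ℝ) < 9 ^ s := by positivity
      calc _ ≤ (ε ^ 2)⁻¹ * (2 * R ^ (α - 1) * Ys S (fun k => wt s k ^ 2) (z t) + 
      (2 * ε * 9 ^ s * Ys S (fun k => wR (2 * s) (R + 2) k ^ 2) (z t) + 2 * ε⁻¹ * Xh S (z t))) := by gcongr
        _ ≤ (ε ^ 2)⁻¹ * ((ε ^ 2 / 4) * Ys S (fun k => wt s k ^ 2) (z t) + 
      (2 * ε * 9 ^ s * Y + 2 * ε⁻¹ * (A * ε ^ 2))) := by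
          have := hY0 t ht
          have := hX t ht
          have := hY t ht
          gcongr
        _ = _ := by field_simp
    rw [e1, Complex.add_re]
    have h2 : (2 * Ff S 2 (a2 s) (z t)).re = 2 * (Ff S 2 (a2 s) (z t)).re := by simp
    have h3 : ((1 / 4 : ℂ) * ∑ p ∈ QS S 2, (symb (a2 s) 2 p : ℂ) * quad (z t) p).re = (1 / 4) * (∑ p ∈ QS S 2, (symb (a2 s) 2 p : ℂ) * quad (z t) p).re := by
      have : (1 / 4 : ℂ) = ((1 / 4 : ℝ) : ℂ) := by push_cast; rfl
      rw [this, Complex.re_ofReal_mul]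
    rw [h2, h3]
    rw [abs_le] at hb e2 hFt
    have hQe : Q = C / ε + 1 / ε + (2 * 9 ^ s * Y + 2 * A) / ε := by rw [hQ]; ring
    have g1 : C ≤ C / ε := by rw [le_div_iff₀ hε]; nlinarith
    have g2 : 1 ≤ 1 / ε := by rw [le_div_iff₀ hε]; linarith
    linarith [hb.1, hb.2, e2.1, e2.2, hFt.1, hFt.2, hY0 t ht])
  intro t ht
  have h := hcmp t ht
  rw [one_mul] at h
  have hFt := abs_le.1 ((Complex.abs_im_le_norm _).trans (hFn _ (H.supp t)))
  have hT : (0:ℝ) ∈ Set.Icc 0 T := ⟨le_rfl, ht.1.trans ht.2⟩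
  have hQ0 : 0 ≤ Q := by
    have y0 : 0 ≤ Y := (Finset.sum_nonneg fun k _ => by positivity : 0 ≤ Ys S (fun k => wR (2 * s) (R + 2) k ^ 2) (z t)).trans (hY t ht)
    have a0 : 0 ≤ A := by
      have := (Xh_nonneg S (z t)).trans (hX t ht)
      by_contra hc
      push Not at hc
      have : 0 < ε ^ 2 := by positivity
      nlinarith
    rw [hQ]; positivity
  nlinarith [hFt.1, hFt.2]
end

/-! Part N -/

noncomputable section
open ComplexConjugate

lemma lip_ode {E : Type*} [NormedAddCommGroup E] [NormedSpace ℝ E] [CompleteSpace E] {f : E → E} {K : NNReal} (hK : LipschitzWith K f)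
    {M : ℝ} (hM : ∀ x, ‖f x‖ ≤ M) (x₀ : E) {T : ℝ} (hT : 0 ≤ T) :
    ∃ x : ℝ → E, x 0 = x₀ ∧ ∀ t ∈ Set.Icc 0 T, HasDerivAt x (f (x t)) t := by
  have hM0 : 0 ≤ M := (norm_nonneg _).trans (hM x₀)
  have h0 : (0:ℝ) ∈ Set.Icc (-1) (T + 1) := ⟨by norm_num, by linarith⟩
  have hPL : IsPicardLindelof (fun _ => f) (tmin := -1) (tmax := T + 1) ⟨0, h0⟩ x₀ ⟨M * (T + 2), by positivity⟩ 0 ⟨M, hM0⟩ K := by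
    refine ⟨fun t _ => hK.lipschitzOnWith, fun x _ => continuousOn_const, fun t _ x _ => hM x, ?_⟩
    show M * max (T + 1 - 0) (0 - (-1)) ≤ M * (T + 2) - 0
    rw [sub_zero (M * (T + 2))]
    refine mul_le_mul_of_nonneg_left ?_ hM0
    exact max_le (by linarith) (by linarith)
  obtain ⟨x, hx0, hx⟩ := hPL.exists_eq_forall_mem_Icc_hasDerivWithinAt₀
  refine ⟨x, hx0, fun t ht => ?_⟩
  exact (hx t ⟨by linarith [ht.1], by linarith [ht.2]⟩).hasDerivAt (Icc_mem_nhds (by linarith [ht.1]) (by linarith [ht.2]))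

def ext0 (S : Finset ℤ) (x : S → ℂ) (k : ℤ) : ℂ := if h : k ∈ S then x ⟨k, h⟩ else 0

lemma ext0_mem {S : Finset ℤ} (x : S → ℂ) (k : S) : ext0 S x k = x k := by
  unfold ext0; rw [dif_pos k.2]

lemma ext0_contDiff (S : Finset ℤ) (k : ℤ) : ContDiff ℝ 1 (fun x : S → ℂ => ext0 S x k) := by
  unfold ext0
  by_cases h : k ∈ S
  · simp only [h, dif_pos]; exact contDiff_apply ℝ ℂ _
  · simp only [h, dif_neg, not_false_eq_true]; exact contDiff_const

def vf (S : Finset ℤ) (lam : ℤ → ℝ) (x : S → ℂ) : S → ℂ := fun k => Complex.I * (lam k * ext0 S x k + Nl S (ext0 S x) k)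

lemma vf_contDiff (S : Finset ℤ) (lam : ℤ → ℝ) : ContDiff ℝ 1 (vf S lam) := by
  rw [contDiff_pi]
  intro k
  unfold vf
  refine contDiff_const.mul ((contDiff_const.mul (ext0_contDiff S k)).add ?_)
  unfold Nl
  refine ContDiff.sum fun a _ => ContDiff.sum fun b _ => ContDiff.sum fun c _ => ?_
  split_ifs
  · refine ((contDiff_const.mul (ext0_contDiff S a)).mul ?_).mul (ext0_contDiff S c)
    exact Complex.conjCLE.contDiff.comp (ext0_contDiff S b)
  · exact contDiff_const

lemma mass_static (S : Finset ℤ) (z : ℤ → ℂ) : (∑ k ∈ S, Nl S z k * conj (z k)).im = 0 := by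
  have h := static_symm (S := S) (e := 0) (fun _ => 1) z
  have h0 : ∑ p ∈ QS S 0, (symb (fun _ => 1) 0 p : ℂ) * quad z p = 0 := by
    refine Finset.sum_eq_zero fun p hp => ?_
    rw [mem_QS] at hp
    have he : (p.1 : ℝ) + p.2.2.1 = p.2.1 + p.2.2.2 := by
      have := hp.2; push_cast [← Int.cast_add]; exact_mod_cast (by omega)
    have : symb (fun _ => 1) 0 p = 0 := by
      simp only [symb]; nlinarith
    rw [this]; simp
  rw [h0, mul_zero] at h
  simp only [Complex.ofReal_one, one_mul, sub_zero, add_zero] at h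
  have e : ∑ k ∈ S, z k * conj (Nl S z k) = conj (∑ k ∈ S, Nl S z k * conj (z k)) := by
    rw [map_sum]; refine Finset.sum_congr rfl fun k _ => ?_
    rw [map_mul, Complex.conj_conj, mul_comm]
  rw [e] at h
  have := congrArg Complex.im h
  rw [Complex.sub_im, Complex.conj_im, Complex.zero_im] at this
  linarith

theorem galerkin (S : Finset ℤ) (lam : ℤ → ℝ) (y : ℤ → ℂ) (hy : ∀ k, k ∉ S → y k = 0) {T : ℝ} (hT : 0 ≤ T) :
    ∃ z : ℝ → ℤ → ℂ, GSol S lam (Set.Icc 0 T) z ∧ z 0 = y := by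
  set M := ∑ k ∈ S, ‖y k‖ ^ 2 with hM
  have hM0 : 0 ≤ M := Finset.sum_nonneg fun k _ => by positivity
  let χ : ContDiffBump (0 : S → ℂ) := ⟨M + 1, M + 2, by linarith, by linarith⟩
  set f : (S → ℂ) → (S → ℂ) := fun x => χ x • vf S lam x with hf
  have hfc : ContDiff ℝ 1 f := χ.contDiff.smul (vf_contDiff S lam)
  have hfs : HasCompactSupport f := χ.hasCompactSupport.smul_right
  obtain ⟨K, hK⟩ := hfc.lipschitzWith_of_hasCompactSupport hfs (by norm_num)
  obtain ⟨B, hB⟩ := hfs.exists_bound_of_continuous hfc.continuous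
  obtain ⟨x, hx0, hx⟩ := lip_ode hK hB (fun k : S => y k) hT
  have hmass : ∀ t ∈ Set.Icc 0 T, ∑ k : S, ‖x t k‖ ^ 2 = ∑ k : S, ‖x 0 k‖ ^ 2 := by
    refine const_of_deriv_zero (f := fun t => ∑ k : S, ‖x t k‖ ^ 2) (fun t ht => ?_)
    have h1 : ∀ k : S, HasDerivAt (fun τ => x τ k) (f (x t) k) t := fun k => (hasDerivAt_pi.1 (hx t ht)) k
    have h2 : ∀ k : S, HasDerivAt (fun τ => ‖x τ k‖ ^ 2) (2 * (f (x t) k * conj (x t k)).re) t := by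
      intro k
      have hr := hasDerivAt_re (h1 k)
      have hi := hasDerivAt_im (h1 k)
      have := (hr.mul hr).add (hi.mul hi)
      have e : (fun τ => ‖x τ k‖ ^ 2) = fun τ => (x τ k).re * (x τ k).re + (x τ k).im * (x τ k).im := by
        ext τ; rw [← Complex.normSq_eq_norm_sq, Complex.normSq_apply]
      rw [e]
      refine this.congr_deriv ?_
      rw [Complex.mul_re, Complex.conj_re, Complex.conj_im]; ring
    refine (HasDerivAt.fun_sum fun k _ => h2 k).congr_deriv ?_
    have e1 : ∀ k : S, 2 * (f (x t) k * conj (x t k)).re = -(2 * χ (x t)) * (Nl S (ext0 S (x t)) k * conj (ext0 S (x t) k)).im := by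
      intro k
      have : f (x t) k = (χ (x t) : ℂ) * (Complex.I * (lam k * ext0 S (x t) k + Nl S (ext0 S (x t)) k)) := by
        simp only [hf, vf, Pi.smul_apply, Complex.real_smul]
      rw [this, ← ext0_mem (x t) k]
      have e2 : (χ (x t) : ℂ) * (Complex.I * (lam k * ext0 S (x t) k + Nl S (ext0 S (x t)) k)) * conj (ext0 S (x t) k) = 
         (χ (x t) : ℂ) * (Complex.I * (((lam k * Complex.normSq (ext0 S (x t) k) : ℝ) : ℂ) + Nl S (ext0 S (x t)) k * conj (ext0 S (x t) k))) := by
        push_cast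
        rw [← Complex.mul_conj]; ring
      rw [e2, Complex.re_ofReal_mul, Complex.I_mul_re, Complex.add_im, Complex.ofReal_im]
      ring
    rw [Finset.sum_congr rfl fun k _ => e1 k, ← Finset.mul_sum]
    have := mass_static S (ext0 S (x t))
    rw [Complex.im_sum, ← Finset.sum_coe_sort] at this
    rw [this, mul_zero]
  have hM' : ∑ k : S, ‖x 0 k‖ ^ 2 = M := by
    rw [hx0, hM]
    exact Finset.sum_coe_sort S (fun k => ‖y k‖ ^ 2)
  have hχ : ∀ t ∈ Set.Icc 0 T, χ (x t) = 1 := by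
    intro t ht
    apply χ.one_of_mem_closedBall
    rw [mem_closedBall_zero_iff, pi_norm_le_iff_of_nonneg (show (0:ℝ) ≤ M + 1 by linarith)]
    intro k
    have : ‖x t k‖ ^ 2 ≤ M := by
      rw [← hM', ← hmass t ht]
      exact Finset.single_le_sum (f := fun k => ‖x t k‖ ^ 2) (fun k _ => by positivity) (Finset.mem_univ k)
    nlinarith [norm_nonneg (x t k)]
  refine ⟨fun t => ext0 S (x t), ⟨fun t k hk => ?_, fun t ht k hk => ?_⟩, ?_⟩
  · unfold ext0; rw [dif_neg hk]
  · have h1 := (hasDerivAt_pi.1 (hx t ht)) ⟨k, hk⟩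
    have e : (fun τ => ext0 S (x τ) k) = fun τ => x τ ⟨k, hk⟩ := by
      ext τ; exact ext0_mem (x τ) ⟨k, hk⟩
    rw [e]
    refine h1.congr_deriv ?_
    simp only [hf, hχ t ht, one_smul, vf]
  · ext k
    simp only [hx0]
    by_cases hk : k ∈ S
    · exact ext0_mem (fun k : S => y k) ⟨k, hk⟩
    · unfold ext0; rw [dif_neg hk, hy k hk]
end

/-! Part O -/

noncomputable section
open ComplexConjugate

def Sn (n : ℕ) : Finset ℤ := (Finset.Icc (-(n : ℤ)) n).filter (fun k => Odd k)

lemma mem_Sn {n : ℕ} {k : ℤ} : k ∈ Sn n ↔ |k| ≤ n ∧ Odd k := by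
  unfold Sn; rw [Finset.mem_filter, Finset.mem_Icc, abs_le]

lemma Sn_odd {n : ℕ} : ∀ k ∈ Sn n, Odd k := fun k hk => (mem_Sn.1 hk).2

/-- time independent majorant of the nonlinearity -/
def cM (S : Finset ℤ) (b : ℤ → ℝ) (k : ℤ) : ℝ :=
  ∑ k1 ∈ S, ∑ k2 ∈ S, ∑ k3 ∈ S, if k1 + k3 = k2 + k then |(k3 : ℝ)| * b k1 * b k2 * b k3 else 0

lemma cM_nonneg {S : Finset ℤ} {b : ℤ → ℝ} (hb : ∀ k, 0 ≤ b k) (k : ℤ) : 0 ≤ cM S b k := by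
  unfold cM
  refine Finset.sum_nonneg fun k1 _ => Finset.sum_nonneg fun k2 _ => Finset.sum_nonneg fun k3 _ => ?_
  have := hb k1; have := hb k2; have := hb k3
  split_ifs <;> positivity

lemma Nl_le_cM {S : Finset ℤ} {b : ℤ → ℝ} (hb : ∀ k, 0 ≤ b k) {z : ℤ → ℂ} (hz : ∀ k, ‖z k‖ ≤ b k) (k : ℤ) : ‖Nl S z k‖ ≤ cM S b k := by
  unfold Nl cM
  refine (norm_sum_le _ _).trans (Finset.sum_le_sum fun k1 _ => (norm_sum_le _ _).trans (Finset.sum_le_sum fun k2 _ => (norm_sum_le _ _).trans (Finset.sum_le_sum fun k3 _ => ?_)))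
  split_ifs
  · rw [norm_mul, norm_mul, norm_mul, RCLike.norm_conj, Complex.norm_intCast]
    have := hz k1; have := hz k2; have := hz k3
    have := hb k1; have := hb k2; have := hb k3
    gcongr
  · simp

lemma sum_cM {S : Finset ℤ} (hS : ∀ k ∈ S, Odd k) {b : ℤ → ℝ} (hb : ∀ k, 0 ≤ b k) {β : ℝ} (hβ : ∑ k ∈ S, (k : ℝ) ^ 2 * b k ≤ β) :
    ∑ k ∈ S, |(k : ℝ)| * cM S b k ≤ 3 * β ^ 3 := by
  have hβ0 : 0 ≤ ∑ k ∈ S, (k : ℝ) ^ 2 * b k := Finset.sum_nonneg fun k _ => mul_nonneg (by positivity) (hb k)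
  have h1 : ∑ k ∈ S, |(k : ℝ)| * cM S b k = ∑ k1 ∈ S, ∑ k2 ∈ S, ∑ k3 ∈ S, ∑ k ∈ S, (if k1 + k3 = k2 + k then |(k : ℝ)| * (|(k3 : ℝ)| * b k1 * b k2 * b k3) else 0) := by
    unfold cM
    simp_rw [Finset.mul_sum, mul_ite, mul_zero]
    rw [Finset.sum_comm]
    refine Finset.sum_congr rfl fun a _ => ?_
    rw [Finset.sum_comm]
    refine Finset.sum_congr rfl fun b _ => ?_
    rw [Finset.sum_comm]
  rw [h1]
  have h2 : ∀ k1 ∈ S, ∀ k2 ∈ S, ∀ k3 ∈ S, ∑ k ∈ S, (if k1 + k3 = k2 + k then |(k : ℝ)| * (|(k3 : ℝ)| * b k1 * b k2 * b k3) else 0) ≤ 3 * (((k1:ℝ) ^ 2 * b k1) * (((k2:ℝ) ^ 2 * b k2) * ((k3:ℝ) ^ 2 * b k3))) := by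
    intro k1 m1 k2 m2 k3 m3
    have o1 := odd_abs_ge (hS _ m1)
    have o2 := odd_abs_ge (hS _ m2)
    have o3 := odd_abs_ge (hS _ m3)
    have hb1 := hb k1; have hb2 := hb k2; have hb3 := hb k3
    have hr : 0 ≤ 3 * (((k1:ℝ) ^ 2 * b k1) * (((k2:ℝ) ^ 2 * b k2) * ((k3:ℝ) ^ 2 * b k3))) := by positivity
    have : ∀ k ∈ S, (if k1 + k3 = k2 + k then |(k : ℝ)| * (|(k3 : ℝ)| * b k1 * b k2 * b k3) else 0) = if k = k1 + k3 - k2 then |((k1 + k3 - k2 : ℤ) : ℝ)| * (|(k3 : ℝ)| * b k1 * b k2 * b k3) else 0 := by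
      intro k _
      by_cases h : k = k1 + k3 - k2
      · rw [if_pos h, if_pos (by omega), h]
      · rw [if_neg h, if_neg (by omega)]
    rw [Finset.sum_congr rfl this, Finset.sum_ite_eq']
    split_ifs
    · have ha : |((k1 + k3 - k2 : ℤ) : ℝ)| ≤ |(k1:ℝ)| + |(k3:ℝ)| + |(k2:ℝ)| := by
        push_cast
        exact (abs_sub _ _).trans (by gcongr; exact abs_add_le _ _)
      have hb' : |(k1:ℝ)| + |(k3:ℝ)| + |(k2:ℝ)| ≤ 3 * (|(k1:ℝ)| ^ 2 * |(k2:ℝ)| ^ 2 * |(k3:ℝ)|) := by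
        have q1 : 1 ≤ |(k1:ℝ)| ^ 2 := one_le_pow₀ o1
        have q2 : 1 ≤ |(k2:ℝ)| ^ 2 := one_le_pow₀ o2
        have q1' : |(k1:ℝ)| ≤ |(k1:ℝ)| ^ 2 := by nlinarith
        have q2' : |(k2:ℝ)| ≤ |(k2:ℝ)| ^ 2 := by nlinarith
        have r0 : 1 ≤ |(k1:ℝ)| ^ 2 * |(k2:ℝ)| ^ 2 := one_le_mul_of_one_le_of_one_le q1 q2
        have r1 : |(k1:ℝ)| ^ 2 ≤ |(k1:ℝ)| ^ 2 * |(k2:ℝ)| ^ 2 := le_mul_of_one_le_right (by positivity) q2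
        have r2 : |(k2:ℝ)| ^ 2 ≤ |(k1:ℝ)| ^ 2 * |(k2:ℝ)| ^ 2 := le_mul_of_one_le_left (by positivity) q1
        have r3 : |(k1:ℝ)| ^ 2 * |(k2:ℝ)| ^ 2 ≤ |(k1:ℝ)| ^ 2 * |(k2:ℝ)| ^ 2 * |(k3:ℝ)| := le_mul_of_one_le_right (by positivity) o3
        have r4 : |(k3:ℝ)| ≤ |(k1:ℝ)| ^ 2 * |(k2:ℝ)| ^ 2 * |(k3:ℝ)| := le_mul_of_one_le_left (by positivity) r0
        linarith
      calc _ ≤ 3 * (|(k1:ℝ)| ^ 2 * |(k2:ℝ)| ^ 2 * |(k3:ℝ)|) * (|(k3 : ℝ)| * b k1 * b k2 * b k3) := by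
            gcongr; exact ha.trans hb'
        _ = 3 * ((|(k1:ℝ)| ^ 2 * b k1) * ((|(k2:ℝ)| ^ 2 * b k2) * (|(k3:ℝ)| ^ 2 * b k3))) := by ring
        _ = _ := by rw [sq_abs, sq_abs, sq_abs]
    · exact hr
  refine (Finset.sum_le_sum fun k1 m1 => Finset.sum_le_sum fun k2 m2 => Finset.sum_le_sum fun k3 m3 => h2 k1 m1 k2 m2 k3 m3).trans ?_
  simp_rw [← Finset.mul_sum, ← Finset.sum_mul]
  have : ∑ k ∈ S, (k : ℝ) ^ 2 * b k * (∑ k ∈ S, (k : ℝ) ^ 2 * b k * ∑ k ∈ S, (k : ℝ) ^ 2 * b k) = (∑ k ∈ S, (k : ℝ) ^ 2 * b k) ^ 3 := by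
    simp_rw [← Finset.sum_mul]; ring
  rw [show (∑ k ∈ S, (k : ℝ) ^ 2 * b k) * ((∑ k ∈ S, (k : ℝ) ^ 2 * b k) * ∑ k ∈ S, (k : ℝ) ^ 2 * b k) = (∑ k ∈ S, (k : ℝ) ^ 2 * b k) ^ 3 by ring]
  gcongr

lemma sum_tri_le {S : Finset ℤ} {f g h : ℤ → ℝ} (hf : ∀ k, 0 ≤ f k) (hg : ∀ k, 0 ≤ g k) (hh : ∀ k, 0 ≤ h k) (k : ℤ) :
    ∑ k1 ∈ S, ∑ k2 ∈ S, ∑ k3 ∈ S, (if k1 + k3 = k2 + k then f k1 * g k2 * h k3 else 0) ≤ (∑ k ∈ S, f k) * (∑ k ∈ S, g k) * (∑ k ∈ S, h k) := by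
  rw [Finset.sum_mul_sum, Finset.sum_mul]
  refine Finset.sum_le_sum fun k1 _ => ?_
  rw [Finset.sum_mul]
  refine Finset.sum_le_sum fun k2 _ => ?_
  rw [Finset.mul_sum]
  refine Finset.sum_le_sum fun k3 _ => ?_
  have := hf k1; have := hg k2; have := hh k3
  split_ifs
  · exact le_rfl
  · positivity

lemma Nl_diff {S : Finset ℤ} (hS : ∀ k ∈ S, Odd k) {b d : ℤ → ℝ} (hb : ∀ k, 0 ≤ b k) (hd : ∀ k, 0 ≤ d k) {z w : ℤ → ℂ} (hz : ∀ k, ‖z k‖ ≤ b k) (hw : ∀ k, ‖w k‖ ≤ b k)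
    (hdz : ∀ k ∈ S, ‖z k - w k‖ ≤ d k) {β L : ℝ} (hβ : ∑ k ∈ S, (k : ℝ) ^ 2 * b k ≤ β) (hL : ∑ k ∈ S, |(k : ℝ)| * d k ≤ L) (k : ℤ) :
    ‖Nl S z k - Nl S w k‖ ≤ 3 * β ^ 2 * L := by
  have hab : ∀ k : ℤ, 0 ≤ |(k:ℝ)| * b k := fun k => mul_nonneg (abs_nonneg _) (hb k)
  have had : ∀ k : ℤ, 0 ≤ |(k:ℝ)| * d k := fun k => mul_nonneg (abs_nonneg _) (hd k)
  have hb0 : ∑ k ∈ S, b k ≤ β := by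
    refine (Finset.sum_le_sum fun k hk => ?_).trans hβ
    have := odd_abs_ge (hS k hk)
    have h2 : 1 ≤ (k:ℝ) ^ 2 := by rw [← sq_abs]; exact one_le_pow₀ this
    exact le_mul_of_one_le_left (hb k) h2
  have hb1 : ∑ k ∈ S, |(k:ℝ)| * b k ≤ β := by
    refine (Finset.sum_le_sum fun k hk => ?_).trans hβ
    have := odd_abs_ge (hS k hk)
    have h2 : |(k:ℝ)| ≤ (k:ℝ) ^ 2 := by rw [← sq_abs]; nlinarith
    exact mul_le_mul_of_nonneg_right h2 (hb k)
  have hd0 : ∑ k ∈ S, d k ≤ L := by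
    refine (Finset.sum_le_sum fun k hk => ?_).trans hL
    exact le_mul_of_one_le_left (hd k) (odd_abs_ge (hS k hk))
  have n1 : 0 ≤ ∑ k ∈ S, b k := Finset.sum_nonneg fun k _ => hb k
  have n2 : 0 ≤ ∑ k ∈ S, d k := Finset.sum_nonneg fun k _ => hd k
  have n3 : 0 ≤ ∑ k ∈ S, |(k:ℝ)| * b k := Finset.sum_nonneg fun k _ => hab k
  have n4 : 0 ≤ ∑ k ∈ S, |(k:ℝ)| * d k := Finset.sum_nonneg fun k _ => had k
  have t1 := sum_tri_le (S := S) hd hb hab k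
  have t2 := sum_tri_le (S := S) hb hd hab k
  have t3 := sum_tri_le (S := S) hb hb had k
  have hβ0 : 0 ≤ β := n1.trans hb0
  have hL0 : 0 ≤ L := n2.trans hd0
  have u1 : (∑ k ∈ S, d k) * (∑ k ∈ S, b k) * (∑ k ∈ S, |(k:ℝ)| * b k) ≤ L * β * β := by gcongr
  have u2 : (∑ k ∈ S, b k) * (∑ k ∈ S, d k) * (∑ k ∈ S, |(k:ℝ)| * b k) ≤ β * L * β := by gcongr
  have u3 : (∑ k ∈ S, b k) * (∑ k ∈ S, b k) * (∑ k ∈ S, |(k:ℝ)| * d k) ≤ β * β * L := by gcongr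
  have key : ‖Nl S z k - Nl S w k‖ ≤ ∑ k1 ∈ S, ∑ k2 ∈ S, ∑ k3 ∈ S, ((if k1 + k3 = k2 + k then d k1 * b k2 * (|(k3:ℝ)| * b k3) else 0)
     + (if k1 + k3 = k2 + k then b k1 * d k2 * (|(k3:ℝ)| * b k3) else 0) + (if k1 + k3 = k2 + k then b k1 * b k2 * (|(k3:ℝ)| * d k3) else 0)) := by
    unfold Nl
    simp_rw [← Finset.sum_sub_distrib]
    refine (norm_sum_le _ _).trans (Finset.sum_le_sum fun k1 m1 => (norm_sum_le _ _).trans (Finset.sum_le_sum fun k2 m2 => (norm_sum_le _ _).trans (Finset.sum_le_sum fun k3 m3 => ?_)))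
    split_ifs
    · have e : (k3 : ℂ) * z k1 * conj (z k2) * z k3 - (k3 : ℂ) * w k1 * conj (w k2) * w k3 = 
        (k3 : ℂ) * ((z k1 - w k1) * conj (z k2) * z k3) + (k3 : ℂ) * (w k1 * conj (z k2 - w k2) * z k3) + (k3 : ℂ) * (w k1 * conj (w k2) * (z k3 - w k3)) := by
        rw [map_sub]; ring
      rw [e]
      refine (norm_add₃_le).trans ?_
      simp only [norm_mul, RCLike.norm_conj, Complex.norm_intCast]
      have g1 := hdz k1 m1; have g2 := hdz k2 m2; have g3 := hdz k3 m3
      have a1 := hz k1; have a2 := hz k2; have a3 := hz k3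
      have c1 := hw k1; have c2 := hw k2; have c3 := hw k3
      have v1 : |(k3:ℝ)| * (‖z k1 - w k1‖ * ‖z k2‖ * ‖z k3‖) ≤ |(k3:ℝ)| * (d k1 * b k2 * b k3) := by
        have := hd k1; have := hb k2; gcongr
      have v2 : |(k3:ℝ)| * (‖w k1‖ * ‖z k2 - w k2‖ * ‖z k3‖) ≤ |(k3:ℝ)| * (b k1 * d k2 * b k3) := by
        have := hb k1; have := hd k2; gcongr
      have v3 : |(k3:ℝ)| * (‖w k1‖ * ‖w k2‖ * ‖z k3 - w k3‖) ≤ |(k3:ℝ)| * (b k1 * b k2 * d k3) := by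
        have := hb k1; have := hb k2; gcongr
      linarith
    · simp
  simp only [Finset.sum_add_distrib] at key
  linarith
end

/-! Part P -/

noncomputable section
open ComplexConjugate Filter Topology

lemma taylor_bd {S : Finset ℤ} (hS : ∀ k ∈ S, Odd k) {lam : ℤ → ℝ} {Λ : ℝ} (hΛ0 : 0 ≤ Λ) (hΛ : ∀ k, Odd k → |lam k| ≤ Λ * |(k : ℝ)|) {T : ℝ}
    {z : ℝ → ℤ → ℂ} (H : GSol S lam (Set.Icc 0 T) z) {b : ℤ → ℝ} (hb : ∀ k, 0 ≤ b k) (hz : ∀ t ∈ Set.Icc 0 T, ∀ k, ‖z t k‖ ≤ b k)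
    {β : ℝ} (hβ : ∑ k ∈ S, (k : ℝ) ^ 2 * b k ≤ β) {k : ℤ} (hk : k ∈ S) {t t' : ℝ} (ht : t ∈ Set.Icc 0 T) (ht' : t' ∈ Set.Icc 0 T) :
    ‖z t' k - z t k - ((t' - t : ℝ) : ℂ) * (Complex.I * (lam k * z t k + Nl S (z t) k))‖ ≤ ((Λ + 3 * β ^ 2) * (Λ * β + 3 * β ^ 3)) * |t' - t| ^ 2 := by
  set ℓ : ℤ → ℝ := fun k => Λ * |(k:ℝ)| * b k + cM S b k with hℓ
  have hℓ0 : ∀ k, 0 ≤ ℓ k := fun k => add_nonneg (mul_nonneg (mul_nonneg hΛ0 (abs_nonneg _)) (hb k)) (cM_nonneg hb k)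
  set L := Λ * β + 3 * β ^ 3 with hL
  have hsum : ∑ k ∈ S, |(k:ℝ)| * ℓ k ≤ L := by
    have e : ∀ k ∈ S, |(k:ℝ)| * ℓ k = Λ * ((k:ℝ) ^ 2 * b k) + |(k:ℝ)| * cM S b k := by
      intro k _; simp only [hℓ]; rw [← sq_abs (k:ℝ)]; ring
    rw [Finset.sum_congr rfl e, Finset.sum_add_distrib, ← Finset.mul_sum]
    have := sum_cM hS hb hβ
    have := mul_le_mul_of_nonneg_left hβ hΛ0
    linarith
  have hβ0 : 0 ≤ β := (Finset.sum_nonneg fun k _ => mul_nonneg (by positivity) (hb k)).trans hβ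
  have hL0 : 0 ≤ L := by positivity
  have hF : ∀ τ ∈ Set.Icc 0 T, ∀ j ∈ S, ‖Complex.I * (lam j * z τ j + Nl S (z τ) j)‖ ≤ ℓ j := by
    intro τ hτ j hj
    rw [norm_mul, Complex.norm_I, one_mul]
    refine (norm_add_le _ _).trans (add_le_add ?_ (Nl_le_cM hb (hz τ hτ) j))
    rw [norm_mul, Complex.norm_real, Real.norm_eq_abs]
    have := hΛ j (hS j hj)
    have := hz τ hτ j
    gcongr
  have hlip : ∀ τ ∈ Set.Icc 0 T, ∀ j ∈ S, ‖z τ j - z t j‖ ≤ ℓ j * |τ - t| := by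
    intro τ hτ j hj
    have := (convex_Icc 0 T).norm_image_sub_le_of_norm_hasDerivWithin_le (f := fun τ => z τ j) 
      (f' := fun τ => Complex.I * (lam j * z τ j + Nl S (z τ) j)) (C := ℓ j) (fun x hx => (H.der x hx j hj).hasDerivWithinAt) (fun x hx => hF x hx j hj) ht hτ
    rw [Real.norm_eq_abs] at this
    exact this
  have hFl : ∀ τ ∈ Set.Icc 0 T, ‖Complex.I * (lam k * z τ k + Nl S (z τ) k) - Complex.I * (lam k * z t k + Nl S (z t) k)‖ ≤ ((Λ + 3 * β ^ 2) * L) * |τ - t| := by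
    intro τ hτ
    have e : Complex.I * (lam k * z τ k + Nl S (z τ) k) - Complex.I * (lam k * z t k + Nl S (z t) k) = Complex.I * (lam k * (z τ k - z t k) + (Nl S (z τ) k - Nl S (z t) k)) := by ring
    rw [e, norm_mul, Complex.norm_I, one_mul]
    refine (norm_add_le _ _).trans ?_
    have h1 : ‖(lam k : ℂ) * (z τ k - z t k)‖ ≤ Λ * L * |τ - t| := by
      rw [norm_mul, Complex.norm_real, Real.norm_eq_abs]
      have a1 := hΛ k (hS k hk)
      have a2 := hlip τ hτ k hk
      have a3 : |(k:ℝ)| * ℓ k ≤ L := (Finset.single_le_sum (f := fun k : ℤ => |(k:ℝ)| * ℓ k) (fun j _ => mul_nonneg (abs_nonneg _) (hℓ0 j)) hk).trans hsum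
      calc _ ≤ Λ * |(k:ℝ)| * (ℓ k * |τ - t|) := by gcongr
        _ = Λ * (|(k:ℝ)| * ℓ k) * |τ - t| := by ring
        _ ≤ _ := by gcongr
    have h2 := Nl_diff hS (d := fun j => ℓ j * |τ - t|) hb (fun j => mul_nonneg (hℓ0 j) (abs_nonneg _)) (hz τ hτ) (hz t ht) (fun j hj => hlip τ hτ j hj) hβ (L := L * |τ - t|) (by
      simp_rw [← mul_assoc]; rw [← Finset.sum_mul]; gcongr) k
    linarith
  have huI : Set.uIcc t t' ⊆ Set.Icc 0 T := (Set.uIcc_subset_Icc ht ht')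
  have hfin := (convex_uIcc t t').norm_image_sub_le_of_norm_hasDerivWithin_le (f := fun τ => z τ k - ((τ - t : ℝ) : ℂ) * (Complex.I * (lam k * z t k + Nl S (z t) k))) 
      (f' := fun τ => Complex.I * (lam k * z τ k + Nl S (z τ) k) - Complex.I * (lam k * z t k + Nl S (z t) k)) (C := ((Λ + 3 * β ^ 2) * L) * |t' - t|) (by
        intro x hx
        have h1 := H.der x (huI hx) k hk
        have h2 : HasDerivAt (fun τ : ℝ => ((τ - t : ℝ) : ℂ)) 1 x := by
          have := ((hasDerivAt_id x).sub_const t).ofReal_comp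
          simpa using this
        have h3 := h1.sub (h2.mul_const (Complex.I * (lam k * z t k + Nl S (z t) k)))
        rw [one_mul] at h3
        exact h3.hasDerivWithinAt) (by
        intro x hx
        refine (hFl x (huI hx)).trans ?_
        have : |x - t| ≤ |t' - t| := Set.abs_sub_left_of_mem_uIcc hx
        gcongr) Set.left_mem_uIcc Set.right_mem_uIcc
  rw [Real.norm_eq_abs] at hfin
  have e : z t' k - z t k - ((t' - t : ℝ) : ℂ) * (Complex.I * (lam k * z t k + Nl S (z t) k)) = 
    (z t' k - ((t' - t : ℝ) : ℂ) * (Complex.I * (lam k * z t k + Nl S (z t) k))) - (z t k - ((t - t : ℝ) : ℂ) * (Complex.I * (lam k * z t k + Nl S (z t) k))) := by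
    rw [sub_self t]; push_cast; ring
  rw [e]
  refine hfin.trans (le_of_eq ?_)
  ring

lemma deriv_of_taylor {f : ℝ → ℂ} {f' : ℂ} {J : Set ℝ} {t C : ℝ} (h : ∀ t' ∈ J, ‖f t' - f t - ((t' - t : ℝ) : ℂ) * f'‖ ≤ C * |t' - t| ^ 2) : HasDerivWithinAt f f' J t := by
  rw [hasDerivWithinAt_iff_isLittleO]
  have h1 : (fun x' => f x' - f t - (x' - t) • f') =O[𝓝[J] t] fun x' => (x' - t) ^ 2 := by
    refine Asymptotics.IsBigO.of_bound C ?_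
    filter_upwards [self_mem_nhdsWithin] with x hx
    have := h x hx
    rw [Complex.real_smul, norm_pow, Real.norm_eq_abs]
    exact this
  refine h1.trans_isLittleO ?_
  have h2 : (fun x' : ℝ => (x' - t) ^ 2) =o[𝓝 t] fun x' => x' - t := by
    have h3 : Tendsto (fun x' : ℝ => x' - t) (𝓝 t) (𝓝 0) := by
      have : Continuous (fun x' : ℝ => x' - t) := by fun_prop
      simpa using this.tendsto t
    have := (Asymptotics.isLittleO_one_iff ℝ).2 h3
    have h4 := this.mul_isBigO (Asymptotics.isBigO_refl (fun x' : ℝ => x' - t) (𝓝 t))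
    simpa [sq] using h4
  exact h2.mono nhdsWithin_le_nhds

lemma Nl_cubic {S : Finset ℤ} {z : ℤ → ℂ} (hz : ∀ k, k ∉ S → z k = 0) (k : ℤ) : Nl S z k = cubicSum z k := by
  unfold cubicSum
  have e : ∑' p : {p : ℤ × ℤ × ℤ // p.1 - p.2.1 + p.2.2 = k}, (p.1.2.2 : ℂ) * z p.1.1 * conj (z p.1.2.1) * z p.1.2.2 = 
     ∑' p : ℤ × ℤ × ℤ, Set.indicator {p : ℤ × ℤ × ℤ | p.1 - p.2.1 + p.2.2 = k} (fun p => (p.2.2 : ℂ) * z p.1 * conj (z p.2.1) * z p.2.2) p := 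
    tsum_subtype {p : ℤ × ℤ × ℤ | p.1 - p.2.1 + p.2.2 = k} (fun p => (p.2.2 : ℂ) * z p.1 * conj (z p.2.1) * z p.2.2)
  rw [e, tsum_eq_sum (s := S ×ˢ S ×ˢ S)]
  · unfold Nl
    rw [Finset.sum_product]
    refine Finset.sum_congr rfl fun a _ => ?_
    rw [Finset.sum_product]
    refine Finset.sum_congr rfl fun b _ => ?_
    refine Finset.sum_congr rfl fun c _ => ?_
    rw [Set.indicator_apply]
    simp only [Set.mem_setOf_eq]
    by_cases h : a + c = b + k
    · rw [if_pos h, if_pos (by omega)]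
    · rw [if_neg h, if_neg (by omega)]
  · intro p hp
    rw [Set.indicator_apply_eq_zero]
    intro _
    simp only [Finset.mem_product, not_and_or] at hp
    rcases hp with h | h | h <;> rw [hz _ h] <;> simp

lemma cub_summable {b : ℤ → ℝ} (hb : ∀ k, 0 ≤ b k) (hb0 : Summable b) (hb1 : Summable fun k : ℤ => |(k:ℝ)| * b k) (k : ℤ) :
    Summable fun p : {p : ℤ × ℤ × ℤ // p.1 - p.2.1 + p.2.2 = k} => |(p.1.2.2 : ℝ)| * b p.1.1 * b p.1.2.1 * b p.1.2.2 := by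
  have h1 := hb0.mul_of_nonneg hb1 (fun k => hb k) (fun k => mul_nonneg (abs_nonneg _) (hb k))
  have h2 := hb0.mul_of_nonneg h1 (fun k => hb k) (fun p => mul_nonneg (hb _) (mul_nonneg (abs_nonneg _) (hb _)))
  have h3 := h2.comp_injective (i := fun p : {p : ℤ × ℤ × ℤ // p.1 - p.2.1 + p.2.2 = k} => p.1) Subtype.val_injective
  refine h3.congr fun p => ?_
  simp only [Function.comp]; ring

theorem limit_pass {T : ℝ} {lam : ℤ → ℝ} {Λ : ℝ} (hΛ0 : 0 ≤ Λ) (hΛ : ∀ k, Odd k → |lam k| ≤ Λ * |(k : ℝ)|)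
    {b : ℤ → ℝ} (hb : ∀ k, 0 ≤ b k) (hb0 : Summable b) (hb2 : Summable fun k : ℤ => (k:ℝ) ^ 2 * b k) {z : ℕ → ℝ → ℤ → ℂ} {n0 : ℕ}
    (H : ∀ n, n0 ≤ n → GSol (Sn n) lam (Set.Icc 0 T) (z n)) (hz : ∀ n, n0 ≤ n → ∀ t ∈ Set.Icc 0 T, ∀ k, ‖z n t k‖ ≤ b k) :
    ∃ (Z : ℝ → ℤ → ℂ) (U : Filter ℕ), U.NeBot ∧ U ≤ atTop ∧ (∀ t ∈ Set.Icc 0 T, ∀ k, Tendsto (fun n => z n t k) U (𝓝 (Z t k)))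
      ∧ ∀ t ∈ Set.Icc 0 T, ∀ k, CubicSummable (Z t) k ∧ HasDerivWithinAt (fun τ => Z τ k) (Complex.I * (lam k * Z t k + cubicSum (Z t) k)) (Set.Icc 0 T) t := by
  have hb1 : Summable fun k : ℤ => |(k:ℝ)| * b k := by
    refine hb2.of_nonneg_of_le (fun k => mul_nonneg (abs_nonneg _) (hb k)) fun k => mul_le_mul_of_nonneg_right ?_ (hb k)
    have : |k| ≤ k ^ 2 := by
      rw [← sq_abs]; nlinarith [abs_nonneg k, Int.natAbs_mul_self' k, Int.le_self_sq |k|]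
    exact_mod_cast this
  set U : Filter ℕ := (hyperfilter ℕ : Filter ℕ) with hU
  have hUat : U ≤ atTop := by rw [← Nat.cofinite_eq_atTop]; exact hyperfilter_le_cofinite
  have hev : ∀ᶠ n in U, n0 ≤ n := hUat (eventually_ge_atTop n0)
  have hex : ∀ t k, ∃ w : ℂ, t ∈ Set.Icc 0 T → Tendsto (fun n => z n t k) U (𝓝 w) := by
    intro t k
    by_cases ht : t ∈ Set.Icc 0 T
    · have hc : IsCompact (Metric.closedBall (0:ℂ) (b k)) := isCompact_closedBall _ _
      have := hc.ultrafilter_le_nhds ((hyperfilter ℕ).map (fun n => z n t k)) (by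
        rw [le_principal_iff]
        show ∀ᶠ n in U, z n t k ∈ Metric.closedBall (0:ℂ) (b k)
        filter_upwards [hev] with n hn
        rw [mem_closedBall_zero_iff]; exact hz n hn t ht k)
      obtain ⟨w, _, hw⟩ := this
      exact ⟨w, fun _ => hw⟩
    · exact ⟨0, fun h => absurd h ht⟩
  choose Z hZ using hex
  have hZb : ∀ t ∈ Set.Icc 0 T, ∀ k, ‖Z t k‖ ≤ b k := fun t ht k =>
    le_of_tendsto (hZ t k ht).norm (by filter_upwards [hev] with n hn; exact hz n hn t ht k)
  have hZe : ∀ t ∈ Set.Icc 0 T, ∀ k, ¬ Odd k → Z t k = 0 := by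
    intro t ht k hk
    refine tendsto_nhds_unique (hZ t k ht) ?_
    refine tendsto_const_nhds.congr' ?_
    filter_upwards [hev] with n hn
    exact ((H n hn).supp t k (fun h => hk (Sn_odd k h))).symm
  have hN : ∀ t ∈ Set.Icc 0 T, ∀ k, Tendsto (fun n => Nl (Sn n) (z n t) k) U (𝓝 (cubicSum (Z t) k)) := by
    intro t ht k
    have h1 : Tendsto (fun n => cubicSum (z n t) k) U (𝓝 (cubicSum (Z t) k)) := by
      unfold cubicSum
      refine tendsto_tsum_of_dominated_convergence (cub_summable hb hb0 hb1 k) (fun p => ?_) ?_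
      · refine ((tendsto_const_nhds.mul (hZ t _ ht)).mul ?_).mul (hZ t _ ht)
        exact (Complex.continuous_conj.tendsto _).comp (hZ t _ ht)
      · filter_upwards [hev] with n hn p
        rw [norm_mul, norm_mul, norm_mul, RCLike.norm_conj, Complex.norm_intCast]
        have hb1' := hb p.1.1
        have hb2' := hb p.1.2.1
        have hb3' := hb p.1.2.2
        have a1 := hz n hn t ht p.1.1
        have a2 := hz n hn t ht p.1.2.1
        have a3 := hz n hn t ht p.1.2.2
        rw [← Int.cast_abs]
        exact mul_le_mul (mul_le_mul (mul_le_mul_of_nonneg_left a1 (by positivity)) a2 (norm_nonneg _) (by positivity)) a3 (norm_nonneg _) (by positivity)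
    refine h1.congr' ?_
    filter_upwards [hev] with n hn
    exact (Nl_cubic ((H n hn).supp t) k).symm
  refine ⟨Z, U, inferInstance, hUat, fun t ht k => hZ t k ht, fun t ht k => ⟨?_, ?_⟩⟩
  · refine (cub_summable hb hb0 hb1 k).of_nonneg_of_le (fun p => by positivity) fun p => ?_
    have hb1' := hb p.1.1
    have hb2' := hb p.1.2.1
    have hb3' := hb p.1.2.2
    have a1 := hZb t ht p.1.1
    have a2 := hZb t ht p.1.2.1
    have a3 := hZb t ht p.1.2.2
    exact mul_le_mul (mul_le_mul (mul_le_mul_of_nonneg_left a1 (by positivity)) a2 (norm_nonneg _) (by positivity)) a3 (norm_nonneg _) (by positivity)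
  · by_cases hk : Odd k
    · set β := ∑' k : ℤ, (k:ℝ) ^ 2 * b k with hβ
      refine deriv_of_taylor (C := ((Λ + 3 * β ^ 2) * (Λ * β + 3 * β ^ 3))) fun t' ht' => ?_
      have hlim : Tendsto (fun n => ‖z n t' k - z n t k - ((t' - t : ℝ) : ℂ) * (Complex.I * (lam k * z n t k + Nl (Sn n) (z n t) k))‖) U 
         (𝓝 ‖Z t' k - Z t k - ((t' - t : ℝ) : ℂ) * (Complex.I * (lam k * Z t k + cubicSum (Z t) k))‖) := by
        refine (((hZ t' k ht').sub (hZ t k ht)).sub (tendsto_const_nhds.mul (tendsto_const_nhds.mul ?_))).norm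
        exact (tendsto_const_nhds.mul (hZ t k ht)).add (hN t ht k)
      refine le_of_tendsto hlim ?_
      filter_upwards [hev, hUat (eventually_ge_atTop k.natAbs)] with n hn hnk
      refine taylor_bd Sn_odd hΛ0 hΛ (H n hn) hb (hz n hn) ?_ (mem_Sn.2 ⟨by rw [Int.abs_eq_natAbs]; exact_mod_cast hnk, hk⟩) ht ht'
      exact hb2.sum_le_tsum _ (fun k _ => mul_nonneg (by positivity) (hb k))
    · have h0 : cubicSum (Z t) k = 0 := by
        unfold cubicSum
        rw [← tsum_zero (β := {p : ℤ × ℤ × ℤ // p.1 - p.2.1 + p.2.2 = k})]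
        refine tsum_congr fun p => ?_
        by_cases o1 : Odd p.1.1
        · by_cases o2 : Odd p.1.2.1
          · by_cases o3 : Odd p.1.2.2
            · exfalso; apply hk; rw [← p.2]; exact (o1.sub_odd o2).add_odd o3
            · rw [hZe t ht _ o3]; simp
          · rw [hZe t ht _ o2]; simp
        · rw [hZe t ht _ o1]; simp
      rw [h0, hZe t ht k hk]
      simp only [mul_zero, add_zero]
      refine (hasDerivWithinAt_const t (Set.Icc 0 T) (0:ℂ)).congr (fun x hx => hZe x hx k hk) (hZe t ht k hk)
end

/-! Part Q -/

noncomputable section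
open ComplexConjugate Filter Topology

lemma wt_p (s : ℝ) {m : ℤ} (hm : m ≠ 0) : wt (2 * s + 4) m = wt s m ^ 2 * (m : ℝ) ^ 4 := by
  have h0 : 0 < |(m : ℝ)| := abs_pos.2 (by exact_mod_cast hm)
  unfold wt
  rw [Real.rpow_add h0, show (4 : ℝ) = (4 : ℕ) by norm_num, Real.rpow_natCast, Even.pow_abs (by decide), ← Real.rpow_natCast (|(m:ℝ)| ^ s), ← Real.rpow_mul h0.le]
  congr 2
  push_cast; ring

lemma Bd_term {s D : ℝ} (hs : 0 ≤ s) {n : ℕ} (hn : 2 ≤ n) {m c : ℤ} (hm : Odd m) (hc : |c| ≤ 2) (hmn : (n : ℤ) - 1 ≤ |m|)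
    {x : ℝ} (hx0 : 0 ≤ x) (hx : wt (2 * s + 4) m * x ≤ D) :
    wt s m * wt s (m + c) * 64 * x ≤ 64 * 3 ^ s * D / ((n : ℝ) - 1) ^ 2 * (1 / (m : ℝ) ^ 2) := by
  have hm0 : m ≠ 0 := by rintro rfl; simp at hm
  have hmR : (m : ℝ) ≠ 0 := by exact_mod_cast hm0
  have hn1 : (1 : ℝ) ≤ (n : ℝ) - 1 := by
    have : (2 : ℝ) ≤ n := by exact_mod_cast hn
    linarith
  have hmn' : (n : ℝ) - 1 ≤ |(m : ℝ)| := by exact_mod_cast hmn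
  have h2 : ((n : ℝ) - 1) ^ 2 ≤ (m : ℝ) ^ 2 := by rw [← sq_abs (m : ℝ)]; gcongr
  have hw := wt_shift hs hm c hc
  have h3 := wt_nonneg s m
  rw [wt_p s hm0] at hx
  have hm2 : 0 < (m : ℝ) ^ 2 := by positivity
  have hq : wt s m ^ 2 * x * (((n : ℝ) - 1) ^ 2 * (m : ℝ) ^ 2) ≤ D := by
    refine le_trans ?_ hx
    have : ((n : ℝ) - 1) ^ 2 * (m : ℝ) ^ 2 ≤ (m : ℝ) ^ 4 := by nlinarith
    calc wt s m ^ 2 * x * (((n : ℝ) - 1) ^ 2 * (m : ℝ) ^ 2) ≤ wt s m ^ 2 * x * (m : ℝ) ^ 4 := mul_le_mul_of_nonneg_left this (by positivity)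
      _ = _ := by ring
  calc wt s m * wt s (m + c) * 64 * x ≤ wt s m * (3 ^ s * wt s m) * 64 * x := by gcongr
    _ = 64 * 3 ^ s * (wt s m ^ 2 * x) := by ring
    _ ≤ 64 * 3 ^ s * (D / (((n : ℝ) - 1) ^ 2 * (m : ℝ) ^ 2)) := by
        refine mul_le_mul_of_nonneg_left ?_ (by positivity)
        rw [le_div_iff₀ (by positivity)]; exact hq
    _ = _ := by field_simp

lemma Bd_bound {s D : ℝ} (hs : 0 ≤ s) {n : ℕ} (hn : 2 ≤ n) {z : ℤ → ℂ} (hD0 : 0 ≤ D) (hD : ∀ k ∈ Sn n, wt (2 * s + 4) k * ‖z k‖ ≤ D)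
    (hW : W1 (Sn n) z ≤ 4) : ‖Bd (Sn n) 2 (a2 s) z‖ ≤ 2 * (64 * 3 ^ s * D / ((n : ℝ) - 1) ^ 2 * cZ) := by
  have hN : ∀ k, ‖Nl (Sn n) z k‖ ≤ 64 := fun k => (Nl_bound Sn_odd z k).trans (by
    have := pow_le_pow_left₀ (W1_nonneg (Sn n) z) hW 3
    linarith)
  have hA0 : 0 ≤ 64 * 3 ^ s * D / ((n : ℝ) - 1) ^ 2 := by positivity
  have key : ∀ f : ℤ → ℂ, (∀ k ∈ Sn n, ‖f k‖ ≤ 64 * 3 ^ s * D / ((n : ℝ) - 1) ^ 2 * (1 / (k : ℝ) ^ 2)) → ‖∑ k ∈ Sn n, f k‖ ≤ 64 * 3 ^ s * D / ((n : ℝ) - 1) ^ 2 * cZ := by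
    intro f hf
    refine (norm_sum_le_of_le _ hf).trans ?_
    rw [← Finset.mul_sum]
    exact mul_le_mul_of_nonneg_left (cZ_le _) hA0
  unfold Bd
  rw [two_mul]
  refine (norm_sub_le _ _).trans (add_le_add (key _ ?_) (key _ ?_))
  · intro m hm
    have hm' := mem_Sn.1 hm
    split_ifs with h
    · rw [norm_zero]; positivity
    · have hb : (n : ℤ) - 1 ≤ |m| := by
        by_contra hcon
        apply h
        rw [mem_Sn]
        refine ⟨?_, hm'.2.sub_even (by decide)⟩
        push Not at hcon
        rw [abs_lt] at hcon
        rw [abs_le]; omega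
      have := Bd_term hs hn hm'.2 (c := -2) (by decide) hb (norm_nonneg (z m)) (hD m hm)
      refine le_trans ?_ this
      rw [norm_mul, norm_mul, RCLike.norm_conj, Complex.norm_real]
      have ha : ‖a2 s (m - 2)‖ = wt s m * wt s (m + -2) := by
        unfold a2
        rw [Real.norm_of_nonneg (mul_nonneg (wt_nonneg _ _) (wt_nonneg _ _)), sub_add_cancel, mul_comm]; rfl
      rw [ha]
      have := mul_nonneg (wt_nonneg s m) (wt_nonneg s (m + -2))
      have := hN (m - 2)
      gcongr
  · intro m hm
    have hm' := mem_Sn.1 hm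
    split_ifs with h
    · rw [norm_zero]; positivity
    · have hb : (n : ℤ) - 1 ≤ |m| := by
        by_contra hcon
        apply h
        rw [mem_Sn]
        refine ⟨?_, hm'.2.add_even (by decide)⟩
        push Not at hcon
        rw [abs_lt] at hcon
        rw [abs_le]; omega
      have := Bd_term hs hn hm'.2 (c := 2) (by decide) hb (norm_nonneg (z m)) (hD m hm)
      refine le_trans ?_ this
      rw [norm_mul, norm_mul, RCLike.norm_conj, Complex.norm_real]
      have ha : ‖a2 s m‖ = wt s m * wt s (m + 2) := by
        unfold a2
        rw [Real.norm_of_nonneg (mul_nonneg (wt_nonneg _ _) (wt_nonneg _ _))]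
      rw [ha]
      have h5 := mul_nonneg (wt_nonneg s m) (wt_nonneg s (m + 2))
      have h6 := hN (m + 2)
      calc wt s m * wt s (m + 2) * ‖z m‖ * ‖Nl (Sn n) z (m + 2)‖ ≤ wt s m * wt s (m + 2) * ‖z m‖ * 64 := by
            exact mul_le_mul_of_nonneg_left h6 (by positivity)
        _ = _ := by ring

/-- pointwise decay from the energy -/
lemma decay {S : Finset ℤ} {p B : ℝ} {z : ℤ → ℂ} (h : Ys S (fun k => wt p k ^ 2) z ≤ B) {k : ℤ} (hk : k ∈ S) :
    wt p k * ‖z k‖ ≤ Real.sqrt B := by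
  apply Real.le_sqrt_of_sq_le
  rw [mul_pow]
  refine le_trans ?_ h
  unfold Ys
  exact Finset.single_le_sum (f := fun k => wt p k ^ 2 * ‖z k‖ ^ 2) (fun k _ => by positivity) hk

def bdec (D p : ℝ) (k : ℤ) : ℝ := D * (max 1 |(k : ℝ)|) ^ (-p)

lemma bdec_nonneg {D p : ℝ} (hD : 0 ≤ D) (k : ℤ) : 0 ≤ bdec D p k := by unfold bdec; positivity

lemma bdec_of {D p : ℝ} (hD : 0 ≤ D) {n : ℕ} {z : ℤ → ℂ} (hz : ∀ k ∉ Sn n, z k = 0) (h : ∀ k ∈ Sn n, wt p k * ‖z k‖ ≤ D) (k : ℤ) :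
    ‖z k‖ ≤ bdec D p k := by
  by_cases hk : k ∈ Sn n
  · have h1 := odd_abs_ge (Sn_odd k hk)
    have := h k hk
    unfold bdec
    rw [max_eq_right h1, Real.rpow_neg (by positivity), ← div_eq_mul_inv, le_div_iff₀ (by positivity), mul_comm]
    exact this
  · rw [hz k hk, norm_zero]; exact bdec_nonneg hD k

lemma summ_max {q : ℝ} (hq : q ≤ -2) : Summable fun k : ℤ => (max 1 |(k : ℝ)|) ^ q := by
  have h2 : Summable fun k : ℤ => 1 / (k : ℝ) ^ 2 := Real.summable_one_div_int_pow.mpr (by norm_num)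
  refine (h2.add (summable_of_ne_finset_zero (f := fun k : ℤ => if k = 0 then (1:ℝ) else 0) (s := {0}) (by intro b hb; simpa using hb))).of_nonneg_of_le (fun k => by positivity) fun k => ?_
  by_cases hk : k = 0
  · subst hk; simp
  · have h1 : (1 : ℝ) ≤ |(k : ℝ)| := by exact_mod_cast Int.one_le_abs hk
    rw [if_neg hk, add_zero, max_eq_right h1]
    refine (Real.rpow_le_rpow_of_exponent_le h1 hq).trans ?_
    rw [Real.rpow_neg (by positivity), one_div]
    simp

lemma bdec_sum {D p q : ℝ} (hD : 0 ≤ D) (h : q - p ≤ -2) : Summable fun k : ℤ => (max 1 |(k : ℝ)|) ^ q * bdec D p k := by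
  refine ((summ_max h).mul_left D).congr fun k => ?_
  unfold bdec
  rw [sub_eq_add_neg, Real.rpow_add (by positivity)]; ring

lemma bdec_sum2 {D p q : ℝ} (hD : 0 ≤ D) (h : q - 2 * p ≤ -2) : Summable fun k : ℤ => (max 1 |(k : ℝ)|) ^ q * bdec D p k ^ 2 := by
  refine ((summ_max h).mul_left (D ^ 2)).congr fun k => ?_
  unfold bdec
  rw [show q - 2 * p = q + -p + -p by ring, Real.rpow_add (by positivity), Real.rpow_add (by positivity)]; ring
end

/-! Part R -/

noncomputable section
open ComplexConjugate Filter Topology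

lemma sobWeight_odd (σ : ℝ) {k : ℤ} (hk : Odd k) : sobWeight σ k = wt σ k ^ 2 := by
  have h1 := odd_abs_ge hk
  unfold sobWeight wt
  rw [max_eq_right h1, mul_comm, Real.rpow_mul (by positivity)]
  norm_cast

lemma sob_Ys (σ : ℝ) {n : ℕ} {z : ℤ → ℂ} (hz : ∀ k ∉ Sn n, z k = 0) : sobNormSq σ z = Ys (Sn n) (fun k => wt σ k ^ 2) z := by
  unfold sobNormSq Ys
  rw [tsum_eq_sum (s := Sn n)]
  · exact Finset.sum_congr rfl fun k hk => by rw [sobWeight_odd σ (Sn_odd k hk)]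
  · intro k hk; rw [hz k hk]; simp

lemma sob_lim {U : Filter ℕ} [U.NeBot] {z : ℕ → ℤ → ℂ} {Z : ℤ → ℂ} {D p σ : ℝ} (hD : 0 ≤ D) (hp : 2 * σ - 2 * p ≤ -2)
    (hz : ∀ᶠ n in U, ∀ k, ‖z n k‖ ≤ bdec D p k) (hZ : ∀ k, Tendsto (fun n => z n k) U (𝓝 (Z k))) :
    HasSobNorm σ Z ∧ Tendsto (fun n => sobNormSq σ (z n)) U (𝓝 (sobNormSq σ Z)) := by
  have hs := bdec_sum2 hD hp
  have hZb : ∀ k, ‖Z k‖ ≤ bdec D p k := fun k =>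
    le_of_tendsto (hZ k).norm (by filter_upwards [hz] with n hn using hn k)
  constructor
  · unfold HasSobNorm
    refine hs.of_nonneg_of_le (fun k => by unfold sobWeight; positivity) fun k => ?_
    unfold sobWeight
    have := hZb k
    gcongr
  · unfold sobNormSq
    refine tendsto_tsum_of_dominated_convergence hs (fun k => ?_) ?_
    · exact tendsto_const_nhds.mul ((hZ k).norm.pow 2)
    · filter_upwards [hz] with n hn k
      have h0 : 0 ≤ sobWeight σ k := by unfold sobWeight; positivity
      rw [Real.norm_of_nonneg (by positivity)]
      have := hn k
      unfold sobWeight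
      gcongr

def phs (ε t : ℝ) (k : ℤ) : ℂ := Complex.exp (((-t + k * ε ^ 2 * t : ℝ) : ℂ) * Complex.I)

lemma phs_norm (ε t : ℝ) (k : ℤ) : ‖phs ε t k‖ = 1 := Complex.norm_exp_ofReal_mul_I _

lemma phs_mul (ε t : ℝ) {k k1 k2 k3 : ℤ} (h : k1 - k2 + k3 = k) : phs ε t k1 * conj (phs ε t k2) * phs ε t k3 = phs ε t k := by
  unfold phs
  rw [← Complex.exp_conj, map_mul, Complex.conj_I, Complex.conj_ofReal, ← Complex.exp_add, ← Complex.exp_add, ← h]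
  congr 1
  push_cast; ring

def ured (ε : ℝ) (Z : ℝ → ℤ → ℂ) (t : ℝ) (k : ℤ) : ℂ := ε * phs ε t k * Z (ε ^ 2 * t) k

lemma ured_norm {ε : ℝ} (hε : 0 < ε) (Z : ℝ → ℤ → ℂ) (t : ℝ) (k : ℤ) : ‖ured ε Z t k‖ = ε * ‖Z (ε ^ 2 * t) k‖ := by
  unfold ured
  rw [norm_mul, norm_mul, phs_norm, Complex.norm_real, Real.norm_of_nonneg hε.le, mul_one]

lemma ured_sob {ε : ℝ} (hε : 0 < ε) (Z : ℝ → ℤ → ℂ) (t σ : ℝ) : sobNormSq σ (ured ε Z t) = ε ^ 2 * sobNormSq σ (Z (ε ^ 2 * t)) := by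
  unfold sobNormSq
  rw [← tsum_mul_left]
  refine tsum_congr fun k => ?_
  rw [ured_norm hε]; ring

lemma ured_has {ε : ℝ} (hε : 0 < ε) (Z : ℝ → ℤ → ℂ) (t σ : ℝ) (h : HasSobNorm σ (Z (ε ^ 2 * t))) : HasSobNorm σ (ured ε Z t) := by
  unfold HasSobNorm at *
  refine (h.mul_left (ε ^ 2)).congr fun k => ?_
  rw [ured_norm hε]; ring

lemma ured_cub (ε : ℝ) (Z : ℝ → ℤ → ℂ) (t : ℝ) (k : ℤ) :
    cubicSum (ured ε Z t) k = ε ^ 3 * phs ε t k * cubicSum (Z (ε ^ 2 * t)) k := by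
  unfold cubicSum
  rw [← tsum_mul_left]
  refine tsum_congr fun p => ?_
  rw [← phs_mul ε t p.2]
  unfold ured
  rw [map_mul, map_mul, Complex.conj_ofReal]
  ring

lemma ured_cubs {ε : ℝ} (hε : 0 < ε) (Z : ℝ → ℤ → ℂ) (t : ℝ) (k : ℤ) (h : CubicSummable (Z (ε ^ 2 * t)) k) :
    CubicSummable (ured ε Z t) k := by
  unfold CubicSummable at *
  refine (h.mul_left (ε ^ 3)).congr fun k => ?_
  simp only [ured_norm hε]; ring

theorem ured_sol {α ε τ : ℝ} (hε : 0 < ε) {Z : ℝ → ℤ → ℂ}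
    (H : ∀ t ∈ Set.Icc 0 τ, ∀ k, CubicSummable (Z t) k ∧ HasDerivWithinAt (fun x => Z x k) (Complex.I * (lamE α ε k * Z t k + cubicSum (Z t) k)) (Set.Icc 0 τ) t) :
    IsFourierSolution α (Set.Icc 0 (τ / ε ^ 2)) (ured ε Z) := by
  have he2 : 0 < ε ^ 2 := by positivity
  have hmap : Set.MapsTo (fun t => ε ^ 2 * t) (Set.Icc 0 (τ / ε ^ 2)) (Set.Icc 0 τ) := by
    intro t ht
    refine ⟨mul_nonneg he2.le ht.1, ?_⟩
    have := ht.2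
    rw [le_div_iff₀ he2] at this
    show ε ^ 2 * t ≤ τ
    linarith
  intro k t ht
  obtain ⟨h1, h2⟩ := H _ (hmap ht) k
  refine ⟨ured_cubs hε Z t k h1, ?_⟩
  have hd1 : HasDerivWithinAt (fun t => ε ^ 2 * t) (ε ^ 2) (Set.Icc 0 (τ / ε ^ 2)) t := by
    simpa using ((hasDerivAt_id t).const_mul (ε ^ 2)).hasDerivWithinAt
  have hd2 := HasDerivWithinAt.scomp t h2 hd1 hmap
  have hd3 : HasDerivAt (fun t : ℝ => (-t + k * ε ^ 2 * t : ℝ)) (-1 + k * ε ^ 2) t := by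
    have := ((hasDerivAt_id t).neg).add ((hasDerivAt_id t).const_mul ((k:ℝ) * ε ^ 2))
    exact this.congr_deriv (by simp)
  have hd4 : HasDerivAt (fun t => (ε : ℂ) * phs ε t k) (ε * (phs ε t k * (((-1 + k * ε ^ 2 : ℝ) : ℂ) * Complex.I))) t :=
    ((hd3.ofReal_comp.mul_const Complex.I).cexp).const_mul _
  have hd5 := hd4.hasDerivWithinAt (s := Set.Icc 0 (τ / ε ^ 2)).mul hd2
  refine (hd5.congr_deriv ?_)
  rw [ured_cub]
  unfold ured lamE
  simp only [Function.comp, Complex.real_smul]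
  have hec : (ε : ℂ) ≠ 0 := by exact_mod_cast hε.ne'
  push_cast
  field_simp
  ring
end

/-! Part S -/

noncomputable section
open ComplexConjugate Filter Topology

lemma small_sqrt (c : ℝ) {d : ℝ} (hd : 0 < d) : ∀ᶠ ε in 𝓝[>] (0 : ℝ), c * Real.sqrt ε ≤ d := by
  have h : Tendsto (fun ε : ℝ => c * Real.sqrt ε) (𝓝[>] 0) (𝓝 (c * Real.sqrt 0)) :=
    ((continuous_const.mul Real.continuous_sqrt).tendsto 0).mono_left nhdsWithin_le_nhds
  rw [Real.sqrt_zero, mul_zero] at h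
  exact (h.eventually (gt_mem_nhds hd)).mono fun _ h => h.le

lemma small_lin (c : ℝ) {d : ℝ} (hd : 0 < d) : ∀ᶠ ε in 𝓝[>] (0 : ℝ), c * ε ≤ d := by
  have h : Tendsto (fun ε : ℝ => c * ε) (𝓝[>] 0) (𝓝 (c * 0)) :=
    ((continuous_const.mul continuous_id).tendsto 0).mono_left nhdsWithin_le_nhds
  rw [mul_zero] at h
  exact (h.eventually (gt_mem_nhds hd)).mono fun _ h => h.le

lemma small_sq (c : ℝ) {d : ℝ} (hd : 0 < d) : ∀ᶠ ε in 𝓝[>] (0 : ℝ), c * ε ^ 2 ≤ d := by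
  have h : Tendsto (fun ε : ℝ => c * ε ^ 2) (𝓝[>] 0) (𝓝 (c * 0 ^ 2)) :=
    ((continuous_const.mul (continuous_pow 2)).tendsto 0).mono_left nhdsWithin_le_nhds
  rw [zero_pow two_ne_zero, mul_zero] at h
  exact (h.eventually (gt_mem_nhds hd)).mono fun _ h => h.le

lemma choose_R {α e : ℝ} (hα1 : α < 1) (he : 0 < e) : ∃ R : ℝ, 1 ≤ R ∧ 2 * R ^ (α - 1) ≤ e := by
  have h := (tendsto_rpow_neg_atTop (y := 1 - α) (by linarith)).const_mul 2
  rw [mul_zero] at h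
  obtain ⟨R, h1, h2⟩ := ((h.eventually (gt_mem_nhds he)).and (eventually_ge_atTop 1)).exists
  refine ⟨R, h2, ?_⟩
  rw [show α - 1 = -(1 - α) by ring]; exact h1.le

/-- choice of the high frequency -/
lemma choose_N {s g e M : ℝ} (hs : 12 < s) (hg : 0 < g) (he : 0 < e) (hM : 0 ≤ M) :
    ∃ (N : ℤ) (η : ℝ), 5 ≤ N ∧ Odd N ∧ η ^ 2 * wt s (N + 2) ^ 2 = g ∧ η ^ 2 * (2 * wt 4 (N + 2) ^ 2) ≤ e ∧ η ^ 2 * M ≤ 1 := by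
  obtain ⟨m, hm⟩ := exists_nat_ge (g * 2 / e + g * M)
  set N : ℤ := 2 * m + 5 with hN
  have hx7 : (1 : ℝ) ≤ ((N + 2 : ℤ) : ℝ) := by
    rw [hN]; push_cast; have : (0 : ℝ) ≤ m := by positivity
    linarith
  have hxm : (m : ℝ) ≤ ((N + 2 : ℤ) : ℝ) := by
    rw [hN]; push_cast; have : (0 : ℝ) ≤ m := by positivity
    linarith
  set x : ℝ := ((N + 2 : ℤ) : ℝ) with hx
  have hx0 : 0 < x := by linarith
  have hws : wt s (N + 2) = x ^ s := by unfold wt; rw [abs_of_pos hx0]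
  have hw12 : x ^ 12 ≤ x ^ s := by
    rw [← Real.rpow_natCast]; exact Real.rpow_le_rpow_of_exponent_le hx7 (by push_cast; linarith)
  have hw24 : x ^ 24 ≤ (x ^ s) ^ 2 := by
    calc x ^ 24 = (x ^ 12) ^ 2 := by ring
      _ ≤ _ := by gcongr
  have hp : 0 < x ^ s := by positivity
  have hη : Real.sqrt (g / (x ^ s) ^ 2) ^ 2 = g / (x ^ s) ^ 2 := Real.sq_sqrt (by positivity)
  have hgx : g * 2 ≤ e * x ∧ g * M ≤ x := by
    have h1 : 0 ≤ g * 2 / e := by positivity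
    have h2 : 0 ≤ g * M := by positivity
    have h3 : g * 2 / e ≤ x := by linarith
    rw [div_le_iff₀ he] at h3
    exact ⟨by linarith, by linarith⟩
  have hle : x ≤ x ^ 16 := le_self_pow₀ hx7 (by norm_num)
  have hle2 : x ≤ x ^ 24 := le_self_pow₀ hx7 (by norm_num)
  refine ⟨N, Real.sqrt (g / (x ^ s) ^ 2), by omega, ⟨m + 2, by omega⟩, ?_, ?_, ?_⟩
  · rw [hη, hws]; field_simp
  · rw [hη, wt_four, ← hx, div_mul_eq_mul_div, div_le_iff₀ (by positivity)]
    calc g * (2 * x ^ 8) = (g * 2) * x ^ 8 := by ring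
      _ ≤ (e * x) * x ^ 8 := mul_le_mul_of_nonneg_right hgx.1 (by positivity)
      _ ≤ (e * x ^ 16) * x ^ 8 := by gcongr
      _ = e * x ^ 24 := by ring
      _ ≤ _ := by gcongr
  · rw [hη, div_mul_eq_mul_div, div_le_iff₀ (by positivity)]
    linarith [hgx.2]

def ydat (N : ℤ) (η : ℝ) (k : ℤ) : ℂ := if k = 1 ∨ k = -1 then 1 else if k = N then η else if k = N + 2 then Complex.I * η else 0

section
variable {N : ℤ} {η : ℝ}

lemma ydat_supp {k : ℤ} (hk : k ∉ ({1, -1, N, N + 2} : Finset ℤ)) : ydat N η k = 0 := by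
  simp only [Finset.mem_insert, Finset.mem_singleton, not_or] at hk
  unfold ydat
  rw [if_neg (by tauto), if_neg (by tauto), if_neg (by tauto)]

lemma ydat_vals (hN : 5 ≤ N) : ydat N η 1 = 1 ∧ ydat N η (-1) = 1 ∧ ydat N η N = η ∧ ydat N η (N + 2) = Complex.I * η ∧ ydat N η (1 + 2) = 0 ∧ ydat N η (N + 2 + 2) = 0 := by
  refine ⟨?_, ?_, ?_, ?_, ?_, ?_⟩ <;> unfold ydat
  · simp
  · simp
  · rw [if_neg (by omega), if_pos rfl]
  · rw [if_neg (by omega), if_neg (by omega), if_pos rfl]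
  · rw [if_neg (by omega), if_neg (by omega), if_neg (by omega)]
  · rw [if_neg (by omega), if_neg (by omega), if_neg (by omega)]

lemma sum4 {β : Type*} [AddCommMonoid β] (hN : 5 ≤ N) (f : ℤ → β) : ∑ k ∈ ({1, -1, N, N + 2} : Finset ℤ), f k = f 1 + (f (-1) + (f N + f (N + 2))) := by
  rw [Finset.sum_insert, Finset.sum_insert, Finset.sum_insert, Finset.sum_singleton]
  · simp
  · simp only [Finset.mem_insert, Finset.mem_singleton]; omega
  · simp only [Finset.mem_insert, Finset.mem_singleton]; omega

lemma Ys_data (hN : 5 ≤ N) {S : Finset ℤ} (hS : ({1, -1, N, N + 2} : Finset ℤ) ⊆ S) (a : ℤ → ℝ) :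
    Ys S a (ydat N η) = a 1 + a (-1) + η ^ 2 * (a N + a (N + 2)) := by
  unfold Ys
  rw [← Finset.sum_subset hS (fun k _ hk => by rw [ydat_supp hk]; simp), sum4 hN]
  obtain ⟨h1, h2, h3, h4, -, -⟩ := ydat_vals (η := η) hN
  rw [h1, h2, h3, h4]
  simp only [norm_mul, Complex.norm_I, Complex.norm_real, norm_one, Real.norm_eq_abs, one_mul, sq_abs]
  ring

lemma Ff_data (hN : 5 ≤ N) {S : Finset ℤ} (hS : ({1, -1, N, N + 2} : Finset ℤ) ⊆ S) (a : ℤ → ℝ) :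
    -(Ff S 2 a (ydat N η)).im = η ^ 2 * a N := by
  unfold Ff
  rw [← Finset.sum_subset hS (fun k _ hk => by rw [ydat_supp hk]; simp), sum4 hN]
  obtain ⟨h1, h2, h3, h4, h5, h6⟩ := ydat_vals (η := η) hN
  have h7 : ydat N η (-1 + 2) = 1 := by rw [show (-1 + 2 : ℤ) = 1 by norm_num, h1]
  rw [h7, h5, h6, h2, h3, h4]
  simp
  ring
end
end

/-! Part T -/

noncomputable section
open ComplexConjugate Filter Topology

lemma wt_one (s : ℝ) : wt s 1 = 1 := by simp [wt]

lemma wt_mone (s : ℝ) : wt s (-1) = 1 := by simp [wt]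

lemma wt_le_add {s : ℝ} (hs : 0 ≤ s) {N : ℤ} (hN : 5 ≤ N) : wt s N ≤ wt s (N + 2) := by
  unfold wt
  have h : (0 : ℝ) ≤ (N : ℝ) := by exact_mod_cast (by omega : (0 : ℤ) ≤ N)
  refine Real.rpow_le_rpow (abs_nonneg _) ?_ hs
  push_cast
  rw [abs_of_nonneg h, abs_of_nonneg (by linarith)]; linarith

lemma wR_one_sq {σ R : ℝ} (hR : 1 ≤ R) : wR σ R 1 ^ 2 = 1 ∧ wR σ R (-1) ^ 2 = 1 := by
  unfold wR
  constructor <;> simp [hR]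

lemma wR_le {σ R : ℝ} (hσ : 0 ≤ σ) (hR : 1 ≤ R) (k : ℤ) : wR σ R k ^ 2 ≤ (R ^ σ) ^ 2 := by
  have h := wR_nonneg (σ := σ) hR k
  have : wR σ R k ≤ R ^ σ := Real.rpow_le_rpow (le_min (abs_nonneg _) (by linarith)) (min_le_right _ _) hσ
  gcongr

set_option maxHeartbeats 2000000 in
theorem pkg {α s δ K : ℝ} (hα : 0 < α) (hα1 : α < 1) (hs : 12 < s) (hδ : 0 < δ) (hδ1 : δ ≤ 1) (hK : 1 ≤ K) :
    ∃ (ε τ D : ℝ) (n0 : ℕ) (z : ℕ → ℝ → ℤ → ℂ), 0 < ε ∧ 0 < τ ∧ 0 ≤ D ∧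
      (∀ n, n0 ≤ n → GSol (Sn n) (lamE α ε) (Set.Icc 0 τ) (z n)) ∧
      (∀ n, n0 ≤ n → ∀ t ∈ Set.Icc 0 τ, ∀ k, ‖z n t k‖ ≤ bdec D (2 * s + 4) k) ∧
      (∀ n, n0 ≤ n → ε ^ 2 * Ys (Sn n) (fun k => wt s k ^ 2) (z n 0) ≤ δ ^ 2) ∧
      (∀ n, n0 ≤ n → K ^ 2 ≤ ε ^ 2 * Ys (Sn n) (fun k => wt s k ^ 2) (z n τ)) ∧
      (∀ n, n0 ≤ n → ∀ t ∈ Set.Icc 0 τ, ε ^ 2 * Ys (Sn n) (fun k => wt 4 k ^ 2) (z n t) ≤ (2 * δ) ^ 2) := by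
  have hs1 : 1 ≤ s := by linarith
  have hs0 : 0 ≤ s := by linarith
  obtain ⟨C, hC0, hgrow⟩ := growth hα hα1 hs1
  have h3s : (1 : ℝ) ≤ 3 ^ s := Real.one_le_rpow (by norm_num) hs0
  -- the time
  set E : ℝ := 8 * 3 ^ s * K ^ 2 / δ ^ 2 with hE
  have hE1 : 1 < E := by
    rw [hE, lt_div_iff₀ (by positivity)]
    have : δ ^ 2 ≤ 1 := by nlinarith
    have : 1 ≤ K ^ 2 := by nlinarith
    nlinarith
  set τ := Real.log E with hτ
  have hτ0 : 0 < τ := Real.log_pos hE1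
  have hexp : Real.exp τ = E := Real.exp_log (by linarith)
  have hT : τ ∈ Set.Icc 0 τ := ⟨hτ0.le, le_rfl⟩
  -- constants
  set Y : ℝ := Real.exp (CE (2 * s) * τ) * 3 with hYdef
  set A : ℝ := 257 / gam α with hA
  have hA0 : 0 < A := div_pos (by norm_num) (gam_pos hα)
  set Q : ℝ := C + 1 + 2 * 9 ^ s * Y + 2 * A with hQ
  -- choice of epsilon
  have hpos : (0 : ℝ) < δ ^ 2 / (8 * 3 ^ s) := by positivity
  obtain ⟨ε, hε, hε1, e2, e3, e4, e5, e6, e7⟩ := ((eventually_mem_nhdsWithin (a := (0:ℝ)) (s := Set.Ioi 0)).and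
    ((small_lin 1 one_pos).and ((small_sqrt (Cap α τ) one_pos).and
    ((small_sqrt (24 * (s + 1) * (100 * Cap α τ * τ)) (d := 1 / 4) (by norm_num)).and
    ((small_sqrt (480 * (5 * s * 9 ^ s) ^ 2 * Cap α τ) (d := 1 / 4) (by norm_num)).and
    ((small_sq (Bap τ) (d := (2 * δ) ^ 2) (by positivity)).and
    ((small_sq 2 (d := δ ^ 2 / 2) (by positivity)).and (small_lin Q hpos)))))))).exists
  have hε : 0 < ε := hε
  rw [one_mul] at hε1
  set ρ : ℝ := (100 * Cap α τ * τ) * Real.sqrt ε with hρ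
  have hρs : 24 * (s + 1) * ρ ≤ 1 / 4 := by rw [hρ, ← mul_assoc]; exact e3
  have hρ1 : ρ ≤ 1 := by
    by_contra h
    push Not at h
    nlinarith
  obtain ⟨R, hR, hRε⟩ := choose_R (e := ε ^ 2 / 4) hα1 (by positivity)
  have hR2 : 1 ≤ R + 2 := by linarith
  obtain ⟨N, η, hN, hNo, hη1, hη2, hη3⟩ := choose_N (s := s) (g := δ ^ 2 / (4 * ε ^ 2)) (e := ε ^ 2) (M := 2 * ((R + 2) ^ (2 * s)) ^ 2) hs (by positivity) (by positivity) (by positivity)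
  set y := ydat N η with hy
  -- data
  set p : ℝ := 2 * s + 4 with hp
  set B : ℝ := Real.exp (CE p * τ) * (wt p 1 ^ 2 + wt p (-1) ^ 2 + η ^ 2 * (wt p N ^ 2 + wt p (N + 2) ^ 2)) with hB
  set D : ℝ := Real.sqrt B with hD
  have hD0 : 0 ≤ D := Real.sqrt_nonneg _
  have hbd : ∀ᶠ n : ℕ in atTop, 2 * (64 * 3 ^ s * D / ((n : ℝ) - 1) ^ 2 * cZ) ≤ 1 := by
    have h1 : Tendsto (fun n : ℕ => ((n : ℝ) - 1) ^ 2) atTop atTop :=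
      (tendsto_pow_atTop two_ne_zero).comp (tendsto_atTop_add_const_right _ (-1) tendsto_natCast_atTop_atTop)
    have h2 := ((h1.const_div_atTop (64 * 3 ^ s * D)).mul_const cZ).const_mul 2
    rw [zero_mul, mul_zero] at h2
    exact (h2.eventually (gt_mem_nhds one_pos)).mono fun _ h => h.le
  obtain ⟨n1, hn1⟩ := eventually_atTop.1 hbd
  set n0 : ℕ := max n1 (N + 2).toNat with hn0
  have hge : ∀ n, n0 ≤ n → N + 2 ≤ n := by intro n hn; omega
  have hsub : ∀ n, n0 ≤ n → ({1, -1, N, N + 2} : Finset ℤ) ⊆ Sn n := by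
    intro n hn k hk
    have := hge n hn
    simp only [Finset.mem_insert, Finset.mem_singleton] at hk
    rw [mem_Sn, abs_le]
    rcases hk with rfl | rfl | rfl | rfl
    · exact ⟨by omega, by decide⟩
    · exact ⟨by omega, by decide⟩
    · exact ⟨by omega, hNo⟩
    · exact ⟨by omega, hNo.add_even (by decide)⟩
  have hex : ∀ n, ∃ z : ℝ → ℤ → ℂ, n0 ≤ n → GSol (Sn n) (lamE α ε) (Set.Icc 0 τ) z ∧ z 0 = y := by
    intro n
    by_cases hn : n0 ≤ n
    · obtain ⟨z, hz⟩ := galerkin (Sn n) (lamE α ε) y (fun k hk => ydat_supp (fun h => hk (hsub n hn h))) hτ0.le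
      exact ⟨z, fun _ => hz⟩
    · exact ⟨fun _ _ => 0, fun h => absurd h hn⟩
  choose z hz using hex
  have key : ∀ n, n0 ≤ n → (∀ t ∈ Set.Icc 0 τ, ∀ k ∈ Sn n, wt p k * ‖z n t k‖ ≤ D) ∧
      K ^ 2 ≤ ε ^ 2 * Ys (Sn n) (fun k => wt s k ^ 2) (z n τ) ∧
      (∀ t ∈ Set.Icc 0 τ, ε ^ 2 * Ys (Sn n) (fun k => wt 4 k ^ 2) (z n t) ≤ (2 * δ) ^ 2) := by
    intro n hn
    obtain ⟨H, H0⟩ := hz n hn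
    have h1 : (1 : ℤ) ∈ Sn n := hsub n hn (by simp)
    have hm : (-1 : ℤ) ∈ Sn n := hsub n hn (by simp)
    have hv := ydat_vals (η := η) hN
    have Dt : Dat (Sn n) ε (z n 0) := by
      rw [H0]
      refine ⟨hv.1, hv.2.1, ?_⟩
      rw [hy, Ys_data hN (hsub n hn)]
      have i1 : isP 1 := Or.inl rfl
      have i2 : isP (-1) := Or.inr rfl
      have i3 : ¬ isP N := by unfold isP; omega
      have i4 : ¬ isP (N + 2) := by unfold isP; omega
      rw [if_pos i1, if_pos i2, if_neg i3, if_neg i4]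
      refine le_trans ?_ hη2
      have := wt_le_add (s := 4) (by norm_num) hN
      have h0 := wt_nonneg 4 N
      have : wt 4 N ^ 2 ≤ wt 4 (N + 2) ^ 2 := by gcongr
      nlinarith [sq_nonneg η]
    have hW := apriori1 hα hα1 hτ0.le hε hε1 e2 Sn_odd h1 hm H Dt
    have hap2 := apriori2 hα hα1 hτ0.le hε hε1 e2 Sn_odd h1 hm H Dt
    have hap3 := apriori3 hα hα1 hτ0.le hε hε1 e2 Sn_odd h1 hm H Dt
    have hdec : ∀ t ∈ Set.Icc 0 τ, ∀ k ∈ Sn n, wt p k * ‖z n t k‖ ≤ D := by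
      intro t ht k hk
      refine decay (S := Sn n) ?_ hk
      refine (energy_est_wt Sn_odd H (σ := p) (by rw [hp]; linarith) hW t ht).trans ?_
      rw [H0, hy, Ys_data hN (hsub n hn), hB]
      refine mul_le_mul_of_nonneg_right (Real.exp_le_exp.2 (mul_le_mul_of_nonneg_left ht.2 CE_nonneg)) (by positivity)
    refine ⟨hdec, ?_, ?_⟩
    · have hg := hgrow ε R ρ Y A τ hε hε1 hR hRε hρ1 hρs (Sn n) Sn_odd h1 hm (z n) H hap3 hW ?_ ?_ (fun t ht => (hap2 t ht).1) ?_ τ hT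
      · rw [H0, hy, Ff_data hN (hsub n hn), ← hQ, hexp] at hg
        have hwN := wt_shift hs0 hNo 2 (by decide)
        have ha : δ ^ 2 / (4 * ε ^ 2) ≤ 3 ^ s * (η ^ 2 * a2 s N) := by
          rw [← hη1]
          unfold a2
          have h0 := wt_nonneg s (N + 2)
          calc η ^ 2 * wt s (N + 2) ^ 2 = η ^ 2 * (wt s (N + 2) * wt s (N + 2)) := by ring
            _ ≤ η ^ 2 * ((3 ^ s * wt s N) * wt s (N + 2)) := by gcongr
            _ = _ := by ring
        have hb : δ ^ 2 / (4 * 3 ^ s) ≤ ε ^ 2 * (η ^ 2 * a2 s N) := by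
          rw [div_le_iff₀ (by positivity)] at ha ⊢
          exact ha.trans (le_of_eq (by ring))
        calc K ^ 2 = E * (δ ^ 2 / (4 * 3 ^ s) - δ ^ 2 / (8 * 3 ^ s)) := by rw [hE]; field_simp; ring
          _ ≤ E * (ε ^ 2 * (η ^ 2 * a2 s N) - Q * ε) := by
              refine mul_le_mul_of_nonneg_left ?_ (by linarith)
              linarith
          _ = ε ^ 2 * (E * (η ^ 2 * a2 s N - Q / ε)) := by field_simp
          _ ≤ _ := mul_le_mul_of_nonneg_left hg (by positivity)
      · intro t ht
        refine le_trans ?_ e4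
        rw [mul_assoc _ (Cap α τ)]
        exact mul_le_mul_of_nonneg_left (hap2 t ht).2.2 (by positivity)
      · intro t ht
        refine (energy_est Sn_odd H (σ := 2 * s) (by linarith) hR2 hW t ht).trans ?_
        rw [H0, hy, Ys_data hN (hsub n hn), hYdef, (wR_one_sq hR2).1, (wR_one_sq hR2).2]
        refine mul_le_mul (Real.exp_le_exp.2 (mul_le_mul_of_nonneg_left ht.2 CE_nonneg)) ?_ (by positivity) (by positivity)
        have w1 := wR_le (σ := 2 * s) (by linarith) hR2 N
        have w2 := wR_le (σ := 2 * s) (by linarith) hR2 (N + 2)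
        nlinarith [sq_nonneg η]
      · intro t ht
        exact (Bd_bound hs0 (by have := hge n hn; omega) hD0 (hdec t ht) (hW t ht)).trans (hn1 n (by omega))
    · intro t ht
      refine le_trans ?_ e5
      rw [mul_comm (Bap τ)]
      exact mul_le_mul_of_nonneg_left (hap2 t ht).2.1 (by positivity)
  refine ⟨ε, τ, D, n0, z, hε, hτ0, hD0, fun n hn => (hz n hn).1, ?_, ?_, fun n hn => (key n hn).2.1, fun n hn => (key n hn).2.2⟩
  · intro n hn t ht k
    exact bdec_of hD0 ((hz n hn).1.supp t) ((key n hn).1 t ht) k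
  · intro n hn
    rw [(hz n hn).2, hy, Ys_data hN (hsub n hn), wt_one, wt_mone]
    have hl := wt_le_add hs0 hN
    have h0 := wt_nonneg s N
    have hl2 : wt s N ^ 2 ≤ wt s (N + 2) ^ 2 := by gcongr
    have h5 : η ^ 2 * (wt s N ^ 2 + wt s (N + 2) ^ 2) ≤ 2 * (δ ^ 2 / (4 * ε ^ 2)) := by
      rw [← hη1]; nlinarith [sq_nonneg η]
    calc ε ^ 2 * (1 ^ 2 + 1 ^ 2 + η ^ 2 * (wt s N ^ 2 + wt s (N + 2) ^ 2)) ≤ ε ^ 2 * (2 + 2 * (δ ^ 2 / (4 * ε ^ 2))) := by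
          refine mul_le_mul_of_nonneg_left ?_ (by positivity)
          linarith
      _ = 2 * ε ^ 2 + δ ^ 2 / 2 := by field_simp; ring
      _ ≤ δ ^ 2 := by linarith
end

/-! Part V -/

noncomputable section
open ComplexConjugate Filter Topology

lemma lamE_bd {α ε : ℝ} (hα : 0 < α) (hα1 : α < 1) (hε : 0 < ε) (k : ℤ) (hk : Odd k) :
    |lamE α ε k| ≤ (2 * (ε ^ 2)⁻¹ + 1) * |(k : ℝ)| := by
  have h1 := odd_abs_ge hk
  have h2 : |(k : ℝ)| ^ α ≤ |(k : ℝ)| := by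
    calc |(k : ℝ)| ^ α ≤ |(k : ℝ)| ^ (1 : ℝ) := Real.rpow_le_rpow_of_exponent_le h1 hα1.le
      _ = _ := Real.rpow_one _
  have h3 : 0 ≤ |(k : ℝ)| ^ α := by positivity
  have he : 0 < (ε ^ 2)⁻¹ := by positivity
  unfold lamE
  refine (abs_sub _ _).trans ?_
  rw [abs_mul, abs_of_pos he]
  have h4 : |1 - |(k : ℝ)| ^ α| ≤ 2 * |(k : ℝ)| := by rw [abs_le]; constructor <;> linarith
  have := mul_le_mul_of_nonneg_left h4 he.le
  linarith

theorem final_aux {α : ℝ} (hα : 0 < α) (hα1 : α < 1) {s : ℝ} (hs : 12 < s) {δ K : ℝ} (hδ : 0 < δ) (hδ1 : δ ≤ 1) (hK : 1 ≤ K) :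
    ∃ T : ℝ, 0 < T ∧ ∃ u : ℝ → ℤ → ℂ,
          IsFourierSolution α (Set.Icc 0 T) u ∧
          (∀ t ∈ Set.Icc (0 : ℝ) T, HasSobNorm s (u t)) ∧
          sobNorm s (u 0) ≤ δ ∧
          K ≤ sobNorm s (u T) ∧
          (∀ t ∈ Set.Icc (0 : ℝ) T, sobNorm 4 (u t) ≤ 2 * δ) := by
  obtain ⟨ε, τ, D, n0, z, hε, hτ, hD, H, hz, g1, g2, g3⟩ := pkg hα hα1 hs hδ hδ1 hK
  have hb0 : Summable (bdec D (2 * s + 4)) := by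
    refine (bdec_sum (q := 0) (p := 2 * s + 4) hD (by linarith)).congr fun k => ?_
    rw [Real.rpow_zero, one_mul]
  have hb2 : Summable fun k : ℤ => (k : ℝ) ^ 2 * bdec D (2 * s + 4) k := by
    refine (bdec_sum (q := 2) (p := 2 * s + 4) hD (by linarith)).of_nonneg_of_le
      (fun k => mul_nonneg (by positivity) (bdec_nonneg hD k)) fun k => mul_le_mul_of_nonneg_right ?_ (bdec_nonneg hD k)
    rw [Real.rpow_two, ← sq_abs (k : ℝ)]
    exact pow_le_pow_left₀ (abs_nonneg _) (le_max_right _ _) 2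
  obtain ⟨Z, U, hU, hUat, hZ, hsol⟩ := limit_pass (Λ := 2 * (ε ^ 2)⁻¹ + 1) (by positivity) (lamE_bd hα hα1 hε) (bdec_nonneg hD) hb0 hb2 H hz
  have hev : ∀ᶠ n in U, n0 ≤ n := hUat (eventually_ge_atTop n0)
  have he2 : 0 < ε ^ 2 := by positivity
  have hlim : ∀ σ, σ ≤ s → ∀ t ∈ Set.Icc 0 τ, HasSobNorm σ (Z t) ∧
      Tendsto (fun n => ε ^ 2 * Ys (Sn n) (fun k => wt σ k ^ 2) (z n t)) U (𝓝 (ε ^ 2 * sobNormSq σ (Z t))) := by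
    intro σ hσ t ht
    obtain ⟨a, b⟩ := sob_lim (U := U) (z := fun n => z n t) (Z := Z t) (σ := σ) (p := 2 * s + 4) hD (by linarith)
      (by filter_upwards [hev] with n hn using hz n hn t ht) (hZ t ht)
    refine ⟨a, (b.const_mul _).congr' ?_⟩
    filter_upwards [hev] with n hn
    rw [sob_Ys σ ((H n hn).supp t)]
  have hmap : ∀ t ∈ Set.Icc 0 (τ / ε ^ 2), ε ^ 2 * t ∈ Set.Icc 0 τ := by
    intro t ht
    refine ⟨mul_nonneg he2.le ht.1, ?_⟩
    have := ht.2
    rw [le_div_iff₀ he2] at this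
    linarith
  have hT0 : (0 : ℝ) ∈ Set.Icc 0 τ := ⟨le_rfl, hτ.le⟩
  have hTT : τ ∈ Set.Icc 0 τ := ⟨hτ.le, le_rfl⟩
  refine ⟨τ / ε ^ 2, by positivity, ured ε Z, ured_sol hε hsol, ?_, ?_, ?_, ?_⟩
  · intro t ht
    exact ured_has hε Z t s (hlim s le_rfl _ (hmap t ht)).1
  · unfold sobNorm
    rw [ured_sob hε, mul_zero]
    refine Real.sqrt_le_iff.2 ⟨hδ.le, le_of_tendsto (hlim s le_rfl 0 hT0).2 ?_⟩
    filter_upwards [hev] with n hn using g1 n hn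
  · unfold sobNorm
    rw [ured_sob hε, mul_div_cancel₀ _ he2.ne']
    refine Real.le_sqrt_of_sq_le (ge_of_tendsto (hlim s le_rfl τ hTT).2 ?_)
    filter_upwards [hev] with n hn using g2 n hn
  · intro t ht
    unfold sobNorm
    rw [ured_sob hε]
    refine Real.sqrt_le_iff.2 ⟨by linarith, le_of_tendsto (hlim 4 (by linarith) _ (hmap t ht)).2 ?_⟩
    filter_upwards [hev] with n hn using g3 n hn _ (hmap t ht)
end

/-- Sobolev norm explosion for the quasilinear Schrödinger equation
`∂ₜ u = -i|D|^α u + |u|² u_x` on the torus, `α ∈ (0,1)`. -/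
theorem sobolev_norm_explosion (α : ℝ) (hα₀ : 0 < α) (hα₁ : α < 1) :
    ∃ s₀ : ℝ, 3 / 2 < s₀ ∧
      ∀ s : ℝ, 3 * s₀ < s → ∀ δ : ℝ, 0 < δ → δ ≤ 1 → ∀ K : ℝ, 1 ≤ K →
        ∃ T : ℝ, 0 < T ∧ ∃ u : ℝ → ℤ → ℂ,
          IsFourierSolution α (Set.Icc 0 T) u ∧
          (∀ t ∈ Set.Icc (0 : ℝ) T, HasSobNorm s (u t)) ∧
          sobNorm s (u 0) ≤ δ ∧
          K ≤ sobNorm s (u T) ∧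
          (∀ t ∈ Set.Icc (0 : ℝ) T, sobNorm s₀ (u t) ≤ 2 * δ) := by
  refine ⟨4, by norm_num, fun s hs δ hδ hδ1 K hK => ?_⟩
  exact final_aux hα₀ hα₁ (by linarith) hδ hδ1 hK

end
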